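/- Let ℓ be a positive integer, let A_ℓ = {(a₁,…,a_ℓ) ∈ ℕ^ℓ : a₁ < a₂ < … < a_ℓ}, and let G ⊆ A_ℓ be arbitrary. Then there exists an infinite set R of positive integers such that for every (a₁,…,a_ℓ) ∈ A_ℓ, the set R is good for recurrence along the sequence (n^{a₁},…,n^{a_ℓ}) if and only if (a₁,…,a_ℓ) ∈ G. -/

import Mathlib

open Filter MeasureTheory

/-- A set `R` of positive integers is good for recurrence along the sequence
`(u₁(n), …, u_ℓ(n))` if for every invertible measure preserving system and every
measurable set `A` of positive measure there are infinitely many `r ∈ R` with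
`μ(A ∩ T^{-u₁(r)}A ∩ … ∩ T^{-u_ℓ(r)}A) > 0`. -/
def GoodForRecurrenceAlong (ℓ : ℕ) (u : Fin ℓ → ℕ → ℤ) (R : Set ℕ) : Prop :=
  ∀ (X : Type) (_ : MeasurableSpace X) (μ : Measure X),
    IsProbabilityMeasure μ →
    ∀ T : X ≃ᵐ X, MeasurePreserving (⇑T) μ μ →
    ∀ A : Set X, MeasurableSet A → 0 < μ A →
      {r : ℕ | r ∈ R ∧
        0 < μ (A ∩ ⋂ i : Fin ℓ, (⇑(T.toEquiv ^ (u i r))) ⁻¹' A)}.Infinite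

open scoped BigOperators

/-- An abstract ergodic system: a commutative `*`-algebra `𝓐` of bounded observables with a unit
ball `B`, an invariant integral, a `ℤ`-action by `*`-homomorphisms, and an invariant mean `m` on
complex sequences. -/
structure ErgSys (𝓐 : Type*) [CommRing 𝓐] [StarRing 𝓐] [Algebra ℂ 𝓐] [StarModule ℂ 𝓐] where
  B : 𝓐 → Prop
  B_one : B 1
  B_mul : ∀ {f g}, B f → B g → B (f * g)
  B_star : ∀ {f}, B f → B (star f)
  B_sum : ∀ {ι : Type} (s : Finset ι) (c : ι → ℂ) (f : ι → 𝓐), (∀ i ∈ s, B (f i)) →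
    ∑ i ∈ s, ‖c i‖ ≤ 1 → B (∑ i ∈ s, c i • f i)
  int : 𝓐 →ₗ[ℂ] ℂ
  sh : ℤ → 𝓐 →⋆ₐ[ℂ] 𝓐
  sh_zero : ∀ f, sh 0 f = f
  sh_add : ∀ a b f, sh (a + b) f = sh a (sh b f)
  B_sh : ∀ {f} a, B f → B (sh a f)
  int_sh : ∀ a f, int (sh a f) = int f
  int_star : ∀ f, int (star f) = star (int f)
  int_one : int 1 = 1
  int_le : ∀ {f}, B f → ‖int f‖ ≤ 1
  int_cs : ∀ {b g}, B b → B g → ‖int (b * g)‖ ^ 2 ≤ (int (g * star g)).re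
  m : (ℕ → ℂ) →ₗ[ℂ] ℂ
  m_one : m 1 = 1
  m_le : ∀ {u : ℕ → ℂ} {c : ℝ}, (∀ n, ‖u n‖ ≤ c) → ‖m u‖ ≤ c
  m_mono : ∀ {u v : ℕ → ℂ}, (∀ n, ‖u n‖ ≤ 1) → (∀ n, ‖v n‖ ≤ 1) → (∀ n, (u n).re ≤ (v n).re) →
    (m u).re ≤ (m v).re
  m_shift : ∀ {u : ℕ → ℂ}, (∀ n, ‖u n‖ ≤ 1) → m (fun n => u (n + 1)) = m u
  m_cs : ∀ {u : ℕ → ℂ}, (∀ n, ‖u n‖ ≤ 1) → ‖m u‖ ^ 2 ≤ (m (fun n => ((‖u n‖ ^ 2 : ℝ) : ℂ))).re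
  dual : ∀ u : ℕ → 𝓐, (∀ n, B (u n)) →
    ∃ F, B F ∧ ∀ g, int (g * F) = m (fun n => int (g * u n))
  eig_unique : ∀ (l : ℂ) (χ ρ : 𝓐), ‖l‖ = 1 → B χ → B ρ →
    (∀ f, int (f * sh 1 χ) = l * int (f * χ)) → (∀ f, int (f * (χ * star χ)) = int f) →
    (∀ f, int (f * sh 1 ρ) = l * int (f * ρ)) → (∀ f, int (f * (ρ * star ρ)) = int f) →
    ∀ f, ‖int (f * χ)‖ = ‖int (f * ρ)‖
  eig_extract : ∀ (l : ℂ) (g : 𝓐) (δ : ℝ), ‖l‖ = 1 → B g → 0 < δ →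
    (∀ j : ℕ, δ ^ 2 ≤ (int ((∑ k ∈ Finset.range j.factorial,
        ((j.factorial : ℂ)⁻¹ * (star l) ^ k) • sh k g) *
      star (∑ k ∈ Finset.range j.factorial,
        ((j.factorial : ℂ)⁻¹ * (star l) ^ k) • sh k g))).re) →
    ∃ χ, B χ ∧ (∀ f, int (f * sh 1 χ) = l * int (f * χ)) ∧
      (∀ f, int (f * (χ * star χ)) = int f) ∧ δ ≤ ‖int (g * star χ)‖

namespace ErgSys

variable {𝓐 : Type*} [CommRing 𝓐] [StarRing 𝓐] [Algebra ℂ 𝓐] [StarModule ℂ 𝓐] (X : ErgSys 𝓐)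

/-- Unimodular eigenfunctions, in the weak sense. -/
def Eig (l : ℂ) (χ : 𝓐) : Prop :=
  ‖l‖ = 1 ∧ X.B χ ∧ (∀ f, X.int (f * X.sh 1 χ) = l * X.int (f * χ)) ∧
    ∀ f, X.int (f * (χ * star χ)) = X.int f

/-- Joint mean over time and space. -/
noncomputable def Φ : (ℕ → 𝓐) →ₗ[ℂ] ℂ := X.m ∘ₗ X.int.compLeft ℕ

variable {X}

theorem Φ_apply (u : ℕ → 𝓐) : X.Φ u = X.m (fun n => X.int (u n)) := rfl

theorem B_smul {c : ℂ} {f : 𝓐} (hc : ‖c‖ ≤ 1) (hf : X.B f) : X.B (c • f) := by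
  have := X.B_sum {()} (fun _ => c) (fun _ => f) (by simpa using hf) (by simpa using hc)
  simpa using this

theorem B_avg {ι : Type} [Fintype ι] (f : ι → 𝓐) (hf : ∀ i, X.B (f i)) :
    X.B ((Fintype.card ι : ℂ)⁻¹ • ∑ i, f i) := by
  rw [Finset.smul_sum]
  refine X.B_sum _ _ _ (fun i _ => hf i) ?_
  simp only [norm_inv, Complex.norm_natCast, Finset.sum_const, Finset.card_univ, nsmul_eq_mul]
  exact mul_inv_le_one

theorem B_prod_list (l : List 𝓐) (h : ∀ f ∈ l, X.B f) : X.B l.prod := by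
  induction l with
  | nil => simpa using X.B_one
  | cons a l ih =>
    simp only [List.prod_cons]
    exact X.B_mul (h _ (by simp)) (ih fun f hf => h f (by simp [hf]))

theorem Φ_le {u : ℕ → 𝓐} (hu : ∀ n, X.B (u n)) : ‖X.Φ u‖ ≤ 1 :=
  X.m_le fun n => X.int_le (hu n)

theorem Φ_sh (a : ℕ → ℤ) (u : ℕ → 𝓐) : X.Φ (fun n => X.sh (a n) (u n)) = X.Φ u := by
  simp only [Φ_apply, X.int_sh]

theorem Φ_shift {u : ℕ → 𝓐} (hu : ∀ n, X.B (u n)) (h : ℕ) :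
    X.Φ (fun n => u (n + h)) = X.Φ u := by
  induction h with
  | zero => rfl
  | succ h ih =>
    rw [← ih]
    have := X.m_shift (u := fun n => X.int (u (n + h))) fun n => X.int_le (hu _)
    simp only [Φ_apply]
    rw [← this]
    congr 1; ext n; congr 2; ring

theorem Φ_cs {b y : ℕ → 𝓐} (hb : ∀ n, X.B (b n)) (hy : ∀ n, X.B (y n)) :
    ‖X.Φ (b * y)‖ ^ 2 ≤ (X.Φ (y * star y)).re := by
  have h1 : ∀ n, ‖X.int ((b * y) n)‖ ≤ 1 := fun n => X.int_le (X.B_mul (hb n) (hy n))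
  refine (X.m_cs h1).trans (X.m_mono ?_ ?_ ?_)
  · intro n
    rw [Complex.norm_real, Real.norm_of_nonneg (by positivity)]
    exact pow_le_one₀ (norm_nonneg _) (h1 n)
  · intro n
    exact X.int_le (X.B_mul (hy n) (X.B_star (hy n)))
  · intro n
    rw [Complex.ofReal_re]
    exact X.int_cs (hb n) (hy n)

theorem box_cs {ι : Type} [Fintype ι] {b : ℕ → 𝓐} (hb : ∀ n, X.B (b n)) {x : ι → ℕ → 𝓐}
    (hx : ∀ i n, X.B (x i n)) :
    ‖𝔼 i, X.Φ (b * x i)‖ ^ 2 ≤ (𝔼 i, 𝔼 j, X.Φ (x i * star (x j))).re := by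
  set y : ℕ → 𝓐 := (Fintype.card ι : ℂ)⁻¹ • ∑ i, x i with hy
  have h1 : 𝔼 i, X.Φ (b * x i) = X.Φ (b * y) := by
    rw [Fintype.expect_eq_sum_div_card, hy, mul_smul_comm, map_smul, Finset.mul_sum, map_sum,
      smul_eq_mul, div_eq_inv_mul]
  have h2 : X.Φ (y * star y) = 𝔼 i, 𝔼 j, X.Φ (x i * star (x j)) := by
    simp only [Fintype.expect_eq_sum_div_card]
    rw [hy, star_smul, star_sum, smul_mul_smul_comm, map_smul, Finset.sum_mul_sum, map_sum,
      ← Finset.sum_div, div_div, div_eq_inv_mul]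
    simp [map_sum]
  have hyB : ∀ n, X.B (y n) := by
    intro n
    have := B_avg (X := X) (fun i => x i n) (fun i => hx i n)
    simpa [hy] using this
  rw [h1, ← h2]
  exact Φ_cs hb hyB

/-- Van der Corput inequality. -/
theorem vdc {g : 𝓐} (hg : X.B g) {u : ℕ → 𝓐} (hu : ∀ n, X.B (u n)) (H : ℕ) (hH : 0 < H) :
    ‖X.Φ (fun n => g * u n)‖ ^ 2 ≤
      𝔼 h : Fin H, 𝔼 k : Fin H, ‖X.Φ (fun n => u (n + h) * star (u (n + k)))‖ := by
  have : Nonempty (Fin H) := ⟨⟨0, hH⟩⟩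
  have := box_cs (X := X) (b := fun _ => g) (fun _ => hg) (x := fun (h : Fin H) n => u (n + h))
    (fun i n => hu _)
  have h2 : ∀ h : Fin H, X.Φ ((fun _ => g) * fun n => u (n + h)) = X.Φ (fun n => g * u n) :=
    fun h => Φ_shift (u := fun n => g * u n) (fun n => X.B_mul hg (hu n)) h
  simp only [h2, Fintype.expect_const] at this
  refine this.trans ((Complex.re_le_norm _).trans ?_)
  refine (RCLike.norm_expect_le (K := ℂ)).trans (Finset.expect_le_expect fun i _ => ?_)
  exact RCLike.norm_expect_le (K := ℂ)

/-- From a lower bound for an average of numbers in `[0,1]`, many terms are large. -/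
theorem expect_boole_of_le {ι : Type*} [Fintype ι] [Nonempty ι] {a : ι → ℝ} (h1 : ∀ i, a i ≤ 1)
    {ε : ℝ} (hε : 0 ≤ ε) (h : ε ≤ 𝔼 i, a i) :
    ε / 2 ≤ 𝔼 i, (if ε / 2 ≤ a i then (1 : ℝ) else 0) := by
  have : 𝔼 i, a i ≤ 𝔼 i, ((if ε / 2 ≤ a i then (1 : ℝ) else 0) + ε / 2) := by
    refine Finset.expect_le_expect fun i _ => ?_
    split_ifs with hi
    · linarith [h1 i]
    · linarith [not_le.1 hi]
  rw [Finset.expect_add_distrib, Fintype.expect_const] at this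
  linarith

/-- Van der Corput, choosing one pair that avoids a sparse set of bad pairs. -/
theorem vdc_pair {ε : ℝ} (hε : 0 < ε) (H b : ℕ) (hH : 0 < H) (hb : 2 * b < ε ^ 2 * H)
    {bad : Fin H → Fin H → Prop}
    (hbad : ∀ k, ∃ s : Finset (Fin H), s.card ≤ b ∧ ∀ h, bad h k → h ∈ s)
    {g : 𝓐} (hg : X.B g) {u : ℕ → 𝓐} (hu : ∀ n, X.B (u n))
    (h : ε ≤ ‖X.Φ (fun n => g * u n)‖) :
    ∃ h k : Fin H, ¬ bad h k ∧
      ε ^ 2 / 2 ≤ ‖X.Φ (fun n => u (n + h) * star (u (n + k)))‖ := by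
  by_contra! hcon
  have : Nonempty (Fin H) := ⟨⟨0, hH⟩⟩
  have h1 := vdc hg hu H hH
  have h2 : ε ^ 2 ≤ ‖X.Φ (fun n => g * u n)‖ ^ 2 := by gcongr
  have h3 := h2.trans h1
  rw [Finset.expect_comm] at h3
  have key : ∀ k : Fin H, 𝔼 h : Fin H, ‖X.Φ (fun n => u (n + h) * star (u (n + k)))‖
      < ε ^ 2 := by
    intro k
    obtain ⟨s, hs, hsb⟩ := hbad k
    have hle : ∀ h : Fin H, ‖X.Φ (fun n => u (n + h) * star (u (n + k)))‖ ≤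
        (if h ∈ s then 1 else 0) + ε ^ 2 / 2 := by
      intro h
      by_cases hh : h ∈ s
      · simp only [hh, if_true]
        have := Φ_le (X := X) (u := fun n => u (n + h) * star (u (n + k)))
          (fun n => X.B_mul (hu _) (X.B_star (hu _)))
        nlinarith [sq_nonneg ε]
      · simp only [hh, if_false, zero_add]
        exact (hcon h k (fun hb => hh (hsb h hb))).le
    refine (Finset.expect_le_expect fun h _ => hle h).trans_lt ?_
    rw [Finset.expect_add_distrib, Fintype.expect_const, Fintype.expect_eq_sum_div_card]
    simp only [Finset.sum_ite_mem, Finset.univ_inter, Finset.sum_const, nsmul_eq_mul, mul_one,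
      Fintype.card_fin]
    have hH' : (0 : ℝ) < H := by exact_mod_cast hH
    have : (s.card : ℝ) / H < ε ^ 2 / 2 := by
      rw [div_lt_iff₀ hH']
      have : (s.card : ℝ) ≤ b := by exact_mod_cast hs
      nlinarith
    linarith
  have := Finset.exists_le_of_le_expect (s := (Finset.univ : Finset (Fin H))) Finset.univ_nonempty h3
  obtain ⟨k, -, hk⟩ := this
  exact absurd (key k) (not_lt.2 hk)

end ErgSys

/-- The discrete box with side lengths `L`. -/
def Idx : List ℕ → Type
  | [] => Unit
  | H :: L => Fin H × Idx L

namespace Idx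

set_option linter.unusedSectionVars false

instance instFintype : (L : List ℕ) → Fintype (Idx L)
  | [] => inferInstanceAs (Fintype Unit)
  | H :: L => letI := instFintype L; inferInstanceAs (Fintype (Fin H × Idx L))

/-- Prepend a coordinate. -/
def cons {H : ℕ} {L : List ℕ} (i : Fin H) (k : Idx L) : Idx (H :: L) := (i, k)

/-- First coordinate. -/
def fst {H : ℕ} {L : List ℕ} (h : Idx (H :: L)) : Fin H := Prod.fst h

/-- Remaining coordinates. -/
def snd {H : ℕ} {L : List ℕ} (h : Idx (H :: L)) : Idx L := Prod.snd h

@[simp] theorem fst_cons {H : ℕ} {L : List ℕ} (i : Fin H) (k : Idx L) : (cons i k).fst = i := rfl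

@[simp] theorem snd_cons {H : ℕ} {L : List ℕ} (i : Fin H) (k : Idx L) : (cons i k).snd = k := rfl

@[simp] theorem cons_eta {H : ℕ} {L : List ℕ} (h : Idx (H :: L)) : cons h.fst h.snd = h := rfl

theorem nonempty : ∀ (L : List ℕ), (∀ H ∈ L, 0 < H) → Nonempty (Idx L)
  | [], _ => ⟨()⟩
  | H :: L, h => by
    obtain ⟨k⟩ := nonempty L fun K hK => h K (by simp [hK])
    exact ⟨cons ⟨0, h H (by simp)⟩ k⟩

/-- The sum of the coordinates. -/
def tot : {L : List ℕ} → Idx L → ℕ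
  | [], _ => 0
  | _ :: _, h => h.fst + tot h.snd

theorem expect_cons {M : Type*} [AddCommMonoid M] [Module ℚ≥0 M] (H : ℕ) (L : List ℕ)
    (f : Idx (H :: L) → M) : 𝔼 h, f h = 𝔼 i : Fin H, 𝔼 k : Idx L, f (cons i k) :=
  Finset.expect_product (Finset.univ : Finset (Fin H)) (Finset.univ : Finset (Idx L)) f

variable {M N : Type*} [CommRing M] [StarRing M] [CommRing N] [StarRing N]

/-- The alternating product of `g` over the vertices of the parallelepiped spanned by `h, h'`. -/
def cube : (L : List ℕ) → (Idx L → M) → Idx L → Idx L → M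
  | [], g, _, _ => g ()
  | _ :: L, g, h, h' => cube L (fun k => g (cons h.fst k) * star (g (cons h'.fst k))) h.snd h'.snd

theorem cube_cons (H : ℕ) (L : List ℕ) (g : Idx (H :: L) → M) (h h' : Idx (H :: L)) :
    cube (H :: L) g h h' = cube L (fun k => g (cons h.fst k) * star (g (cons h'.fst k))) h.snd h'.snd := rfl

theorem cube_mul : ∀ (L : List ℕ) (g₁ g₂ : Idx L → M) (h h' : Idx L),
    cube L (fun k => g₁ k * g₂ k) h h' = cube L g₁ h h' * cube L g₂ h h'
  | [], _, _, _, _ => rfl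
  | _ :: L, g₁, g₂, h, h' => by
    rw [cube_cons, cube_cons, cube_cons, ← cube_mul L]
    congr 1; ext k; rw [star_mul']; ring

theorem cube_star : ∀ (L : List ℕ) (g : Idx L → M) (h h' : Idx L),
    cube L (fun k => star (g k)) h h' = star (cube L g h h')
  | [], _, _, _ => rfl
  | _ :: L, g, h, h' => by
    rw [cube_cons, cube_cons, ← cube_star L]
    congr 1; ext k; rw [star_mul']

theorem cube_map {F : Type*} [FunLike F M N] [MulHomClass F M N] [StarHomClass F M N] (φ : F) :
    ∀ (L : List ℕ) (g : Idx L → M) (h h' : Idx L),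
    cube L (fun k => φ (g k)) h h' = φ (cube L g h h')
  | [], _, _, _ => rfl
  | _ :: L, g, h, h' => by
    rw [cube_cons, cube_cons, ← cube_map φ L]
    congr 1; ext k; rw [map_mul, map_star]

theorem cube_pred (P : M → Prop) (hm : ∀ a b, P a → P b → P (a * b)) (hs : ∀ a, P a → P (star a)) :
    ∀ (L : List ℕ) (g : Idx L → M) (h h' : Idx L), (∀ k, P (g k)) → P (cube L g h h')
  | [], _, _, _, hg => hg _
  | _ :: L, _, h, h', hg => cube_pred P hm hs L _ h.snd h'.snd fun _ => hm _ _ (hg _) (hs _ (hg _))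

theorem cube_cons' (H : ℕ) (L : List ℕ) (g : Idx (H :: L) → M) (h h' : Idx (H :: L)) :
    cube (H :: L) g h h' = cube L (fun k => g (cons h.fst k)) h.snd h'.snd *
      star (cube L (fun k => g (cons h'.fst k)) h.snd h'.snd) := by
  rw [cube_cons, cube_mul, ← cube_star]

/-- The factors of `cube` other than the one at the vertex `h`. -/
def rest : (L : List ℕ) → (Idx L → M) → Idx L → Idx L → M
  | [], _, _, _ => 1
  | _ :: L, g, h, h' => star (cube L (fun k => g (cons h'.fst k)) h.snd h'.snd) *
      rest L (fun k => g (cons h.fst k)) h.snd h'.snd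

theorem cube_eq : ∀ (L : List ℕ) (g : Idx L → M) (h h' : Idx L),
    cube L g h h' = g h * rest L g h h'
  | [], g, h, h' => (mul_one (g ())).symm
  | _ :: L, g, h, h' => by
    rw [cube_cons', cube_eq L (fun k => g (cons h.fst k)), rest]
    rw [cons_eta]; ring

/-- Functions on the box that are products of functions each missing one coordinate. -/
def Low (P : M → Prop) : (L : List ℕ) → (Idx L → M) → Prop
  | [], b => b = fun _ => 1
  | H :: L, b => ∃ (b₀ : Idx L → M) (b₁ : Fin H → Idx L → M), (∀ k, P (b₀ k)) ∧
      (∀ i, Low P L (b₁ i)) ∧ ∀ i k, b (cons i k) = b₀ k * b₁ i k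

theorem Low.mul {P : M → Prop} (hm : ∀ a b, P a → P b → P (a * b)) : ∀ {L : List ℕ}
    {b c : Idx L → M}, Low P L b → Low P L c → Low P L (fun k => b k * c k)
  | [], b, c, hb, hc => by
    simp only [Low] at hb hc ⊢; simp [hb, hc]
  | H :: L, b, c, ⟨b₀, b₁, h0, h1, h2⟩, ⟨c₀, c₁, g0, g1, g2⟩ =>
    ⟨fun k => b₀ k * c₀ k, fun i k => b₁ i k * c₁ i k, fun k => hm _ _ (h0 k) (g0 k),
      fun i => (h1 i).mul hm (g1 i), fun i k => by dsimp only; rw [h2, g2]; ring⟩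

theorem Low.star {P : M → Prop} (hs : ∀ a, P a → P (star a)) : ∀ {L : List ℕ}
    {b : Idx L → M}, Low P L b → Low P L (fun k => star (b k))
  | [], b, hb => by
    simp only [Low] at hb ⊢; simp [hb]
  | H :: L, b, ⟨b₀, b₁, h0, h1, h2⟩ =>
    ⟨fun k => Star.star (b₀ k), fun i k => Star.star (b₁ i k), fun k => hs _ (h0 k),
      fun i => (h1 i).star hs, fun i k => by dsimp only; rw [h2, star_mul']⟩

theorem Low.pred {P : M → Prop} (h1 : P 1) (hm : ∀ a b, P a → P b → P (a * b)) : ∀ {L : List ℕ}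
    {b : Idx L → M}, Low P L b → ∀ k, P (b k)
  | [], b, hb, k => by
    simp only [Low] at hb; simpa [hb] using h1
  | H :: L, b, ⟨b₀, b₁, h0, hb1, h2⟩, k => by
    have := h2 k.fst k.snd
    rw [cons_eta] at this
    rw [this]
    exact hm _ _ (h0 _) ((hb1 _).pred h1 hm _)

theorem low_rest {P : M → Prop} (hm : ∀ a b, P a → P b → P (a * b)) (hs : ∀ a, P a → P (star a)) :
    ∀ (L : List ℕ) (g : Idx L → M) (h' : Idx L), (∀ k, P (g k)) →
      Low P L (fun h => rest L g h h')
  | [], _, _, _ => rfl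
  | _ :: L, g, h', hg => ⟨fun k => Star.star (cube L (fun k => g (cons h'.fst k)) k h'.snd),
      fun i k => rest L (fun k => g (cons i k)) k h'.snd,
      fun k => hs _ (cube_pred P hm hs L _ k h'.snd fun _ => hg _),
      fun _ => low_rest hm hs L _ h'.snd fun _ => hg _, fun _ _ => rfl⟩

end Idx

theorem expect_pow_le {ι : Type*} [Fintype ι] [Nonempty ι] {a : ι → ℝ} (ha : ∀ i, 0 ≤ a i)
    (n : ℕ) : (𝔼 i, a i) ^ n ≤ 𝔼 i, a i ^ n := by
  have hc : (0 : ℝ) < Fintype.card ι := by exact_mod_cast Fintype.card_pos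
  have := Real.pow_arith_mean_le_arith_mean_pow Finset.univ (fun _ => (Fintype.card ι : ℝ)⁻¹) a
    (fun _ _ => by positivity) (by simp) (fun i _ => ha i) n
  rw [← Finset.mul_sum, ← Finset.mul_sum] at this
  rw [Fintype.expect_eq_sum_div_card, Fintype.expect_eq_sum_div_card, div_eq_inv_mul,
    div_eq_inv_mul]
  exact this

namespace ErgSys

open Idx

variable {𝓐 : Type*} [CommRing 𝓐] [StarRing 𝓐] [Algebra ℂ 𝓐] [StarModule ℂ 𝓐] {X : ErgSys 𝓐}

/-- Gowers–Cauchy–Schwarz inequality for boxes. -/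
theorem gowers_cs : ∀ (L : List ℕ), (∀ H ∈ L, 0 < H) → ∀ (b g : Idx L → ℕ → 𝓐),
    Low (fun u : ℕ → 𝓐 => ∀ n, X.B (u n)) L b → (∀ h n, X.B (g h n)) →
    ‖𝔼 h, X.Φ (b h * g h)‖ ^ 2 ^ L.length ≤ 𝔼 h, 𝔼 h', ‖X.Φ (cube L g h h')‖
  | [], _, b, g, hb, hg => by
    simp only [Low] at hb
    subst hb
    have : ∀ f : Idx [] → ℝ, 𝔼 h, f h = f () := fun f => Finset.expect_singleton f ()
    have h2 : ∀ f : Idx [] → ℂ, 𝔼 h, f h = f () := fun f => Finset.expect_singleton f ()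
    rw [this, this, h2]
    simp [cube]
  | H :: L, hL, b, g, ⟨b₀, b₁, h0, h1, h2⟩, hg => by
    have hH : 0 < H := hL H (by simp)
    have hL' : ∀ K ∈ L, 0 < K := fun K hK => hL K (by simp [hK])
    have : Nonempty (Fin H) := ⟨⟨0, hH⟩⟩
    have : Nonempty (Idx L) := nonempty L hL'
    have hb1 : ∀ i k n, X.B (b₁ i k n) := fun i k =>
      (h1 i).pred (fun _ => X.B_one) (fun _ _ ha hb n => X.B_mul (ha n) (hb n)) k
    set y : Fin H → Fin H → ℂ := fun i j => 𝔼 k : Idx L,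
      X.Φ ((b₁ i k * star (b₁ j k)) * (g (cons i k) * star (g (cons j k)))) with hy
    have step : ‖𝔼 h, X.Φ (b h * g h)‖ ^ 2 ≤ 𝔼 i, 𝔼 j, ‖y i j‖ := by
      rw [expect_cons, Finset.expect_comm]
      calc ‖𝔼 k : Idx L, 𝔼 i : Fin H, X.Φ (b (cons i k) * g (cons i k))‖ ^ 2
          ≤ (𝔼 k : Idx L, ‖𝔼 i : Fin H, X.Φ (b (cons i k) * g (cons i k))‖) ^ 2 := by
            gcongr; exact RCLike.norm_expect_le (K := ℂ)
        _ ≤ 𝔼 k : Idx L, ‖𝔼 i : Fin H, X.Φ (b (cons i k) * g (cons i k))‖ ^ 2 :=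
            expect_pow_le (fun _ => norm_nonneg _) 2
        _ ≤ 𝔼 k : Idx L, (𝔼 i : Fin H, 𝔼 j : Fin H,
              X.Φ ((b₁ i k * star (b₁ j k)) * (g (cons i k) * star (g (cons j k))))).re := by
            refine Finset.expect_le_expect fun k _ => ?_
            have := box_cs (X := X) (b := b₀ k) (h0 k) (x := fun i => b₁ i k * g (cons i k))
              (fun i n => X.B_mul (hb1 i k n) (hg _ n))
            simp only [star_mul'] at this
            have e1 : ∀ i, X.Φ (b (cons i k) * g (cons i k)) =
                X.Φ (b₀ k * (b₁ i k * g (cons i k))) := fun i => by rw [h2, mul_assoc]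
            have e2 : ∀ i j, X.Φ ((b₁ i k * star (b₁ j k)) * (g (cons i k) * star (g (cons j k)))) =
                X.Φ (b₁ i k * g (cons i k) * (star (b₁ j k) * star (g (cons j k)))) :=
              fun i j => congrArg _ (by ring)
            simp only [e1, e2]
            exact this
        _ = (𝔼 i, 𝔼 j, y i j).re := by
            have : ∀ z : Idx L → ℂ, 𝔼 k, (z k).re = (𝔼 k, z k).re := fun z => by
              rw [Fintype.expect_eq_sum_div_card, Fintype.expect_eq_sum_div_card,
                ← Complex.re_sum, ← Complex.ofReal_natCast, Complex.div_ofReal_re]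
            rw [this, Finset.expect_comm]
            congr 1
            exact Finset.expect_congr rfl fun i _ => Finset.expect_comm _ _ _
        _ ≤ _ := by
            refine (Complex.re_le_norm _).trans ?_
            refine (RCLike.norm_expect_le (K := ℂ)).trans (Finset.expect_le_expect fun i _ => ?_)
            exact RCLike.norm_expect_le (K := ℂ)
    calc ‖𝔼 h, X.Φ (b h * g h)‖ ^ 2 ^ (L.length + 1)
        = (‖𝔼 h, X.Φ (b h * g h)‖ ^ 2) ^ 2 ^ L.length := by rw [← pow_mul, pow_succ']
      _ ≤ (𝔼 i, 𝔼 j, ‖y i j‖) ^ 2 ^ L.length := by gcongr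
      _ ≤ 𝔼 i, 𝔼 j, ‖y i j‖ ^ 2 ^ L.length := by
          refine (expect_pow_le (fun i => Finset.expect_nonneg fun _ _ => norm_nonneg _) _).trans
            (Finset.expect_le_expect fun i _ => ?_)
          exact expect_pow_le (fun i => norm_nonneg _) _
      _ ≤ 𝔼 i : Fin H, 𝔼 j : Fin H, 𝔼 k : Idx L, 𝔼 k' : Idx L,
            ‖X.Φ (cube L (fun k => g (cons i k) * star (g (cons j k))) k k')‖ := by
          refine Finset.expect_le_expect fun i _ => Finset.expect_le_expect fun j _ => ?_
          refine gowers_cs L hL' (fun k => b₁ i k * star (b₁ j k))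
            (fun k => g (cons i k) * star (g (cons j k))) ?_ ?_
          · exact (h1 i).mul (fun _ _ ha hb n => X.B_mul (ha n) (hb n))
              ((h1 j).star (fun _ ha n => X.B_star (ha n)))
          · exact fun k n => X.B_mul (hg _ n) (X.B_star (hg _ n))
      _ = _ := by
          rw [expect_cons]
          refine Finset.expect_congr rfl fun i _ => ?_
          rw [Finset.expect_comm]
          refine Finset.expect_congr rfl fun k _ => ?_
          rw [expect_cons]
          rfl

end ErgSys

theorem sum_root_zpow {M : ℕ} {ζ : ℂ} (hζ : IsPrimitiveRoot ζ M) {t : ℤ} (ht : |t| < M) :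
    ∑ r ∈ Finset.range M, (ζ ^ r) ^ t = if t = 0 then (M : ℂ) else 0 := by
  have e : ∀ r : ℕ, (ζ ^ r) ^ t = (ζ ^ t) ^ r := fun r => by
    rw [← zpow_natCast, ← zpow_natCast, zpow_comm]
  simp only [e]
  split_ifs with h
  · simp [h]
  · have h1 : ζ ^ t ≠ 1 := by
      rw [Ne, hζ.zpow_eq_one_iff_dvd]
      intro hd
      have := Int.le_of_dvd (abs_pos.2 h) ((dvd_abs _ _).2 hd)
      omega
    rw [geom_sum_eq h1, ← zpow_natCast, ← zpow_mul, mul_comm, zpow_mul, zpow_natCast, hζ.pow_eq_one]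
    simp

namespace ErgSys

variable {𝓐 : Type*} [CommRing 𝓐] [StarRing 𝓐] [Algebra ℂ 𝓐] [StarModule ℂ 𝓐] (X : ErgSys 𝓐)

/-- Correlation sequence. -/
noncomputable def corr (g : 𝓐) (t : ℤ) : ℂ := X.int (X.sh t g * star g)

/-- Twisted ergodic average. -/
noncomputable def twAvg (g : 𝓐) (K : ℕ) (l : ℂ) : 𝓐 :=
  ∑ k ∈ Finset.range K, ((K : ℂ)⁻¹ * (star l) ^ k) • X.sh k g

/-- Energy of a twisted ergodic average. -/
noncomputable def energy (g : 𝓐) (K : ℕ) (l : ℂ) : ℝ :=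
  (X.int (X.twAvg g K l * star (X.twAvg g K l))).re

variable {X}

theorem int_sh_mul_star (g : 𝓐) (a b : ℤ) :
    X.int (X.sh a g * star (X.sh b g)) = X.corr g (a - b) := by
  rw [corr, ← X.int_sh b (X.sh (a - b) g * star g), map_mul (X.sh b), map_star (X.sh b),
    ← X.sh_add, add_sub_cancel]

theorem corr_neg (g : 𝓐) (t : ℤ) : X.corr g (-t) = star (X.corr g t) := by
  rw [corr, corr, ← X.int_star, star_mul', star_star, ← X.int_sh t (X.sh (-t) g * star g),
    map_mul (X.sh t), map_star (X.sh t), ← X.sh_add, add_neg_cancel, X.sh_zero, mul_comm]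

theorem int_self_nonneg {g : 𝓐} (hg : X.B g) : 0 ≤ (X.int (g * star g)).re :=
  (sq_nonneg _).trans (X.int_cs X.B_one hg)

theorem B_twAvg {g : 𝓐} (hg : X.B g) (K : ℕ) {l : ℂ} (hl : ‖l‖ = 1) : X.B (X.twAvg g K l) := by
  refine X.B_sum _ _ _ (fun k _ => X.B_sh _ hg) ?_
  simp [hl, mul_inv_le_one]

theorem energy_nonneg {g : 𝓐} (hg : X.B g) (K : ℕ) {l : ℂ} (hl : ‖l‖ = 1) :
    0 ≤ X.energy g K l := int_self_nonneg (B_twAvg hg K hl)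

theorem int_twAvg (g : 𝓐) (K : ℕ) {l : ℂ} (hl : ‖l‖ = 1) :
    X.int (X.twAvg g K l * star (X.twAvg g K l)) =
      (K : ℂ)⁻¹ ^ 2 * ∑ q ∈ Finset.range K ×ˢ Finset.range K,
        l ^ ((q.2 : ℤ) - q.1) * X.corr g (q.1 - q.2) := by
  have hl0 : l ≠ 0 := by rintro rfl; simp at hl
  have hs : star l = l⁻¹ := (Complex.inv_eq_conj hl).symm
  have hs' : star (l⁻¹) = l := by rw [← hs, star_star]
  rw [twAvg, star_sum, Finset.sum_mul_sum, Finset.mul_sum, ← Finset.sum_product', map_sum]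
  refine Finset.sum_congr rfl fun q _ => ?_
  rw [star_smul, smul_mul_smul_comm, map_smul, int_sh_mul_star, smul_eq_mul, star_mul', star_pow,
    hs, hs', star_inv₀, star_natCast, zpow_sub₀ hl0, zpow_natCast, zpow_natCast, inv_pow]
  field_simp

theorem energy_im (g : 𝓐) (K : ℕ) (l : ℂ) :
    X.int (X.twAvg g K l * star (X.twAvg g K l)) = (X.energy g K l : ℂ) := by
  have : star (X.int (X.twAvg g K l * star (X.twAvg g K l))) =
      X.int (X.twAvg g K l * star (X.twAvg g K l)) := by
    rw [← X.int_star, star_mul', star_star, mul_comm]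
  exact (Complex.conj_eq_iff_re.1 this).symm

theorem corr_avg_le {g : 𝓐} (hg : X.B g) {K N : ℕ} (hK : 0 < K) {c : ℝ}
    (hc : ∀ l : ℂ, ‖l‖ = 1 → X.energy g K l ≤ c) :
    (N : ℝ) * ∑ q ∈ Finset.range K ×ˢ Finset.range K, ‖X.corr g (q.1 - q.2)‖ ^ 2 ≤
      (K + N : ℕ) * (K : ℝ) ^ 2 * c := by
  set N' := K + N with hN'
  have hM : 2 * N' ≠ 0 := by omega
  have hζ := Complex.isPrimitiveRoot_exp (2 * N') hM
  set ζ := Complex.exp (2 * Real.pi * Complex.I / ((2 * N' : ℕ) : ℂ)) with hζdef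
  have hζ1 : ∀ r : ℕ, ‖ζ ^ r‖ = 1 := fun r => by rw [norm_pow, hζ.norm'_eq_one hM, one_pow]
  have hζ0 : ∀ r : ℕ, ζ ^ r ≠ 0 := fun r h => by have := hζ1 r; simp [h] at this
  have hN0 : (N' : ℂ) ≠ 0 := by exact_mod_cast (by omega : N' ≠ 0)
  have hK0 : (K : ℂ) ≠ 0 := by exact_mod_cast hK.ne'
  have mass : ∑ r ∈ Finset.range (2 * N'), X.energy g N' (ζ ^ r) ≤ 2 := by
    have : ((∑ r ∈ Finset.range (2 * N'), X.energy g N' (ζ ^ r) : ℝ) : ℂ) = 2 * X.corr g 0 := by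
      push_cast
      simp only [← energy_im, int_twAvg g N' (hζ1 _)]
      rw [← Finset.mul_sum, Finset.sum_comm]
      have : ∀ q ∈ Finset.range N' ×ˢ Finset.range N', ∑ r ∈ Finset.range (2 * N'),
          (ζ ^ r) ^ ((q.2 : ℤ) - q.1) * X.corr g (q.1 - q.2) =
          if q.1 = q.2 then 2 * N' * X.corr g 0 else 0 := by
        rintro ⟨a, b⟩ hq
        simp only [Finset.mem_product, Finset.mem_range] at hq
        rw [← Finset.sum_mul, sum_root_zpow hζ (by rw [abs_lt]; constructor <;> push_cast <;> omega)]
        by_cases hab : a = b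
        · simp [hab]
        · rw [if_neg (by simp only; omega), if_neg hab, zero_mul]
      rw [Finset.sum_congr rfl this, Finset.sum_product]
      simp only [Finset.sum_ite_eq, Finset.mem_range]
      rw [Finset.sum_congr rfl (fun x hx => if_pos (Finset.mem_range.1 hx))]
      simp only [Finset.sum_const, Finset.card_range, nsmul_eq_mul]
      field_simp
    have h2 : ‖((∑ r ∈ Finset.range (2 * N'), X.energy g N' (ζ ^ r) : ℝ) : ℂ)‖ ≤ 2 := by
      rw [this, norm_mul]
      have : ‖X.corr g 0‖ ≤ 1 := X.int_le (X.B_mul (X.B_sh _ hg) (X.B_star hg))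
      simpa using this
    rw [Complex.norm_real] at h2
    exact (le_abs_self _).trans h2
  have prod : ((∑ r ∈ Finset.range (2 * N'), X.energy g N' (ζ ^ r) * X.energy g K (ζ ^ r) : ℝ) : ℂ)
      = 2 * (N' : ℂ)⁻¹ * (K : ℂ)⁻¹ ^ 2 * ∑ q ∈ Finset.range K ×ˢ Finset.range K,
        ∑ p ∈ Finset.range N' ×ˢ Finset.range N',
          if ((p.1 : ℤ) - p.2) = q.2 - q.1 then ((‖X.corr g (q.1 - q.2)‖ ^ 2 : ℝ) : ℂ) else 0 := by
    push_cast
    simp only [← energy_im, int_twAvg g _ (hζ1 _)]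
    have e : ∀ r : ℕ, ((N' : ℂ)⁻¹ ^ 2 * ∑ q ∈ Finset.range N' ×ˢ Finset.range N',
        (ζ ^ r) ^ ((q.2 : ℤ) - q.1) * X.corr g (q.1 - q.2)) *
        ((K : ℂ)⁻¹ ^ 2 * ∑ q ∈ Finset.range K ×ˢ Finset.range K,
        (ζ ^ r) ^ ((q.2 : ℤ) - q.1) * X.corr g (q.1 - q.2)) =
        (N' : ℂ)⁻¹ ^ 2 * (K : ℂ)⁻¹ ^ 2 * ∑ q ∈ Finset.range K ×ˢ Finset.range K,
        ∑ p ∈ Finset.range N' ×ˢ Finset.range N',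
        (ζ ^ r) ^ (((p.2 : ℤ) - p.1) + ((q.2 : ℤ) - q.1)) *
          (X.corr g (p.1 - p.2) * X.corr g (q.1 - q.2)) := by
      intro r
      rw [mul_mul_mul_comm, Finset.sum_mul_sum, Finset.sum_comm]
      congr 1
      refine Finset.sum_congr rfl fun q _ => Finset.sum_congr rfl fun p _ => ?_
      rw [zpow_add₀ (hζ0 r)]; ring
    simp only [e]
    rw [← Finset.mul_sum, Finset.sum_comm, Finset.mul_sum, Finset.mul_sum]
    refine Finset.sum_congr rfl fun q hq => ?_
    rw [Finset.sum_comm, Finset.mul_sum, Finset.mul_sum]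
    refine Finset.sum_congr rfl fun p hp => ?_
    simp only [Finset.mem_product, Finset.mem_range] at hq hp
    rw [← Finset.sum_mul, sum_root_zpow hζ (by rw [abs_lt]; constructor <;> push_cast <;> omega)]
    by_cases h : ((p.1 : ℤ) - p.2) = q.2 - q.1
    · rw [if_pos h, if_pos (by omega), h, ← neg_sub, corr_neg, Complex.star_def, Complex.conj_mul']
      push_cast
      field_simp
    · rw [if_neg h, if_neg (by omega)]; simp
  have cnt : ∀ q ∈ Finset.range K ×ˢ Finset.range K,
      (N : ℝ) * ‖X.corr g (q.1 - q.2)‖ ^ 2 ≤ ∑ p ∈ Finset.range N' ×ˢ Finset.range N',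
          if ((p.1 : ℤ) - p.2) = q.2 - q.1 then ‖X.corr g (q.1 - q.2)‖ ^ 2 else 0 := by
    rintro ⟨a, b⟩ hq
    simp only [Finset.mem_product, Finset.mem_range] at hq
    rw [← Finset.sum_filter, Finset.sum_const, nsmul_eq_mul]
    gcongr
    have := Finset.card_le_card_of_injOn (s := Finset.range N)
      (t := (Finset.range N' ×ˢ Finset.range N').filter
        (fun p : ℕ × ℕ => ((p.1 : ℤ) - p.2) = (b : ℤ) - a)) (fun i => (i + b, i + a))
      (by
        intro i hi
        simp only [Finset.coe_range, Set.mem_Iio] at hi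
        simp only [Finset.coe_filter, Finset.mem_product, Finset.mem_range, Set.mem_ofPred_eq]
        refine ⟨⟨by omega, by omega⟩, by push_cast; ring⟩)
      (by intro i _ j _ hij; simpa using hij)
    rwa [Finset.card_range] at this
  have prod' : ∑ r ∈ Finset.range (2 * N'), X.energy g N' (ζ ^ r) * X.energy g K (ζ ^ r)
      = 2 * (N' : ℝ)⁻¹ * (K : ℝ)⁻¹ ^ 2 * ∑ q ∈ Finset.range K ×ˢ Finset.range K,
        ∑ p ∈ Finset.range N' ×ˢ Finset.range N',
          if ((p.1 : ℤ) - p.2) = q.2 - q.1 then ‖X.corr g (q.1 - q.2)‖ ^ 2 else 0 := by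
    apply Complex.ofReal_injective
    rw [prod]
    push_cast
    congr 1
    refine Finset.sum_congr rfl fun q hq => Finset.sum_congr rfl fun p hp => ?_
    split_ifs <;> simp
  have hc0 : 0 ≤ c := (energy_nonneg hg K (l := 1) (by simp)).trans (hc 1 (by simp))
  have up : ∑ r ∈ Finset.range (2 * N'), X.energy g N' (ζ ^ r) * X.energy g K (ζ ^ r) ≤ 2 * c := by
    calc _ ≤ ∑ r ∈ Finset.range (2 * N'), X.energy g N' (ζ ^ r) * c :=
          Finset.sum_le_sum fun r _ => mul_le_mul_of_nonneg_left (hc _ (hζ1 r))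
            (energy_nonneg hg _ (hζ1 r))
      _ ≤ 2 * c := by rw [← Finset.sum_mul]; gcongr
  have low := Finset.sum_le_sum cnt
  rw [← Finset.mul_sum] at low
  rw [prod'] at up
  have hN'p : (0 : ℝ) < N' := by exact_mod_cast (by omega : 0 < N')
  have hKp : (0 : ℝ) < K := by exact_mod_cast hK
  set S := ∑ q ∈ Finset.range K ×ˢ Finset.range K, ∑ p ∈ Finset.range N' ×ˢ Finset.range N',
    if ((p.1 : ℤ) - p.2) = q.2 - q.1 then ‖X.corr g (q.1 - q.2)‖ ^ 2 else 0
  refine low.trans ?_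
  have : S = N' * K ^ 2 * ((N' : ℝ)⁻¹ * (K : ℝ)⁻¹ ^ 2 * S) := by field_simp
  rw [this]
  gcongr
  nlinarith

theorem continuous_energy (g : 𝓐) (K : ℕ) : ContinuousOn (X.energy g K) (Metric.sphere 0 1) := by
  have : ContinuousOn (fun l : ℂ => ((K : ℂ)⁻¹ ^ 2 * ∑ q ∈ Finset.range K ×ˢ Finset.range K,
        l ^ ((q.2 : ℤ) - q.1) * X.corr g (q.1 - q.2)).re) (Metric.sphere 0 1) := by
    refine Complex.continuous_re.comp_continuousOn (ContinuousOn.mul continuousOn_const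
      (continuousOn_finsetSum _ fun q _ => ContinuousOn.mul ?_ continuousOn_const))
    refine ContinuousOn.zpow₀ continuousOn_id _ fun l hl => Or.inl ?_
    rintro rfl
    simp at hl
  refine this.congr fun l hl => ?_
  rw [energy, int_twAvg g K (by simpa using hl)]

theorem exists_energy {g : 𝓐} (hg : X.B g) {K : ℕ} (hK : 0 < K) {δ : ℝ} (hδ : 0 ≤ δ)
    (h : δ ≤ 𝔼 k : Fin K, 𝔼 k' : Fin K, ‖X.int (X.sh k g * star (X.sh k' g))‖) :
    ∃ l : ℂ, ‖l‖ = 1 ∧ δ ^ 2 ≤ X.energy g K l := by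
  have : Nonempty (Fin K) := ⟨⟨0, hK⟩⟩
  have hKp : (0 : ℝ) < K := by exact_mod_cast hK
  obtain ⟨l, hl, hmax⟩ := (isCompact_sphere (0 : ℂ) 1).exists_isMaxOn
    ⟨1, by simp⟩ (continuous_energy (X := X) g K)
  refine ⟨l, by simpa using hl, ?_⟩
  set c := X.energy g K l
  have hc : ∀ l : ℂ, ‖l‖ = 1 → X.energy g K l ≤ c := fun l' hl' => hmax (by simpa using hl')
  set S := ∑ q ∈ Finset.range K ×ˢ Finset.range K, ‖X.corr g (q.1 - q.2)‖ ^ 2 with hS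
  have h1 : δ ^ 2 * K ^ 2 ≤ S := by
    have h2 : δ ^ 2 ≤ 𝔼 k : Fin K, 𝔼 k' : Fin K, ‖X.int (X.sh k g * star (X.sh k' g))‖ ^ 2 := by
      refine (pow_le_pow_left₀ hδ h 2).trans ((expect_pow_le (fun i =>
        Finset.expect_nonneg fun _ _ => norm_nonneg _) _).trans
          (Finset.expect_le_expect fun i _ => expect_pow_le (fun i => norm_nonneg _) _))
    simp only [Fintype.expect_eq_sum_div_card, int_sh_mul_star, ← Finset.sum_div,
      Fintype.card_fin] at h2
    rw [div_div, le_div_iff₀ (by positivity)] at h2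
    rw [hS, Finset.sum_product, Finset.sum_range]
    simp only [Finset.sum_range]
    rw [pow_two (K : ℝ)]
    exact h2
  have h3 : ∀ N : ℕ, (N : ℝ) * S ≤ (K + N : ℕ) * (K : ℝ) ^ 2 * c := fun N => corr_avg_le hg hK hc
  have h4 : ∀ N : ℕ, (N : ℝ) * (S - K ^ 2 * c) ≤ K * K ^ 2 * c := fun N => by
    have := h3 N; push_cast at this; linarith
  have h5 : S ≤ K ^ 2 * c := by
    by_contra hcon
    push Not at hcon
    obtain ⟨N, hN⟩ := exists_nat_gt ((K * K ^ 2 * c) / (S - K ^ 2 * c))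
    rw [div_lt_iff₀ (by linarith)] at hN
    linarith [h4 N]
  have : δ ^ 2 * K ^ 2 ≤ c * K ^ 2 := by linarith
  exact le_of_mul_le_mul_right this (by positivity)

theorem int_triangle {ι : Type} [Fintype ι] [Nonempty ι] {x : ι → 𝓐} (hx : ∀ i, X.B (x i)) {c : ℝ}
    (h : ∀ i, (X.int (x i * star (x i))).re ≤ c) :
    (X.int (((Fintype.card ι : ℂ)⁻¹ • ∑ i, x i) * star ((Fintype.card ι : ℂ)⁻¹ • ∑ i, x i))).re
      ≤ c := by
  set y := (Fintype.card ι : ℂ)⁻¹ • ∑ i, x i with hy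
  have hyB : X.B y := B_avg x hx
  have hc0 : (Fintype.card ι : ℂ) ≠ 0 := by exact_mod_cast Fintype.card_ne_zero
  have e : ∑ i, (X.int (x i * star y)).re = Fintype.card ι * (X.int (y * star y)).re := by
    rw [← Complex.re_sum, ← map_sum, ← Finset.sum_mul]
    have : ∑ i, x i = (Fintype.card ι : ℂ) • y := by rw [hy, smul_inv_smul₀ hc0]
    rw [this, smul_mul_assoc, map_smul, smul_eq_mul, ← Complex.ofReal_natCast,
      Complex.re_ofReal_mul]
  have key : ∀ i, 2 * (X.int (x i * star y)).re ≤ c + (X.int (y * star y)).re := by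
    intro i
    have hB : X.B ((2 : ℂ)⁻¹ • x i + (-(2 : ℂ)⁻¹) • y) := by
      have := X.B_sum Finset.univ (fun b : Bool => if b then (2 : ℂ)⁻¹ else -(2 : ℂ)⁻¹)
        (fun b => if b then x i else y) (by intro b _; cases b <;> simp [hx, hyB]) (by norm_num)
      simpa using this
    have h0 := int_self_nonneg hB
    have e2 : ((2 : ℂ)⁻¹ • x i + (-(2 : ℂ)⁻¹) • y) * star ((2 : ℂ)⁻¹ • x i + (-(2 : ℂ)⁻¹) • y) =
        (4 : ℂ)⁻¹ • (x i * star (x i) - x i * star y - star (x i * star y) + y * star y) := by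
      simp only [star_add, star_smul, star_mul', star_star, star_neg, star_inv₀]
      simp only [Complex.star_def, Complex.conj_ofNat, Algebra.smul_def, map_neg]
      have h4 : algebraMap ℂ 𝓐 4⁻¹ = algebraMap ℂ 𝓐 2⁻¹ * algebraMap ℂ 𝓐 2⁻¹ := by
        rw [← map_mul]; norm_num
      rw [h4]; ring
    rw [e2, map_smul, map_add, map_sub, map_sub, X.int_star, smul_eq_mul,
      show (4 : ℂ)⁻¹ = ((4⁻¹ : ℝ) : ℂ) by norm_num, Complex.re_ofReal_mul] at h0
    simp only [Complex.add_re, Complex.sub_re, Complex.star_def, Complex.conj_re] at h0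
    linarith [h i]
  have hs := Finset.sum_le_sum fun i (_ : i ∈ Finset.univ) => key i
  rw [← Finset.mul_sum, e, Finset.sum_const, Finset.card_univ, nsmul_eq_mul] at hs
  have hcp : (0 : ℝ) < Fintype.card ι := by exact_mod_cast Fintype.card_pos
  nlinarith

theorem _root_.sum_range_mul' {M : Type*} [AddCommMonoid M] (f : ℕ → M) (K n : ℕ) :
    ∑ k ∈ Finset.range (K * n), f k =
      ∑ i ∈ Finset.range n, ∑ k ∈ Finset.range K, f (K * i + k) := by
  induction n with
  | zero => simp
  | succ n ih => rw [Nat.mul_succ, Finset.sum_range_add, ih, Finset.sum_range_succ]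

theorem twAvg_mul (g : 𝓐) (K n : ℕ) (l : ℂ) :
    X.twAvg g (K * n) l = (Fintype.card (Fin n) : ℂ)⁻¹ •
      ∑ i : Fin n, (star l) ^ (K * i) • X.sh ((K * i : ℕ) : ℤ) (X.twAvg g K l) := by
  rw [Fintype.card_fin, Fin.sum_univ_eq_sum_range
    (fun i => (star l) ^ (K * i) • X.sh ((K * i : ℕ) : ℤ) (X.twAvg g K l)), twAvg,
    sum_range_mul', Finset.smul_sum]
  refine Finset.sum_congr rfl fun i _ => ?_
  rw [twAvg, map_sum, Finset.smul_sum, Finset.smul_sum]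
  refine Finset.sum_congr rfl fun k _ => ?_
  rw [map_smul, smul_smul, smul_smul, ← X.sh_add]
  push_cast
  congr 1
  rw [mul_inv, pow_add]; ring

theorem energy_antitone {g : 𝓐} (hg : X.B g) {K n : ℕ} (hn : 0 < n) {l : ℂ} (hl : ‖l‖ = 1) :
    X.energy g (K * n) l ≤ X.energy g K l := by
  have : Nonempty (Fin n) := ⟨⟨0, hn⟩⟩
  rw [energy, twAvg_mul g K n l]
  have hl' : ‖star l‖ = 1 := by rw [norm_star, hl]
  refine int_triangle (fun i => B_smul (by simp [hl]) (X.B_sh _ (B_twAvg hg K hl))) fun i => ?_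
  rw [star_smul, smul_mul_smul_comm, map_smul, ← map_star (X.sh _), ← map_mul (X.sh _), X.int_sh,
    star_pow, ← mul_pow, star_star, mul_comm (star l), Complex.star_def, Complex.mul_conj,
    Complex.normSq_eq_norm_sq, hl]
  simp [energy]

variable (X) in
/-- The supremum of correlations with eigenfunctions. -/
noncomputable def sn (g : 𝓐) : ℝ := sSup {r | ∃ l χ, X.Eig l χ ∧ r = ‖X.int (g * χ)‖}

theorem Eig.one : X.Eig 1 1 :=
  ⟨by simp, X.B_one, fun f => by simp, fun f => by simp⟩

theorem Eig.star {l : ℂ} {χ : 𝓐} (h : X.Eig l χ) : X.Eig (star l) (star χ) := by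
  obtain ⟨h1, h2, h3, h4⟩ := h
  refine ⟨by rw [norm_star, h1], X.B_star h2, fun f => ?_, fun f => ?_⟩
  · have := congrArg Star.star (h3 (Star.star f))
    rw [← X.int_star, star_mul', star_star, star_mul', ← X.int_star, star_mul', star_star] at this
    rw [map_star (X.sh 1), this]
  · rw [star_star, mul_comm (Star.star χ), h4]

theorem Eig.mul {l l' : ℂ} {χ ρ : 𝓐} (h : X.Eig l χ) (h' : X.Eig l' ρ) :
    X.Eig (l * l') (χ * ρ) := by
  obtain ⟨h1, h2, h3, h4⟩ := h
  obtain ⟨h1', h2', h3', h4'⟩ := h'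
  refine ⟨by rw [norm_mul, h1, h1', one_mul], X.B_mul h2 h2', fun f => ?_, fun f => ?_⟩
  · rw [map_mul (X.sh 1), ← mul_assoc, h3', mul_right_comm, h3, mul_right_comm, mul_assoc f]; ring
  · rw [star_mul', show f * (χ * ρ * (Star.star χ * Star.star ρ)) =
      (f * (χ * Star.star χ)) * (ρ * Star.star ρ) by ring, h4', h4]

theorem Eig.sh {l : ℂ} {χ : 𝓐} (h : X.Eig l χ) (a : ℤ) (f : 𝓐) :
    X.int (f * X.sh a χ) = l ^ a * X.int (f * χ) := by
  have hl : l ≠ 0 := by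
    rintro rfl
    simpa using h.1
  have key : ∀ (n : ℕ) (f : 𝓐), X.int (f * X.sh n χ) = l ^ n * X.int (f * χ) := by
    intro n
    induction n with
    | zero => intro f; simp [X.sh_zero]
    | succ n ih =>
      intro f
      have e : X.int (f * X.sh ((n + 1 : ℕ) : ℤ) χ) = X.int (X.sh (-n) f * X.sh 1 χ) := by
        rw [← X.int_sh n (X.sh (-n) f * X.sh 1 χ), map_mul (X.sh _), ← X.sh_add, ← X.sh_add,
          add_neg_cancel, X.sh_zero]
        push_cast; rfl
      rw [e, h.2.2.1, ← X.int_sh n (X.sh (-n) f * χ), map_mul (X.sh _), ← X.sh_add,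
        add_neg_cancel, X.sh_zero, ih, pow_succ']
      ring
  obtain ⟨n, rfl | rfl⟩ := a.eq_nat_or_neg
  · rw [key, zpow_natCast]
  · have := key n (X.sh n f)
    rw [← map_mul (X.sh _), X.int_sh] at this
    rw [← X.int_sh n, map_mul (X.sh _), ← X.sh_add, add_neg_cancel, X.sh_zero, zpow_neg,
      zpow_natCast, this, inv_mul_cancel_left₀ (pow_ne_zero _ hl)]

theorem Eig.norm_sh {l : ℂ} {χ : 𝓐} (h : X.Eig l χ) (a : ℤ) (f : 𝓐) :
    ‖X.int (X.sh a f * χ)‖ = ‖X.int (f * χ)‖ := by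
  rw [← X.int_sh (-a), map_mul (X.sh _), ← X.sh_add, neg_add_cancel, X.sh_zero, h.sh, norm_mul,
    norm_zpow, h.1, one_zpow, one_mul]

theorem sn_set_bdd {g : 𝓐} (hg : X.B g) :
    BddAbove {r | ∃ l χ, X.Eig l χ ∧ r = ‖X.int (g * χ)‖} := by
  refine ⟨1, ?_⟩
  rintro r ⟨l, χ, h, rfl⟩
  exact X.int_le (X.B_mul hg h.2.1)

theorem le_sn {g : 𝓐} (hg : X.B g) {l : ℂ} {χ : 𝓐} (h : X.Eig l χ) : ‖X.int (g * χ)‖ ≤ X.sn g :=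
  le_csSup (sn_set_bdd hg) ⟨l, χ, h, rfl⟩

theorem sn_le_of {g : 𝓐} {c : ℝ} (h : ∀ l χ, X.Eig l χ → ‖X.int (g * χ)‖ ≤ c) : X.sn g ≤ c := by
  refine csSup_le ⟨_, 1, 1, Eig.one, rfl⟩ ?_
  rintro r ⟨l, χ, hχ, rfl⟩
  exact h l χ hχ

theorem exists_eig_of_lt {g : 𝓐} {c : ℝ} (h : c < X.sn g) :
    ∃ l χ, X.Eig l χ ∧ c < ‖X.int (g * χ)‖ := by
  by_contra hcon
  push Not at hcon
  exact absurd (sn_le_of hcon) (not_le.2 h)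

theorem sn_nonneg (g : 𝓐) : 0 ≤ X.sn g := by
  refine Real.sSup_nonneg ?_
  rintro r ⟨l, χ, h, rfl⟩
  exact norm_nonneg _

theorem sn_le_one {g : 𝓐} (hg : X.B g) : X.sn g ≤ 1 :=
  sn_le_of fun _ _ h => X.int_le (X.B_mul hg h.2.1)

theorem sn_sh (a : ℤ) (g : 𝓐) : X.sn (X.sh a g) = X.sn g := by
  refine congrArg sSup (Set.ext fun r => ?_)
  constructor
  · rintro ⟨l, χ, h, rfl⟩; exact ⟨l, χ, h, h.norm_sh a g⟩
  · rintro ⟨l, χ, h, rfl⟩; exact ⟨l, χ, h, (h.norm_sh a g).symm⟩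

theorem sn_star (g : 𝓐) : X.sn (star g) = X.sn g := by
  have e : ∀ g χ, ‖X.int (star g * star χ)‖ = ‖X.int (g * χ)‖ := fun g χ => by
    rw [← star_mul', X.int_star, norm_star]
  refine congrArg sSup (Set.ext fun r => ?_)
  constructor
  · rintro ⟨l, χ, h, rfl⟩
    exact ⟨_, _, h.star, by rw [← e g, star_star]⟩
  · rintro ⟨l, χ, h, rfl⟩; exact ⟨_, _, h.star, (e g χ).symm⟩

/-- Averaged correlations along factorial windows are controlled by eigenfunctions. -/
theorem sn_extract {g : 𝓐} (hg : X.B g) {η : ℝ} (hη : 0 < η) :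
    ∀ᶠ j : ℕ in atTop, 𝔼 k : Fin j.factorial, 𝔼 k' : Fin j.factorial,
      ‖X.int (X.sh (k : ℕ) g * star (X.sh (k' : ℕ) g))‖ ≤ X.sn g + η := by
  by_contra hcon
  rw [Filter.not_eventually] at hcon
  set δ := X.sn g + η with hδ
  have hδ0 : 0 < δ := by have := sn_nonneg (X := X) g; positivity
  let t : ℕ → Set ℂ := fun j => Metric.sphere 0 1 ∩ X.energy g j.factorial ⁻¹' Set.Ici (δ ^ 2)
  have hne : ∀ j, (t j).Nonempty := by
    intro j
    obtain ⟨i, hi, h⟩ := (hcon.and_eventually (eventually_ge_atTop j)).exists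
    push Not at hi
    obtain ⟨l, hl, he⟩ := exists_energy hg (Nat.factorial_pos i) hδ0.le hi.le
    obtain ⟨n, hn⟩ := Nat.factorial_dvd_factorial h
    have hn0 : 0 < n := by
      rcases Nat.eq_zero_or_pos n with rfl | h'
      · exact absurd hn (by simpa using Nat.factorial_ne_zero i)
      · exact h'
    refine ⟨l, by simpa using hl, ?_⟩
    rw [hn] at he
    exact he.trans (energy_antitone hg hn0 hl)
  have hanti : ∀ j, t (j + 1) ⊆ t j := by
    rintro j l ⟨hl, he⟩
    refine ⟨hl, ?_⟩
    have : X.energy g (j + 1).factorial l ≤ X.energy g j.factorial l := by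
      rw [Nat.factorial_succ, mul_comm]
      exact energy_antitone hg (Nat.succ_pos j) (by simpa using hl)
    exact le_trans he this
  have hcl : ∀ j, IsClosed (t j) := fun j =>
    (continuous_energy g _).preimage_isClosed_of_isClosed Metric.isClosed_sphere isClosed_Ici
  obtain ⟨l, hl⟩ := IsCompact.nonempty_iInter_of_sequence_nonempty_isCompact_isClosed t hanti hne
    ((isCompact_sphere _ _).of_isClosed_subset (hcl 0) Set.inter_subset_left) hcl
  rw [Set.mem_iInter] at hl
  have hl1 : ‖l‖ = 1 := by simpa using (hl 0).1
  obtain ⟨χ, h1, h2, h3, h4⟩ := X.eig_extract l g δ hl1 hg hδ0 fun j => (hl j).2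
  have := le_sn hg (Eig.star ⟨hl1, h1, h2, h3⟩ : X.Eig _ _)
  linarith

end ErgSys

namespace ErgSys

open Idx

variable {𝓐 : Type*} [CommRing 𝓐] [StarRing 𝓐] [Algebra ℂ 𝓐] [StarModule ℂ 𝓐] (X : ErgSys 𝓐)

/-- Iterated multiplicative derivative of `F` along the box `L`. -/
def nab (L : List ℕ) (h g : Idx L) (F : 𝓐) : 𝓐 := cube L (fun k => X.sh (tot k : ℕ) F) h g

/-- Box seminorm of `f`. -/
noncomputable def V (L : List ℕ) (f : 𝓐) : ℝ := 𝔼 h, 𝔼 h', X.sn (X.nab L h h' f)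

/-- `f` has box seminorms of dimension `r` bounded below by `δ`, at all scales divisible by `C`. -/
def Ctrl (f : 𝓐) (δ : ℝ) (C r : ℕ) : Prop :=
  ∀ L : List ℕ, L.length = r → (∀ H ∈ L, 0 < H ∧ C ∣ H) → δ ≤ X.V L f

variable {X}

theorem sh_comm (a b : ℤ) (f : 𝓐) : X.sh a (X.sh b f) = X.sh b (X.sh a f) := by
  rw [← X.sh_add, ← X.sh_add, add_comm]

theorem nab_cons (H : ℕ) (L : List ℕ) (h h' : Idx (H :: L)) (F : 𝓐) :
    X.nab (H :: L) h h' F = X.nab L h.snd h'.snd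
      (X.sh (h.fst : ℕ) F * star (X.sh (h'.fst : ℕ) F)) := by
  rw [nab, cube_cons, nab]
  congr 1; ext k
  rw [map_mul (X.sh _), map_star (X.sh _), ← X.sh_add, ← X.sh_add, tot, tot]
  simp only [fst_cons, snd_cons, Nat.cast_add]
  rw [add_comm ((h.fst : ℕ) : ℤ), add_comm ((h'.fst : ℕ) : ℤ)]

theorem nab_sh (L : List ℕ) (h h' : Idx L) (a : ℤ) (F : 𝓐) :
    X.nab L h h' (X.sh a F) = X.sh a (X.nab L h h' F) := by
  rw [nab, nab, ← cube_map (X.sh a)]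
  congr 1; ext k; rw [sh_comm]

theorem nab_star (L : List ℕ) (h h' : Idx L) (F : 𝓐) :
    X.nab L h h' (star F) = star (X.nab L h h' F) := by
  rw [nab, nab, ← cube_star]
  congr 1; ext k; rw [map_star (X.sh _)]

theorem nab_mul (L : List ℕ) (h h' : Idx L) (F G : 𝓐) :
    X.nab L h h' (F * G) = X.nab L h h' F * X.nab L h h' G := by
  rw [nab, nab, nab, ← cube_mul]
  congr 1; ext k; rw [map_mul (X.sh _)]

theorem nab_cons' (H : ℕ) (L : List ℕ) (h h' : Idx (H :: L)) (F : 𝓐) :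
    X.nab (H :: L) h h' F = X.sh (h.fst : ℕ) (X.nab L h.snd h'.snd F) *
      star (X.sh (h'.fst : ℕ) (X.nab L h.snd h'.snd F)) := by
  rw [nab_cons, nab_mul, nab_star, nab_sh, nab_sh]

theorem B_nab {F : 𝓐} (hF : X.B F) (L : List ℕ) (h h' : Idx L) : X.B (X.nab L h h' F) :=
  cube_pred X.B (fun _ _ => X.B_mul) (fun _ => X.B_star) L _ h h' fun _ => X.B_sh _ hF

theorem V_nonneg (L : List ℕ) (f : 𝓐) : 0 ≤ X.V L f :=
  Finset.expect_nonneg fun _ _ => Finset.expect_nonneg fun _ _ => sn_nonneg _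

theorem V_nil (f : 𝓐) : X.V [] f = X.sn f := by
  have : ∀ f : Idx [] → ℝ, 𝔼 h, f h = f () := fun f => Finset.expect_singleton f ()
  rw [V, this, this]
  simp [nab, cube, tot, X.sh_zero]

theorem V_cons (H : ℕ) (L : List ℕ) (f : 𝓐) : X.V (H :: L) f = 𝔼 i : Fin H, 𝔼 i' : Fin H,
    X.V L (X.sh (i : ℕ) f * star (X.sh (i' : ℕ) f)) := by
  rw [V, expect_cons]
  refine Finset.expect_congr rfl fun i _ => ?_
  have : ∀ k : Idx L, 𝔼 h', X.sn (X.nab (H :: L) (cons i k) h' f) = 𝔼 i' : Fin H, 𝔼 k' : Idx L,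
      X.sn (X.nab L k k' (X.sh (i : ℕ) f * star (X.sh (i' : ℕ) f))) := fun k => by
    rw [expect_cons]
    simp only [nab_cons, fst_cons, snd_cons]
  simp only [this]
  rw [Finset.expect_comm]
  rfl

theorem V_sh (L : List ℕ) (a : ℤ) (f : 𝓐) : X.V L (X.sh a f) = X.V L f := by
  simp only [V, nab_sh, sn_sh]

theorem V_star (L : List ℕ) (f : 𝓐) : X.V L (star f) = X.V L f := by
  simp only [V, nab_star, sn_star]

theorem Ctrl.star {f : 𝓐} {δ : ℝ} {C r : ℕ} (h : X.Ctrl (star f) δ C r) : X.Ctrl f δ C r :=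
  fun L hL hC => by rw [← V_star]; exact h L hL hC

/-- Dilating a translation invariant nonnegative kernel. -/
theorem _root_.expect_dilate_le (v : ℤ → ℤ → ℝ) (hv : ∀ a b, 0 ≤ v a b)
    (hvt : ∀ a b t, v (a + t) (b + t) = v a b) {c : ℤ} (hc : c ≠ 0) {H : ℕ} (hH : 0 < H) :
    𝔼 h : Fin H, 𝔼 h' : Fin H, v (c * (h : ℕ)) (c * (h' : ℕ)) ≤
      (c : ℝ) ^ 2 * 𝔼 i : Fin (c.natAbs * H), 𝔼 i' : Fin (c.natAbs * H), v (i : ℕ) (i' : ℕ) := by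
  have hca : 0 < c.natAbs := Int.natAbs_pos.2 hc
  have hsum : ∑ q ∈ Finset.range H ×ˢ Finset.range H, v (c * (q.1 : ℕ)) (c * (q.2 : ℕ)) ≤
      ∑ q ∈ Finset.range (c.natAbs * H) ×ˢ Finset.range (c.natAbs * H), v (q.1 : ℕ) (q.2 : ℕ) := by
    let φ : ℕ → ℕ := fun h => if 0 < c then c.natAbs * h else c.natAbs * (H - 1 - h)
    have hφ : ∀ h < H, (φ h : ℤ) = c * h + (if 0 < c then 0 else (c.natAbs : ℤ) * ((H : ℤ) - 1)) := by
      intro h hh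
      simp only [φ]
      split_ifs with h0
      · push_cast; rw [abs_of_pos h0]; ring
      · rw [show H - 1 - h = H - (1 + h) by omega]
        push_cast [show 1 + h ≤ H by omega]
        rw [abs_of_neg (by omega)]; ring
    have hφ2 : ∀ h < H, φ h < c.natAbs * H := by
      intro h hh
      simp only [φ]
      split_ifs <;> exact Nat.mul_lt_mul_of_pos_left (by omega) hca
    have hinj : Set.InjOn (fun q : ℕ × ℕ => (φ q.1, φ q.2))
        (Finset.range H ×ˢ Finset.range H : Finset (ℕ × ℕ)) := by
      have h1 : ∀ a < H, ∀ b < H, φ a = φ b → a = b := by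
        intro a ha b hb hab
        have : (φ a : ℤ) = φ b := by rw [hab]
        rw [hφ a ha, hφ b hb] at this
        have := mul_left_cancel₀ hc (add_right_cancel this)
        exact_mod_cast this
      rintro ⟨a, b⟩ hab ⟨a', b'⟩ hab' he
      simp only [Finset.coe_product, Finset.coe_range, Set.mem_prod, Set.mem_Iio] at hab hab'
      simp only [Prod.mk.injEq] at he ⊢
      exact ⟨h1 _ hab.1 _ hab'.1 he.1, h1 _ hab.2 _ hab'.2 he.2⟩
    have e : ∀ q ∈ Finset.range H ×ˢ Finset.range H, v (c * (q.1 : ℕ)) (c * (q.2 : ℕ)) =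
        v (φ q.1 : ℕ) (φ q.2 : ℕ) := by
      rintro ⟨a, b⟩ hq
      simp only [Finset.mem_product, Finset.mem_range] at hq
      simp only
      rw [hφ _ hq.1, hφ _ hq.2, hvt]
    rw [Finset.sum_congr rfl e, ← Finset.sum_image (g := fun q : ℕ × ℕ => (φ q.1, φ q.2))
      (f := fun q : ℕ × ℕ => v (q.1 : ℕ) (q.2 : ℕ)) hinj]
    refine Finset.sum_le_sum_of_subset_of_nonneg ?_ fun _ _ _ => hv _ _
    intro q hq
    obtain ⟨⟨a, b⟩, hab, rfl⟩ := Finset.mem_image.1 hq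
    simp only [Finset.mem_product, Finset.mem_range] at hab ⊢
    exact ⟨hφ2 _ hab.1, hφ2 _ hab.2⟩
  rw [Finset.sum_product, Finset.sum_product] at hsum
  simp only [Finset.sum_range] at hsum
  simp only [Fintype.expect_eq_sum_div_card, ← Finset.sum_div, Fintype.card_fin]
  have hHp : (0 : ℝ) < H := by exact_mod_cast hH
  have hcr : (0 : ℝ) < c.natAbs := by exact_mod_cast hca
  have hcc : (c : ℝ) ^ 2 = (c.natAbs : ℝ) ^ 2 := by
    rw [Nat.cast_natAbs, Int.cast_abs, sq_abs]
  rw [hcc, div_div, div_div, div_le_iff₀ (by positivity)]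
  refine hsum.trans (le_of_eq ?_)
  push_cast
  field_simp

theorem V_kernel_sh (L : List ℕ) (f : 𝓐) (a b t : ℤ) :
    X.V L (X.sh (a + t) f * star (X.sh (b + t) f)) = X.V L (X.sh a f * star (X.sh b f)) := by
  rw [add_comm a, add_comm b, X.sh_add, X.sh_add, ← map_star (X.sh t), ← map_mul (X.sh t), V_sh]

theorem int_kernel_sh (f : 𝓐) (a b t : ℤ) :
    X.int (X.sh (a + t) f * star (X.sh (b + t) f)) = X.int (X.sh a f * star (X.sh b f)) := by
  rw [add_comm a, add_comm b, X.sh_add, X.sh_add, ← map_star (X.sh t), ← map_mul (X.sh t), X.int_sh]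

/-- Averages along linear sequences with distinct slopes are controlled by box seminorms. -/
theorem linear_ctrl (cs : List ℤ) : ∀ (c₁ s : ℤ), c₁ ≠ s → (∀ c ∈ cs, c ≠ c₁) → ∀ ε : ℝ, 0 < ε →
    ∃ δ : ℝ, 0 < δ ∧ ∃ C : ℕ, 0 < C ∧ ∀ (w : ℕ → ℂ) (f₀ f₁ : 𝓐) (l : List (ℤ × 𝓐)),
      l.map Prod.fst = cs → (∀ n, ‖w n‖ ≤ 1) → X.B f₀ → X.B f₁ → (∀ t ∈ l, X.B t.2) →
      ε ≤ ‖X.Φ (fun n => f₀ * (w n • (X.sh ((c₁ - s) * n) f₁ *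
        (l.map fun t => X.sh ((t.1 - s) * n) t.2).prod)))‖ → X.Ctrl f₁ δ C cs.length := by
  induction cs with
  | nil =>
    intro c₁ s hs _ ε hε
    have hc : c₁ - s ≠ 0 := sub_ne_zero.2 hs
    set c := c₁ - s
    have hcp : (0 : ℝ) < (c : ℝ) ^ 2 := by
      have : (c : ℝ) ≠ 0 := by exact_mod_cast hc
      positivity
    refine ⟨ε ^ 2 / (c : ℝ) ^ 2, by positivity, 1, one_pos, ?_⟩
    intro w f₀ f₁ l hl hw h0 h1 _ h L hL _
    rw [List.map_eq_nil_iff] at hl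
    subst hl
    rw [List.length_nil, List.length_eq_zero_iff] at hL
    subst hL
    simp only [List.map_nil, List.prod_nil, mul_one] at h
    rw [V_nil]
    refine le_of_forall_pos_le_add fun η hη => ?_
    obtain ⟨j, hj, hjc⟩ := ((sn_extract h1 hη).and (eventually_ge_atTop c.natAbs)).exists
    obtain ⟨H, hH⟩ := Nat.dvd_factorial (Int.natAbs_pos.2 hc) hjc
    have hH0 : 0 < H := by
      rcases Nat.eq_zero_or_pos H with rfl | h'
      · exact absurd hH (by simpa using Nat.factorial_ne_zero j)
      · exact h'
    refine le_trans ?_ hj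
    rw [hH, div_le_iff₀ hcp, mul_comm]
    refine le_trans ?_ (expect_dilate_le (fun a b => ‖X.int (X.sh a f₁ * star (X.sh b f₁))‖)
      (fun _ _ => norm_nonneg _) (fun a b t => by rw [int_kernel_sh]) hc hH0)
    refine (pow_le_pow_left₀ hε.le h 2).trans ((vdc h0 (fun n => B_smul (hw n)
      (X.B_sh _ h1)) H hH0).trans ?_)
    refine Finset.expect_le_expect fun a _ => Finset.expect_le_expect fun b _ => ?_
    refine X.m_le fun n => ?_
    change ‖X.int (_ * _)‖ ≤ _
    rw [star_smul, smul_mul_smul_comm, map_smul, norm_smul]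
    have e : ∀ a : ℕ, c * ((n + a : ℕ) : ℤ) = c * a + c * n := fun a => by push_cast; ring
    rw [e, e, int_kernel_sh]
    refine mul_le_of_le_one_left (norm_nonneg _) ?_
    rw [norm_mul, norm_star]
    exact mul_le_one₀ (hw _) (norm_nonneg _) (hw _)
  | cons c₂ cs ih =>
    intro c₁ s hs hcs ε hε
    obtain ⟨δ, hδ, C, hC, H⟩ := ih c₁ c₂ (hcs c₂ (by simp)).symm
      (fun c hc => hcs c (by simp [hc])) (ε ^ 2 / 2) (by positivity)
    have hc : c₁ - s ≠ 0 := sub_ne_zero.2 hs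
    have hcp : (0 : ℝ) < ((c₁ - s : ℤ) : ℝ) ^ 2 := by
      have : ((c₁ - s : ℤ) : ℝ) ≠ 0 := by exact_mod_cast hc
      positivity
    refine ⟨δ * (ε ^ 2 / 2) / ((c₁ - s : ℤ) : ℝ) ^ 2, by positivity, (c₁ - s).natAbs * C,
      Nat.mul_pos (Int.natAbs_pos.2 hc) hC, ?_⟩
    intro w f₀ f₁ l hl hw h0 h1 hlB h L hL hLC
    obtain ⟨⟨c, g⟩, l', rfl⟩ : ∃ t l', l = t :: l' := by
      cases l with
      | nil => simp at hl
      | cons t l' => exact ⟨t, l', rfl⟩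
    simp only [List.map_cons, List.cons.injEq] at hl
    obtain ⟨rfl, hl⟩ := hl
    obtain ⟨N, L, rfl⟩ : ∃ N L', L = N :: L' := by
      cases L with
      | nil => simp at hL
      | cons t l' => exact ⟨t, l', rfl⟩
    obtain ⟨hN, ⟨q, hq⟩⟩ := hLC N (by simp)
    rw [mul_assoc] at hq
    set K := C * q
    have hK : 0 < K := by
      rcases Nat.eq_zero_or_pos K with h' | h'
      · rw [hq, h'] at hN; simp at hN
      · exact h'
    have : Nonempty (Fin K) := ⟨⟨0, hK⟩⟩
    have hlB' : ∀ t ∈ l', X.B t.2 := fun t ht => hlB t (by simp [ht])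
    have hg : X.B g := hlB (c, g) (by simp)
    rw [V_cons, hq, div_le_iff₀ hcp, mul_comm (𝔼 _, _)]
    refine le_trans ?_ (expect_dilate_le (fun a b => X.V L (X.sh a f₁ * star (X.sh b f₁)))
      (fun _ _ => V_nonneg _ _) (fun a b t => by rw [V_kernel_sh]) hc hK)
    have hB : ∀ n : ℕ, X.B (w n • (X.sh ((c₁ - s) * n) f₁ *
        (((c, g) :: l').map fun t => X.sh ((t.1 - s) * n) t.2).prod)) := by
      intro n
      refine B_smul (hw n) (X.B_mul (X.B_sh _ h1) (B_prod_list _ ?_))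
      simp only [List.mem_map, forall_exists_index, and_imp]
      rintro _ t ht rfl
      exact X.B_sh _ (hlB t ht)
    have key := (pow_le_pow_left₀ hε.le h 2).trans (vdc h0 hB K hK)
    have step : ∀ a b : Fin K, ‖X.Φ (fun n =>
        (w (n + a) • (X.sh ((c₁ - s) * (n + a : ℕ)) f₁ *
        (((c, g) :: l').map fun t => X.sh ((t.1 - s) * (n + a : ℕ)) t.2).prod)) *
        star (w (n + b) • (X.sh ((c₁ - s) * (n + b : ℕ)) f₁ *
        (((c, g) :: l').map fun t => X.sh ((t.1 - s) * (n + b : ℕ)) t.2).prod)))‖ ≤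
        ε ^ 2 / 2 + δ⁻¹ * X.V L (X.sh ((c₁ - s) * (a : ℕ)) f₁ *
          star (X.sh ((c₁ - s) * (b : ℕ)) f₁)) := by
      intro a b
      by_contra hcon
      push Not at hcon
      have hV := V_nonneg (X := X) L (X.sh ((c₁ - s) * (a : ℕ)) f₁ *
          star (X.sh ((c₁ - s) * (b : ℕ)) f₁))
      have hle : (1 : ℝ) < δ⁻¹ * δ + ε ^ 2 / 2 := by
        rw [inv_mul_cancel₀ hδ.ne']; have : 0 < ε ^ 2 := by positivity
        linarith
      have hΦ1 := Φ_le (X := X) (u := fun n : ℕ => (w (n + a) • (X.sh ((c₁ - s) * (n + a : ℕ)) f₁ *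
        (((c, g) :: l').map fun t => X.sh ((t.1 - s) * (n + a : ℕ)) t.2).prod)) *
        star (w (n + b) • (X.sh ((c₁ - s) * (n + b : ℕ)) f₁ *
        (((c, g) :: l').map fun t => X.sh ((t.1 - s) * (n + b : ℕ)) t.2).prod)))
        (fun n => X.B_mul (hB _) (X.B_star (hB _)))
      have hVδ : X.V L (X.sh ((c₁ - s) * (a : ℕ)) f₁ * star (X.sh ((c₁ - s) * (b : ℕ)) f₁)) < δ := by
        by_contra hd
        push Not at hd
        have : δ⁻¹ * δ ≤ δ⁻¹ * X.V L (X.sh ((c₁ - s) * (a : ℕ)) f₁ *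
          star (X.sh ((c₁ - s) * (b : ℕ)) f₁)) := by gcongr
        linarith
      refine absurd ?_ (not_le.2 hVδ)
      refine H (fun n => w (n + a) * star (w (n + b)))
        (X.sh ((c - s) * (a : ℕ)) g * star (X.sh ((c - s) * (b : ℕ)) g)) _
        (l'.map fun t => (t.1, X.sh ((t.1 - s) * (a : ℕ)) t.2 *
          star (X.sh ((t.1 - s) * (b : ℕ)) t.2))) ?_ ?_
        (X.B_mul (X.B_sh _ hg) (X.B_star (X.B_sh _ hg)))
        (X.B_mul (X.B_sh _ h1) (X.B_star (X.B_sh _ h1))) ?_ ?_ L (by simpa using hL)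
        (fun M hM => ?_)
      · rw [List.map_map]; exact hl
      · intro n
        rw [norm_mul, norm_star]
        exact mul_le_one₀ (hw _) (norm_nonneg _) (hw _)
      · simp only [List.mem_map, forall_exists_index, and_imp]
        rintro _ t ht rfl
        exact X.B_mul (X.B_sh _ (hlB' t ht)) (X.B_star (X.B_sh _ (hlB' t ht)))
      · have hlow : ε ^ 2 / 2 ≤ ε ^ 2 / 2 + δ⁻¹ * X.V L (X.sh ((c₁ - s) * (a : ℕ)) f₁ *
          star (X.sh ((c₁ - s) * (b : ℕ)) f₁)) := by
          have := mul_nonneg (inv_nonneg.2 hδ.le) hV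
          linarith
        refine (hlow.trans hcon.le).trans (le_of_eq ?_)
        rw [← Φ_sh (fun n : ℕ => -((c - s) * n)) (fun n => _ * _)]
        congr 2
        ext n
        have sh1 : ∀ (d : ℤ) (a : ℕ) (f : 𝓐), X.sh (-((c - s) * n)) (X.sh ((d - s) * (n + a : ℕ)) f)
            = X.sh ((d - c) * n) (X.sh ((d - s) * a) f) := by
          intro d a f
          rw [← X.sh_add, ← X.sh_add]
          congr 2
          push_cast; ring
        have sh2 : ∀ a : ℕ, X.sh (-((c - s) * n))
            (List.map (fun t => X.sh ((t.1 - s) * (n + a : ℕ)) t.2) l').prod =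
            (List.map (fun t => X.sh ((t.1 - c) * n) (X.sh ((t.1 - s) * a) t.2)) l').prod := by
          intro a
          rw [map_list_prod, List.map_map]
          congr 1
          refine List.map_congr_left fun t _ => ?_
          simp only [Function.comp]
          rw [sh1]
        have sh3 : (List.map (fun t => X.sh ((t.1 - c) * n) t.2) (List.map (fun t => (t.1,
            X.sh ((t.1 - s) * (a : ℕ)) t.2 * star (X.sh ((t.1 - s) * (b : ℕ)) t.2))) l')).prod =
            (List.map (fun t => X.sh ((t.1 - c) * n) (X.sh ((t.1 - s) * (a : ℕ)) t.2)) l').prod *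
            star (List.map (fun t => X.sh ((t.1 - c) * n) (X.sh ((t.1 - s) * (b : ℕ)) t.2)) l').prod
            := by
          rw [← starRingEnd_apply (R := 𝓐), map_list_prod, List.map_map, List.map_map,
            ← List.prod_map_mul]
          congr 1
          refine List.map_congr_left fun t _ => ?_
          simp only [Function.comp, starRingEnd_apply]
          rw [map_mul (X.sh _), map_star (X.sh _)]
        rw [sh3]
        simp only [List.map_cons, List.prod_cons, star_smul, map_smul,
          map_mul (X.sh _), star_mul', map_star (X.sh _), sh1, sh2, mul_smul_comm]
        rw [smul_mul_assoc, smul_smul, mul_comm (star (w _))]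
        congr 1
        simp only [sub_self, zero_mul, X.sh_zero]
        ring
      · obtain ⟨h3, h4⟩ := hLC M (by simp [hM])
        exact ⟨h3, (Dvd.intro_left _ rfl).trans h4⟩
    have := key.trans (Finset.expect_le_expect fun a _ => Finset.expect_le_expect fun b _ =>
      step a b)
    simp only [Finset.expect_add_distrib, Fintype.expect_const, ← Finset.mul_expect] at this
    have h5 : ε ^ 2 / 2 ≤ δ⁻¹ * 𝔼 a : Fin K, 𝔼 b : Fin K, X.V L (X.sh ((c₁ - s) * (a : ℕ)) f₁ *
          star (X.sh ((c₁ - s) * (b : ℕ)) f₁)) := by linarith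
    calc δ * (ε ^ 2 / 2) ≤ _ := mul_le_mul_of_nonneg_left h5 hδ.le
      _ = _ := by rw [mul_inv_cancel_left₀ hδ.ne']

end ErgSys

namespace Polynomial

/-- The leading coefficients of the members of degree `d` of a family of polynomials. -/
def lcs (Ps : List ℤ[X]) (d : ℕ) : Finset ℤ :=
  ((Ps.filter fun P => P.natDegree = d).map leadingCoeff).toFinset

theorem mem_lcs {Ps : List ℤ[X]} {d : ℕ} {c : ℤ} :
    c ∈ lcs Ps d ↔ ∃ P ∈ Ps, P.natDegree = d ∧ P.leadingCoeff = c := by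
  simp [lcs, and_assoc]

/-- A distinguished polynomial of maximal degree, essentially distinct from the others. -/
def Leads (P₁ : ℤ[X]) (Ps : List ℤ[X]) : Prop :=
  0 < P₁.natDegree ∧ ∀ P ∈ Ps, P.natDegree ≤ P₁.natDegree ∧ 0 < (P₁ - P).natDegree

/-- The family obtained from `Ps` after one differencing step. -/
noncomputable def diffFamily (P₁ : ℤ[X]) (Ps : List ℤ[X]) (Q : ℤ[X]) (h k : ℤ) : List ℤ[X] :=
  (taylor k P₁ - Q) :: (Ps.map (fun P => taylor h P - Q) ++ Ps.map (fun P => taylor k P - Q))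

theorem coeff_taylor_sub_one (P : ℤ[X]) (hP : 0 < P.natDegree) (a : ℤ) :
    (taylor a P).coeff (P.natDegree - 1) =
      P.coeff (P.natDegree - 1) + P.natDegree * P.leadingCoeff * a := by
  obtain ⟨d, hd⟩ : ∃ d, P.natDegree = d + 1 := ⟨P.natDegree - 1, by omega⟩
  rw [taylor_coeff, hd, Nat.add_sub_cancel, leadingCoeff, hd]
  have : (hasseDeriv d P).natDegree < 2 := by
    have := natDegree_hasseDeriv_le P d
    omega
  rw [eval_eq_sum_range' this, Finset.sum_range_succ, Finset.sum_range_one, hasseDeriv_coeff,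
    hasseDeriv_coeff]
  simp only [zero_add, Nat.choose_self, Nat.cast_one, one_mul, pow_zero, mul_one, pow_one]
  rw [add_comm 1 d, Nat.choose_succ_self_right]

theorem coeff_taylor_sub_ne (P : ℤ[X]) (hP : 0 < P.natDegree) {a b : ℤ} (hab : a ≠ b) :
    (taylor a P - taylor b P).coeff (P.natDegree - 1) ≠ 0 := by
  rw [coeff_sub, coeff_taylor_sub_one P hP, coeff_taylor_sub_one P hP, add_sub_add_left_eq_sub,
    ← mul_sub]
  have : P.leadingCoeff ≠ 0 := by
    rw [Ne, leadingCoeff_eq_zero]; rintro rfl; simp at hP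
  have h3 : (P.natDegree : ℤ) ≠ 0 := by exact_mod_cast hP.ne'
  exact mul_ne_zero (mul_ne_zero h3 this) (sub_ne_zero.2 hab)

theorem natDegree_taylor_sub_pos (P : ℤ[X]) (hP : 2 ≤ P.natDegree) {a b : ℤ} (hab : a ≠ b) :
    0 < (taylor a P - taylor b P).natDegree := by
  have := le_natDegree_of_ne_zero (coeff_taylor_sub_ne P (by omega) hab)
  omega

theorem bad_subsingleton (P₁ P : ℤ[X]) (hP : 2 ≤ P₁.natDegree) (k : ℤ) {a b : ℤ}
    (ha : (taylor a P₁ - taylor k P).natDegree = 0)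
    (hb : (taylor b P₁ - taylor k P).natDegree = 0) : a = b := by
  by_contra hab
  have := natDegree_taylor_sub_pos P₁ hP hab
  have h2 := natDegree_sub_le (taylor a P₁ - taylor k P) (taylor b P₁ - taylor k P)
  rw [sub_sub_sub_cancel_right, ha, hb] at h2
  simp only [max_self] at h2
  omega

/-- Choice of the polynomial used for differencing, and its effect on the family. -/
theorem exists_diff_poly (P₁ : ℤ[X]) (Ps : List ℤ[X]) (hL : Leads P₁ Ps)
    (hPs : ∀ P ∈ Ps, 0 < P.natDegree) (hD : 2 ≤ P₁.natDegree) :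
    ∃ Q : ℤ[X], 0 < Q.natDegree ∧ Q.natDegree ≤ P₁.natDegree ∧ ∀ h k : ℤ, h ≠ 0 →
      (∀ P ∈ P₁ :: Ps, 0 < (taylor h P₁ - taylor k P).natDegree) →
      Leads (taylor h P₁ - Q) (diffFamily P₁ Ps Q h k) ∧
      (taylor h P₁ - Q).natDegree ≤ P₁.natDegree ∧
      (∀ d, Q.natDegree < d → lcs ((taylor h P₁ - Q) :: diffFamily P₁ Ps Q h k) d =
        lcs (P₁ :: Ps) d) ∧
      (lcs ((taylor h P₁ - Q) :: diffFamily P₁ Ps Q h k) Q.natDegree).card <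
        (lcs (P₁ :: Ps) Q.natDegree).card := by
  classical
  have hall : ∀ P ∈ P₁ :: Ps, 0 < P.natDegree ∧ P.natDegree ≤ P₁.natDegree := by
    intro P hP
    rcases List.mem_cons.1 hP with rfl | hP
    · exact ⟨by omega, le_rfl⟩
    · exact ⟨hPs P hP, (hL.2 P hP).1⟩
  have hQ : ∃ Q ∈ P₁ :: Ps, (∀ P ∈ P₁ :: Ps, Q.natDegree ≤ P.natDegree) ∧
      (Q.natDegree < P₁.natDegree ∨
        (Q.natDegree = P₁.natDegree ∧ Q.leadingCoeff ≠ P₁.leadingCoeff) ∨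
        (Q = P₁ ∧ ∀ P ∈ P₁ :: Ps, P.natDegree = P₁.natDegree ∧
          P.leadingCoeff = P₁.leadingCoeff)) := by
    obtain ⟨Q, hQ, hmin⟩ := Finset.exists_min_image (P₁ :: Ps).toFinset natDegree ⟨P₁, by simp⟩
    simp only [List.mem_toFinset] at hQ hmin
    by_cases h1 : Q.natDegree < P₁.natDegree
    · exact ⟨Q, hQ, hmin, Or.inl h1⟩
    · have hQd : Q.natDegree = P₁.natDegree := le_antisymm (hall Q hQ).2 (not_lt.1 h1)
      have hd : ∀ P ∈ P₁ :: Ps, P.natDegree = P₁.natDegree := fun P hP =>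
        le_antisymm (hall P hP).2 (hQd ▸ hmin P hP)
      by_cases h2 : ∃ P ∈ P₁ :: Ps, P.leadingCoeff ≠ P₁.leadingCoeff
      · obtain ⟨P, hP, hne⟩ := h2
        exact ⟨P, hP, fun P' hP' => by rw [hd P hP, hd P' hP'], Or.inr (Or.inl ⟨hd P hP, hne⟩)⟩
      · push Not at h2
        exact ⟨P₁, by simp, fun P' hP' => by rw [hd P' hP'],
          Or.inr (Or.inr ⟨rfl, fun P hP => ⟨hd P hP, h2 P hP⟩⟩)⟩
  obtain ⟨Q, hQm, hmin, hcase⟩ := hQ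
  refine ⟨Q, (hall Q hQm).1, (hall Q hQm).2, fun h k h0 hgood => ?_⟩
  set R₁ := taylor h P₁ - Q with hR₁
  have hmem : ∀ R, R ∈ R₁ :: diffFamily P₁ Ps Q h k ↔
      ∃ P ∈ P₁ :: Ps, R = taylor h P - Q ∨ R = taylor k P - Q := by
    intro R
    simp only [diffFamily, List.mem_cons, List.mem_append, List.mem_map, hR₁]
    constructor
    · rintro (rfl | rfl | ⟨P, hP, rfl⟩ | ⟨P, hP, rfl⟩)
      · exact ⟨P₁, Or.inl rfl, Or.inl rfl⟩
      · exact ⟨P₁, Or.inl rfl, Or.inr rfl⟩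
      · exact ⟨P, Or.inr hP, Or.inl rfl⟩
      · exact ⟨P, Or.inr hP, Or.inr rfl⟩
    · rintro ⟨P, rfl | hP, rfl | rfl⟩
      · exact Or.inl rfl
      · exact Or.inr (Or.inl rfl)
      · exact Or.inr (Or.inr (Or.inl ⟨P, hP, rfl⟩))
      · exact Or.inr (Or.inr (Or.inr ⟨P, hP, rfl⟩))
  have hgt : ∀ P x, Q.natDegree < P.natDegree → (taylor x P - Q).natDegree = P.natDegree ∧
      (taylor x P - Q).leadingCoeff = P.leadingCoeff := by
    intro P x hlt
    have e : (taylor x P - Q).natDegree = P.natDegree := by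
      rw [natDegree_sub_eq_left_of_natDegree_lt (by rwa [natDegree_taylor]), natDegree_taylor]
    refine ⟨e, ?_⟩
    rw [leadingCoeff, e, coeff_sub, coeff_taylor_natDegree, coeff_eq_zero_of_natDegree_lt hlt,
      sub_zero]
  have hle : ∀ P ∈ P₁ :: Ps, ∀ x, (taylor x P - Q).natDegree ≤ P.natDegree := by
    intro P hP x
    refine (natDegree_sub_le _ _).trans ?_
    rw [natDegree_taylor]
    exact max_le le_rfl (hmin P hP)
  have heq : ∀ P x, P.natDegree = Q.natDegree → (taylor x P - Q).natDegree = Q.natDegree →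
      0 < Q.natDegree →
      (taylor x P - Q).leadingCoeff = P.leadingCoeff - Q.leadingCoeff ∧
      P.leadingCoeff ≠ Q.leadingCoeff := by
    intro P x h1 h2 h3
    have e : (taylor x P - Q).leadingCoeff = P.leadingCoeff - Q.leadingCoeff := by
      rw [leadingCoeff, h2, coeff_sub, ← h1, coeff_taylor_natDegree, h1]; rfl
    refine ⟨e, fun hc => ?_⟩
    rw [hc, sub_self, leadingCoeff_eq_zero] at e
    rw [e] at h2
    simp at h2; omega
  have hdeg : 0 < R₁.natDegree ∧ ∀ R ∈ R₁ :: diffFamily P₁ Ps Q h k, R.natDegree ≤ R₁.natDegree := by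
    rcases hcase with hc | ⟨hc, hc'⟩ | ⟨rfl, hc⟩
    · have e := (hgt P₁ h hc).1
      rw [← hR₁] at e
      refine ⟨by omega, fun R hR => ?_⟩
      obtain ⟨P, hP, rfl | rfl⟩ := (hmem R).1 hR
      · rw [e]; exact (hle P hP h).trans (hall P hP).2
      · rw [e]; exact (hle P hP k).trans (hall P hP).2
    · have e : P₁.natDegree ≤ R₁.natDegree := by
        refine le_natDegree_of_ne_zero ?_
        rw [hR₁, coeff_sub, coeff_taylor_natDegree, ← hc]
        exact sub_ne_zero.2 (Ne.symm hc')
      refine ⟨by omega, fun R hR => ?_⟩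
      obtain ⟨P, hP, rfl | rfl⟩ := (hmem R).1 hR
      · exact ((hle P hP h).trans (hall P hP).2).trans e
      · exact ((hle P hP k).trans (hall P hP).2).trans e
    · have e : Q.natDegree - 1 ≤ R₁.natDegree := by
        have := coeff_taylor_sub_ne Q (by omega) h0
        rw [taylor_zero] at this
        exact le_natDegree_of_ne_zero this
      refine ⟨by omega, fun R hR => le_trans ?_ e⟩
      have aux : ∀ P ∈ Q :: Ps, ∀ x, (taylor x P - Q).natDegree ≤ Q.natDegree - 1 := by
        intro P hP x
        by_contra hcon
        push Not at hcon
        have h1 := hle P hP x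
        rw [(hc P hP).1] at h1
        exact (heq P x (hc P hP).1 (by omega) (by omega)).2 (hc P hP).2
      obtain ⟨P, hP, rfl | rfl⟩ := (hmem R).1 hR
      · exact aux P hP h
      · exact aux P hP k
  refine ⟨⟨hdeg.1, fun R hR => ⟨hdeg.2 R (List.mem_cons_of_mem _ hR), ?_⟩⟩,
    hle P₁ (by simp) h, fun d hd => ?_, ?_⟩
  · simp only [diffFamily, List.mem_cons, List.mem_append, List.mem_map] at hR
    rcases hR with rfl | ⟨P, hP, rfl⟩ | ⟨P, hP, rfl⟩
    · rw [hR₁, sub_sub_sub_cancel_right]; exact hgood P₁ (by simp)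
    · rw [hR₁, sub_sub_sub_cancel_right, ← map_sub, natDegree_taylor]; exact (hL.2 P hP).2
    · rw [hR₁, sub_sub_sub_cancel_right]; exact hgood P (by simp [hP])
  · ext c
    simp only [mem_lcs]
    constructor
    · rintro ⟨R, hR, hRd, rfl⟩
      obtain ⟨P, hP, hx⟩ := (hmem R).1 hR
      have : ∃ x, R = taylor x P - Q := by
        rcases hx with rfl | rfl <;> exact ⟨_, rfl⟩
      obtain ⟨x, rfl⟩ := this
      have hlt : Q.natDegree < P.natDegree := by have := hle P hP x; omega
      obtain ⟨e1, e2⟩ := hgt P x hlt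
      exact ⟨P, hP, by omega, e2.symm⟩
    · rintro ⟨P, hP, rfl, rfl⟩
      obtain ⟨e1, e2⟩ := hgt P h hd
      exact ⟨_, (hmem _).2 ⟨P, hP, Or.inl rfl⟩, e1, e2⟩
  · have hsub : lcs (R₁ :: diffFamily P₁ Ps Q h k) Q.natDegree ⊆
        ((lcs (P₁ :: Ps) Q.natDegree).erase Q.leadingCoeff).image (fun c => c - Q.leadingCoeff) := by
      intro c hc
      obtain ⟨R, hR, hRd, rfl⟩ := mem_lcs.1 hc
      obtain ⟨P, hP, hx⟩ := (hmem R).1 hR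
      have : ∃ x, R = taylor x P - Q := by
        rcases hx with rfl | rfl <;> exact ⟨_, rfl⟩
      obtain ⟨x, rfl⟩ := this
      have hPd : P.natDegree = Q.natDegree := by
        by_contra hne
        have hlt : Q.natDegree < P.natDegree := lt_of_le_of_ne (hmin P hP) (Ne.symm hne)
        have := (hgt P x hlt).1
        omega
      obtain ⟨e1, e2⟩ := heq P x hPd hRd (hall Q hQm).1
      refine Finset.mem_image.2 ⟨P.leadingCoeff, ?_, e1.symm⟩
      exact Finset.mem_erase.2 ⟨e2, mem_lcs.2 ⟨P, hP, hPd, rfl⟩⟩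
    refine (Finset.card_le_card hsub).trans_lt (Finset.card_image_le.trans_lt ?_)
    exact Finset.card_erase_lt_of_mem (mem_lcs.2 ⟨Q, hQm, rfl, rfl⟩)

end Polynomial

namespace ErgSys

open Idx Polynomial

variable {𝓐 : Type*} [CommRing 𝓐] [StarRing 𝓐] [Algebra ℂ 𝓐] [StarModule ℂ 𝓐] (X : ErgSys 𝓐)

/-- The product of the translates of the functions in `l` along the polynomials in `l`. -/
noncomputable def polyProd (l : List (ℤ[X] × 𝓐)) (n : ℕ) : 𝓐 :=
  (l.map fun t => X.sh (t.1.eval (n : ℤ)) t.2).prod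

/-- Averages along `P₁` and the polynomials `Ps` are controlled by box seminorms of the function
attached to `P₁`. -/
def PolyCtrl (P₁ : ℤ[X]) (Ps : List ℤ[X]) : Prop :=
  ∀ ε : ℝ, 0 < ε → ∃ T : Finset (ℕ × ℝ × ℕ), (∀ t ∈ T, 0 < t.2.1 ∧ 0 < t.2.2) ∧
    ∀ (w : ℕ → ℂ) (f₀ f₁ : 𝓐) (l : List (ℤ[X] × 𝓐)), l.map Prod.fst = Ps → (∀ n, ‖w n‖ ≤ 1) →
      X.B f₀ → X.B f₁ → (∀ t ∈ l, X.B t.2) →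
      ε ≤ ‖X.Φ (fun n => f₀ * (w n • (X.sh (P₁.eval (n : ℤ)) f₁ * X.polyProd l n)))‖ →
      ∃ t ∈ T, X.Ctrl f₁ t.2.1 t.2.2 t.1

variable {X}

theorem B_polyProd {l : List (ℤ[X] × 𝓐)} (hl : ∀ t ∈ l, X.B t.2) (n : ℕ) :
    X.B (X.polyProd l n) := by
  refine B_prod_list _ ?_
  simp only [List.mem_map, forall_exists_index, and_imp]
  rintro _ t ht rfl
  exact X.B_sh _ (hl t ht)

theorem polyProd_cons (t : ℤ[X] × 𝓐) (l : List (ℤ[X] × 𝓐)) (n : ℕ) :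
    X.polyProd (t :: l) n = X.sh (t.1.eval (n : ℤ)) t.2 * X.polyProd l n := by
  simp [polyProd]

theorem polyProd_append (l l' : List (ℤ[X] × 𝓐)) (n : ℕ) :
    X.polyProd (l ++ l') n = X.polyProd l n * X.polyProd l' n := by
  simp [polyProd]

theorem sh_polyProd (Q : ℤ[X]) (a : ℕ) (l : List (ℤ[X] × 𝓐)) (n : ℕ) :
    X.sh (-(Q.eval (n : ℤ))) (X.polyProd l (n + a)) =
      X.polyProd (l.map fun t => (taylor (a : ℤ) t.1 - Q, t.2)) n := by
  rw [polyProd, polyProd, map_list_prod, List.map_map, List.map_map]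
  congr 1
  refine List.map_congr_left fun t _ => ?_
  simp only [Function.comp]
  rw [← X.sh_add, eval_sub, taylor_eval]
  congr 2
  push_cast; ring

theorem star_polyProd (l : List (ℤ[X] × 𝓐)) (n : ℕ) :
    star (X.polyProd l n) = X.polyProd (l.map fun t => (t.1, star t.2)) n := by
  rw [polyProd, polyProd, ← starRingEnd_apply (R := 𝓐), map_list_prod, List.map_map, List.map_map]
  congr 1
  refine List.map_congr_left fun t _ => ?_
  simp only [Function.comp, starRingEnd_apply]
  rw [map_star (X.sh _)]

theorem polyProd_drop_const (l : List (ℤ[X] × 𝓐)) (hl : ∀ t ∈ l, X.B t.2) :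
    ∃ (g : 𝓐) (l' : List (ℤ[X] × 𝓐)), X.B g ∧
      l'.map Prod.fst = (l.map Prod.fst).filter (fun P => 0 < P.natDegree) ∧
      (∀ t ∈ l', X.B t.2) ∧ ∀ n, X.polyProd l n = g * X.polyProd l' n := by
  induction l with
  | nil => exact ⟨1, [], X.B_one, by simp, by simp, by simp⟩
  | cons t l ih =>
    obtain ⟨g, l', hg, h1, h2, h3⟩ := ih fun t ht => hl t (by simp [ht])
    by_cases ht : 0 < t.1.natDegree
    · refine ⟨g, t :: l', hg, by simp [ht, h1], ?_, fun n => ?_⟩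
      · intro s hs
        rcases List.mem_cons.1 hs with rfl | hs
        · exact hl s (by simp)
        · exact h2 s hs
      · rw [polyProd_cons, polyProd_cons, h3]; ring
    · refine ⟨X.sh (t.1.coeff 0) t.2 * g, l', X.B_mul (X.B_sh _ (hl t (by simp))) hg,
        by simp [ht, h1], h2, fun n => ?_⟩
      rw [polyProd_cons, h3, eq_C_of_natDegree_eq_zero (by omega : t.1.natDegree = 0), eval_C,
        coeff_C_zero, mul_assoc]

theorem polyCtrl_linear {P₁ : ℤ[X]} {Ps : List ℤ[X]} (hL : Leads P₁ Ps) (hD : P₁.natDegree ≤ 1) :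
    X.PolyCtrl P₁ Ps := by
  intro ε hε
  have hform : ∀ P : ℤ[X], P.natDegree ≤ 1 → ∀ n : ℤ, P.eval n = P.coeff 1 * n + P.coeff 0 := by
    intro P hP n
    rw [eval_eq_sum_range' (Nat.lt_succ_of_le hP), Finset.sum_range_succ, Finset.sum_range_one]
    ring
  have h1 : P₁.coeff 1 ≠ 0 := by
    have : P₁.natDegree = 1 := le_antisymm hD hL.1
    rw [← this]
    change P₁.leadingCoeff ≠ 0
    rw [Ne, leadingCoeff_eq_zero]; rintro rfl; simp at this
  have h2 : ∀ c ∈ Ps.map (fun P => P.coeff 1), c ≠ P₁.coeff 1 := by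
    intro c hc
    obtain ⟨P, hP, rfl⟩ := List.mem_map.1 hc
    intro he
    obtain ⟨h3, h4⟩ := hL.2 P hP
    have : (P₁ - P).natDegree ≤ 1 := (natDegree_sub_le _ _).trans (max_le hD (h3.trans hD))
    have h5 : (P₁ - P).natDegree = 1 := by omega
    have h6 : (P₁ - P).leadingCoeff = 0 := by rw [leadingCoeff, h5, coeff_sub, he, sub_self]
    rw [leadingCoeff_eq_zero] at h6
    rw [h6] at h5; simp at h5
  obtain ⟨δ, hδ, C, hC, H⟩ := linear_ctrl (X := X) (Ps.map fun P => P.coeff 1) (P₁.coeff 1) 0 h1 h2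
    ε hε
  refine ⟨{(Ps.length, δ, C)}, by simp [hδ, hC], fun w f₀ f₁ l hl hw h0 hf1 hlB h => ?_⟩
  refine ⟨_, Finset.mem_singleton_self _, ?_⟩
  have := H w f₀ (X.sh (P₁.coeff 0) f₁) (l.map fun t => (t.1.coeff 1, X.sh (t.1.coeff 0) t.2))
    (by rw [← hl]; simp [List.map_map, Function.comp_def]) hw h0 (X.B_sh _ hf1)
    (by
      simp only [List.mem_map, forall_exists_index, and_imp]
      rintro _ t ht rfl
      exact X.B_sh _ (hlB t ht)) (by
      refine h.trans (le_of_eq ?_)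
      congr 2; ext n
      rw [polyProd, List.map_map, ← X.sh_add, sub_zero, hform P₁ hD]
      congr 4
      refine List.map_congr_left fun t ht => ?_
      have ht' : t.1.natDegree ≤ 1 :=
        (hL.2 t.1 (hl ▸ List.mem_map_of_mem ht)).1.trans hD
      simp only [Function.comp]
      rw [← X.sh_add, sub_zero, hform t.1 ht'])
  intro L hL hC
  rw [← V_sh L (P₁.coeff 0)]
  exact this L (by simpa using hL) hC

theorem polyCtrl_of_diff {P₁ : ℤ[X]} {Ps : List ℤ[X]} {Q : ℤ[X]} (hD : 2 ≤ P₁.natDegree)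
    (hQ : ∀ h k : ℤ, h ≠ 0 →
      (∀ P ∈ P₁ :: Ps.filter (fun P => 0 < P.natDegree),
        0 < (taylor h P₁ - taylor k P).natDegree) →
      X.PolyCtrl (taylor h P₁ - Q)
        (diffFamily P₁ (Ps.filter fun P => 0 < P.natDegree) Q h k)) :
    X.PolyCtrl P₁ Ps := by
  classical
  intro ε hε
  set Ps' := Ps.filter fun P => 0 < P.natDegree with hPs'
  set b := (P₁ :: Ps').length + 1 with hb
  obtain ⟨H, hH⟩ := exists_nat_gt (2 * b / ε ^ 2)
  rw [div_lt_iff₀ (by positivity)] at hH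
  have hH0 : 0 < H := by
    rcases Nat.eq_zero_or_pos H with rfl | h'
    · have : (0 : ℝ) ≤ 2 * b := by positivity
      simp only [Nat.cast_zero, zero_mul] at hH
      linarith
    · exact h'
  let bad : Fin H → Fin H → Prop := fun h k => (h : ℕ) = 0 ∨
    ∃ P ∈ P₁ :: Ps', (taylor ((h : ℕ) : ℤ) P₁ - taylor ((k : ℕ) : ℤ) P).natDegree = 0
  have hbad : ∀ k, ∃ s : Finset (Fin H), s.card ≤ b ∧ ∀ h, bad h k → h ∈ s := by
    intro k
    refine ⟨insert ⟨0, hH0⟩ ((P₁ :: Ps').toFinset.biUnion fun P => Finset.univ.filter fun h : Fin H =>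
      (taylor ((h : ℕ) : ℤ) P₁ - taylor ((k : ℕ) : ℤ) P).natDegree = 0), ?_, ?_⟩
    · refine (Finset.card_insert_le _ _).trans (Nat.succ_le_succ ?_)
      refine Finset.card_biUnion_le.trans ?_
      refine (Finset.sum_le_card_nsmul _ _ 1 fun P _ => ?_).trans ?_
      · refine Finset.card_le_one.2 fun x hx y hy => ?_
        simp only [Finset.mem_filter, Finset.mem_univ, true_and] at hx hy
        have := bad_subsingleton P₁ P hD _ hx hy
        exact Fin.ext (by exact_mod_cast this)
      · rw [smul_eq_mul, mul_one]; exact List.toFinset_card_le _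
    · rintro h (h0 | ⟨P, hP, h1⟩)
      · exact Finset.mem_insert.2 (Or.inl (Fin.ext h0))
      · refine Finset.mem_insert_of_mem (Finset.mem_biUnion.2 ⟨P, List.mem_toFinset.2 hP, ?_⟩)
        simpa using h1
  have hchoice : ∀ q : Fin H × Fin H, ∃ T : Finset (ℕ × ℝ × ℕ), (∀ t ∈ T, 0 < t.2.1 ∧ 0 < t.2.2) ∧
      (¬ bad q.1 q.2 → ∀ (w : ℕ → ℂ) (f₀ f₁ : 𝓐) (l : List (ℤ[X] × 𝓐)),
      l.map Prod.fst = diffFamily P₁ Ps' Q (q.1 : ℕ) (q.2 : ℕ) → (∀ n, ‖w n‖ ≤ 1) →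
      X.B f₀ → X.B f₁ → (∀ t ∈ l, X.B t.2) →
      ε ^ 2 / 2 ≤ ‖X.Φ (fun n => f₀ * (w n • (X.sh ((taylor ((q.1 : ℕ) : ℤ) P₁ - Q).eval (n : ℤ)) f₁ *
        X.polyProd l n)))‖ → ∃ t ∈ T, X.Ctrl f₁ t.2.1 t.2.2 t.1) := by
    intro q
    by_cases hq : bad q.1 q.2
    · exact ⟨∅, by simp, fun h => absurd hq h⟩
    · simp only [bad, not_or, not_exists, not_and] at hq
      obtain ⟨T, hT, hT'⟩ := hQ (q.1 : ℕ) (q.2 : ℕ) (by exact_mod_cast hq.1)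
        (fun P hP => Nat.pos_of_ne_zero (hq.2 P hP)) (ε ^ 2 / 2) (by positivity)
      exact ⟨T, hT, fun _ => hT'⟩
  choose T hT hT' using hchoice
  refine ⟨Finset.univ.biUnion T, fun t ht => ?_, fun w f₀ f₁ l hl hw h0 h1 hlB h => ?_⟩
  · obtain ⟨q, -, hq⟩ := Finset.mem_biUnion.1 ht
    exact hT q t hq
  obtain ⟨g, l', hg, hl', hlB', hprod⟩ := polyProd_drop_const l hlB
  rw [hl, ← hPs'] at hl'
  have e : (fun n : ℕ => f₀ * (w n • (X.sh (P₁.eval (n : ℤ)) f₁ * X.polyProd l n))) =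
      fun n : ℕ => (f₀ * g) * (w n • (X.sh (P₁.eval (n : ℤ)) f₁ * X.polyProd l' n)) := by
    ext n
    rw [hprod, mul_smul_comm, mul_smul_comm]
    congr 1; ring
  rw [e] at h
  obtain ⟨a, k, hak, hlow⟩ := vdc_pair hε H b hH0 (by rw [mul_comm (ε ^ 2)]; exact hH) hbad
    (X.B_mul h0 hg) (fun n => B_smul (hw n) (X.B_mul (X.B_sh _ h1) (B_polyProd hlB' n))) h
  obtain ⟨t, ht, hc⟩ := hT' (a, k) hak (fun n => w (n + a) * star (w (n + k))) 1 f₁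
    ((taylor ((k : ℕ) : ℤ) P₁ - Q, star f₁) :: (l'.map (fun t => (taylor ((a : ℕ) : ℤ) t.1 - Q, t.2))
      ++ (l'.map fun t => (t.1, star t.2)).map (fun t => (taylor ((k : ℕ) : ℤ) t.1 - Q, t.2))))
    (by simp [diffFamily, ← hl', List.map_map, Function.comp_def])
    (fun n => by
      rw [norm_mul, norm_star]
      exact mul_le_one₀ (hw _) (norm_nonneg _) (hw _))
    X.B_one h1
    (by
      intro t ht
      simp only [List.mem_cons, List.mem_append, List.mem_map, List.map_map, Function.comp] at ht
      rcases ht with rfl | ⟨t, ht, rfl⟩ | ⟨t, ht, rfl⟩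
      · exact X.B_star h1
      · exact hlB' t ht
      · exact X.B_star (hlB' t ht))
    (by
      refine hlow.trans (le_of_eq ?_)
      rw [← Φ_sh (fun n : ℕ => -(Q.eval (n : ℤ))) (fun n => _ * _)]
      congr 2
      ext n
      have sh1 : ∀ (a : ℕ) (f : 𝓐), X.sh (-(Q.eval (n : ℤ))) (X.sh (P₁.eval ((n + a : ℕ) : ℤ)) f) =
          X.sh ((taylor (a : ℤ) P₁ - Q).eval (n : ℤ)) f := by
        intro a f
        rw [← X.sh_add, eval_sub, taylor_eval]
        congr 2
        push_cast; ring
      rw [polyProd_cons, polyProd_append, ← sh_polyProd, ← sh_polyProd, ← star_polyProd, star_smul,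
        smul_mul_smul_comm, map_smul, star_mul', map_mul (X.sh _), map_mul (X.sh _),
        map_mul (X.sh _), sh1, ← map_star (X.sh _) f₁, sh1, one_mul]
      congr 1
      ring)
  exact ⟨t, Finset.mem_biUnion.2 ⟨_, Finset.mem_univ _, ht⟩, hc⟩

theorem polyCtrl_of_leads (P₁ : ℤ[X]) (Ps : List ℤ[X]) (hL : Leads P₁ Ps) : X.PolyCtrl P₁ Ps := by
  have key : ∀ (D : ℕ) (v : Fin D → ℕ) (P₁ : ℤ[X]) (Ps : List ℤ[X]), Leads P₁ Ps →
      P₁.natDegree ≤ D → (∀ i : Fin D, (lcs (P₁ :: Ps) (i + 1)).card = v i) → X.PolyCtrl P₁ Ps := by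
    intro D v
    have wf : WellFounded (Pi.Lex (ι := Fin D) (β := fun _ => ℕ) (· > ·) (fun {_} => (· < ·))) :=
      Pi.Lex.wellFounded _ fun i => wellFounded_lt
    induction v using wf.induction with
    | _ v ih =>
    intro P₁ Ps hL hD hv
    by_cases h1 : P₁.natDegree ≤ 1
    · exact polyCtrl_linear hL h1
    push Not at h1
    have hmem : ∀ P, P ∈ Ps.filter (fun P => 0 < P.natDegree) ↔ P ∈ Ps ∧ 0 < P.natDegree := by
      simp
    have hL' : Leads P₁ (Ps.filter fun P => 0 < P.natDegree) :=
      ⟨hL.1, fun P hP => hL.2 P ((hmem P).1 hP).1⟩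
    obtain ⟨Q, hQ0, hQ1, hQ⟩ := exists_diff_poly P₁ _ hL' (fun P hP => ((hmem P).1 hP).2) h1
    have hlcs : ∀ d, 0 < d → lcs (P₁ :: Ps.filter fun P => 0 < P.natDegree) d = lcs (P₁ :: Ps) d := by
      intro d hd
      ext c
      simp only [mem_lcs, List.mem_cons, hmem]
      constructor
      · rintro ⟨P, h | h, h2⟩
        · exact ⟨P, Or.inl h, h2⟩
        · exact ⟨P, Or.inr h.1, h2⟩
      · rintro ⟨P, h | h, h2⟩
        · exact ⟨P, Or.inl h, h2⟩
        · exact ⟨P, Or.inr ⟨h, by omega⟩, h2⟩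
    refine polyCtrl_of_diff (Q := Q) h1 fun h k h0 hgood => ?_
    obtain ⟨g1, g2, g3, g4⟩ := hQ h k h0 hgood
    refine ih _ ?_ _ _ g1 (g2.trans hD) fun i => rfl
    refine ⟨⟨Q.natDegree - 1, by omega⟩, fun j hj => ?_, ?_⟩
    · have hj' : Q.natDegree - 1 < (j : ℕ) := hj
      simp only
      rw [g3 _ (by omega), hlcs _ (by omega), hv]
    · simp only
      rw [← hv, Nat.sub_add_cancel hQ0, ← hlcs _ hQ0]
      exact g4
  exact key _ _ P₁ Ps hL le_rfl fun i => rfl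

end ErgSys

/-- Choice of phases making a weighted average large. -/
theorem exists_phases {ι : Type*} [Fintype ι] (z : ι → ℂ) (S : ι → Prop) [DecidablePred S]
    {a θ : ℝ} (ha : 0 ≤ a) (hz : ∀ i, S i → a ≤ ‖z i‖) (hS : θ ≤ 𝔼 i, if S i then (1 : ℝ) else 0) :
    ∃ c : ι → ℂ, (∀ i, ‖c i‖ ≤ 1) ∧ (∀ i, c i ≠ 0 → S i) ∧ a * θ ≤ ‖𝔼 i, c i * z i‖ := by
  have hph : ∀ w : ℂ, ∃ c : ℂ, ‖c‖ ≤ 1 ∧ c * w = (‖w‖ : ℂ) := by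
    intro w
    by_cases hw : w = 0
    · exact ⟨0, by simp, by simp [hw]⟩
    · have hn : (‖w‖ : ℂ) ≠ 0 := by simpa using hw
      refine ⟨‖w‖ / w, ?_, by field_simp⟩
      rw [norm_div, Complex.norm_real, norm_norm, div_self (by simpa using hw)]
  choose c hc1 hc2 using hph
  refine ⟨fun i => if S i then c (z i) else 0, fun i => ?_, fun i hi => ?_, ?_⟩
  · dsimp only; split_ifs
    · exact hc1 _
    · simp
  · by_contra h
    simp [h] at hi
  · have e : 𝔼 i, (if S i then c (z i) else 0) * z i =
        ((𝔼 i, if S i then ‖z i‖ else 0 : ℝ) : ℂ) := by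
      rw [Fintype.expect_eq_sum_div_card, Fintype.expect_eq_sum_div_card]
      push_cast
      congr 1
      refine Finset.sum_congr rfl fun i _ => ?_
      split_ifs <;> simp [hc2]
    rw [e, Complex.norm_real]
    refine le_trans ?_ (le_abs_self _)
    refine (mul_le_mul_of_nonneg_left hS ha).trans ?_
    rw [Finset.mul_expect]
    refine Finset.expect_le_expect fun i _ => ?_
    split_ifs with h
    · simpa using hz i h
    · simp

namespace Idx

theorem cube_smul {M : Type*} [CommRing M] [StarRing M] [Algebra ℂ M] [StarModule ℂ M] :
    ∀ (L : List ℕ) (c : Idx L → ℂ) (g : Idx L → M) (h h' : Idx L),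
    cube L (fun k => c k • g k) h h' = cube L c h h' • cube L g h h'
  | [], _, _, _, _ => rfl
  | _ :: L, c, g, h, h' => by
    rw [cube_cons, cube_cons, cube_cons, ← cube_smul L]
    congr 1; ext k; rw [star_smul, smul_mul_smul_comm]

theorem cube_apply {M : Type*} [CommRing M] [StarRing M] :
    ∀ (L : List ℕ) (g : Idx L → ℕ → M) (h h' : Idx L) (n : ℕ),
    cube L g h h' n = cube L (fun k => g k n) h h'
  | [], _, _, _, _ => rfl
  | _ :: L, g, h, h', n => by
    rw [cube_cons, cube_cons, cube_apply L]
    rfl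

theorem Low.const {M : Type*} [CommRing M] [StarRing M] {P : M → Prop} : ∀ {L : List ℕ}
    {b : Idx L → M}, Low P L b → Low (fun u : ℕ → M => ∀ n, P (u n)) L (fun h _ => b h)
  | [], b, hb => by
    simp only [Low] at hb ⊢; subst hb; rfl
  | _ :: _, b, ⟨b₀, b₁, h0, h1, h2⟩ =>
    ⟨fun k _ => b₀ k, fun i k _ => b₁ i k, fun k _ => h0 k, fun i => (h1 i).const,
      fun i k => by ext n; exact h2 i k⟩

end Idx

namespace ErgSys

open Idx

variable {𝓐 : Type*} [CommRing 𝓐] [StarRing 𝓐] [Algebra ℂ 𝓐] [StarModule ℂ 𝓐] {X : ErgSys 𝓐}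

theorem Φ_const (f : 𝓐) : X.Φ (fun _ => f) = X.int f := by
  have : (fun _ : ℕ => X.int f) = X.int f • (1 : ℕ → ℂ) := by ext; simp
  rw [Φ_apply, this, map_smul, X.m_one, smul_eq_mul, mul_one]

theorem Eig.cube : ∀ (L : List ℕ) {l : Idx L → ℂ} {χ : Idx L → 𝓐}, (∀ k, X.Eig (l k) (χ k)) →
    ∀ h h' : Idx L, X.Eig (Idx.cube L l h h') (Idx.cube L χ h h')
  | [], _, _, hχ, _, _ => hχ _
  | _ :: L, _, _, hχ, h, h' => Eig.cube L (fun _ => (hχ _).mul (hχ _).star) h.snd h'.snd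

theorem Eig.rest : ∀ (L : List ℕ) {l : Idx L → ℂ} {χ : Idx L → 𝓐}, (∀ k, X.Eig (l k) (χ k)) →
    ∀ h h' : Idx L, X.Eig (Idx.rest L l h h') (Idx.rest L χ h h')
  | [], _, _, _, _, _ => Eig.one
  | _ :: L, _, _, hχ, h, h' => (Eig.cube L (fun _ => hχ _) h.snd h'.snd).star.mul
      (Eig.rest L (fun _ => hχ _) h.snd h'.snd)

theorem int_cube_const {ρ : 𝓐} {l : ℂ} (hρ : X.Eig l ρ) : ∀ (H : ℕ) (L : List ℕ) (h h' : Idx (H :: L))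
    (f : 𝓐), X.int (f * Idx.cube (H :: L) (fun _ => ρ) h h') = X.int f
  | H, [], h, h', f => hρ.2.2.2 f
  | H, K :: L, h, h', f => by
    have e : Idx.cube (H :: K :: L) (fun _ => ρ) h h' = Idx.cube (K :: L) (fun _ => ρ) h.snd h'.snd *
        star (Idx.cube (K :: L) (fun _ => ρ) h.snd h'.snd) := cube_cons' _ _ _ _ _
    have hE : X.Eig (Idx.cube (K :: L) (fun _ => l) h.snd h'.snd)
      (Idx.cube (K :: L) (fun _ => ρ) h.snd h'.snd) := Eig.cube (K :: L) (fun _ => hρ) h.snd h'.snd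
    rw [e]
    exact hE.2.2.2 f

/-- Gowers–Cauchy–Schwarz with weights, in terms of iterated derivatives. -/
theorem gowers_nab (L : List ℕ) (hL : ∀ H ∈ L, 0 < H) {b : Idx L → 𝓐} (hb : Low X.B L b)
    {c : Idx L → ℂ} (hc : ∀ h, ‖c h‖ ≤ 1) {ψ : Idx L → 𝓐} (hψ : ∀ h, X.B (ψ h))
    {F : ℕ → 𝓐} (hF : ∀ n, X.B (F n)) :
    ‖𝔼 h, c h * X.Φ (fun n => b h * (ψ h * X.sh (tot h : ℕ) (F n)))‖ ^ 2 ^ L.length ≤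
      𝔼 h, 𝔼 h', if c h ≠ 0 then ‖X.Φ (fun n => cube L ψ h h' * X.nab L h h' (F n))‖ else 0 := by
  have h1 := gowers_cs (X := X) L hL (fun h _ => b h)
    (fun h n => c h • (ψ h * X.sh (tot h : ℕ) (F n))) hb.const
    (fun h n => B_smul (hc h) (X.B_mul (hψ h) (X.B_sh _ (hF n))))
  have e : ∀ h, X.Φ ((fun _ => b h) * fun n => c h • (ψ h * X.sh (tot h : ℕ) (F n))) =
      c h * X.Φ (fun n => b h * (ψ h * X.sh (tot h : ℕ) (F n))) := by
    intro h
    rw [← smul_eq_mul (c h), ← map_smul]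
    congr 1
    ext n
    simp only [Pi.mul_apply, Pi.smul_apply, mul_smul_comm]
  simp only [e] at h1
  refine h1.trans (Finset.expect_le_expect fun h _ => Finset.expect_le_expect fun h' _ => ?_)
  have e2 : cube L (fun h n => c h • (ψ h * X.sh (tot h : ℕ) (F n))) h h' =
      cube L c h h' • fun n => cube L ψ h h' * X.nab L h h' (F n) := by
    ext n
    rw [cube_apply, cube_smul, cube_mul]
    rfl
  rw [e2, map_smul, norm_smul]
  split_ifs with h0
  · refine mul_le_of_le_one_left (norm_nonneg _) ?_
    refine cube_pred (fun z : ℂ => ‖z‖ ≤ 1) (fun a b ha hb => ?_) (fun a ha => ?_) L c h h' hc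
    · rw [norm_mul]; exact mul_le_one₀ ha (norm_nonneg _) hb
    · rwa [norm_star]
  · rw [cube_eq, not_not.1 h0]
    simp

theorem exists_pigeon {ι κ : Type*} [Fintype ι] [Nonempty ι] [DecidableEq κ] (S : ι → Prop)
    [DecidablePred S] (Z : Finset κ) (hZ : Z.Nonempty) (f : ι → κ) (hf : ∀ i, S i → f i ∈ Z) {θ : ℝ}
    (hS : θ ≤ 𝔼 i, if S i then (1 : ℝ) else 0) :
    ∃ z ∈ Z, θ / Z.card ≤ 𝔼 i, if S i ∧ f i = z then (1 : ℝ) else 0 := by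
  by_contra hcon
  push Not at hcon
  have hc : (0 : ℝ) < Z.card := by exact_mod_cast hZ.card_pos
  have h1 : ∑ z ∈ Z, 𝔼 i, (if S i ∧ f i = z then (1 : ℝ) else 0) < ∑ z ∈ Z, θ / Z.card :=
    Finset.sum_lt_sum_of_nonempty hZ fun z hz => hcon z hz
  rw [Finset.sum_const, nsmul_eq_mul, mul_div_cancel₀ _ hc.ne', ← Finset.expect_sum_comm] at h1
  refine absurd (hS.trans (Finset.expect_le_expect fun i _ => ?_)) (not_le.2 h1)
  split_ifs with h
  · refine le_trans ?_ (Finset.single_le_sum (f := fun z => if S i ∧ f i = z then (1 : ℝ) else 0)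
      (fun z _ => by split_ifs <;> norm_num) (hf i h))
    simp [h]
  · exact Finset.sum_nonneg fun z _ => by split_ifs <;> norm_num

/-- If the box norm of `F` is large and the eigenvalues correlating with derivatives of the dual
sequence are roots of unity, then derivatives of `F` have large integrals on average. -/
theorem int_nab_of_V {δ : ℝ} (hδ : 0 < δ) {ε : ℝ} {Q : ℕ} (hQ : 0 < Q) (L : List ℕ)
    (hLne : L ≠ []) (hL : ∀ H ∈ L, 0 < H) (hε : ε = (δ / 4 * (δ / 2)) ^ 2 ^ L.length / 2)
    {F : 𝓐} {Fn : ℕ → 𝓐} (hF : X.B F) (hFn : ∀ n, X.B (Fn n))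
    (hd : ∀ g, X.int (g * F) = X.Φ (fun n => g * Fn n))
    (hE : ∀ (h h' : Idx L) (l : ℂ) (χ : 𝓐), X.Eig l χ →
      ε ≤ ‖X.Φ (fun n => χ * X.nab L h h' (Fn n))‖ → l ^ Q = 1) (hV : δ ≤ X.V L F) :
    (δ / 4 * (ε / (Polynomial.nthRootsFinset Q (1 : ℂ)).card)) ^ 2 ^ L.length ≤
      𝔼 h, 𝔼 h', ‖X.int (X.nab L h h' F)‖ := by
  classical
  have : Nonempty (Idx L) := nonempty L hL
  have hεp : 0 < ε := by rw [hε]; positivity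
  rw [V, Finset.expect_comm] at hV
  obtain ⟨k', -, hk'⟩ := Finset.exists_le_of_le_expect Finset.univ_nonempty hV
  have hdens := expect_boole_of_le (fun h => sn_le_one (B_nab hF L h k')) hδ.le hk'
  have hex : ∀ h : Idx L, ∃ l χ, X.Eig l χ ∧ (δ / 2 ≤ X.sn (X.nab L h k' F) →
      δ / 4 ≤ ‖X.int (X.nab L h k' F * χ)‖) := by
    intro h
    by_cases hh : δ / 2 ≤ X.sn (X.nab L h k' F)
    · obtain ⟨l, χ, h1, h2⟩ := exists_eig_of_lt (X := X) (g := X.nab L h k' F) (c := δ / 4)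
        (by linarith)
      exact ⟨l, χ, h1, fun _ => h2.le⟩
    · exact ⟨1, 1, Eig.one, fun h' => absurd h' hh⟩
  choose l χ hχ hintg using hex
  have hr : ∀ h, X.nab L h k' F = X.sh (tot h : ℕ) F * rest L (fun k => X.sh (tot k : ℕ) F) h k' :=
    fun h => cube_eq _ _ _ _
  have hlow : Low X.B L (fun h => rest L (fun k => X.sh (tot k : ℕ) F) h k') :=
    low_rest (P := X.B) (fun _ _ => X.B_mul) (fun _ => X.B_star) L _ k' fun _ => X.B_sh _ hF
  obtain ⟨c, hc1, hc2, hc3⟩ := exists_phases _ _ (by positivity) hintg hdens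
  have e1 : ∀ h, X.int (X.nab L h k' F * χ h) = X.Φ (fun n =>
      rest L (fun k => X.sh (tot k : ℕ) F) h k' * (χ h * X.sh (tot h : ℕ) (Fn n))) := by
    intro h
    have := hd (X.sh (-(tot h : ℕ)) (rest L (fun k => X.sh (tot k : ℕ) F) h k' * χ h))
    rw [← X.int_sh (tot h : ℕ), ← Φ_sh (fun _ => (tot h : ℕ))] at this
    simp only [map_mul (X.sh _), ← X.sh_add, add_neg_cancel, X.sh_zero] at this
    rw [hr]
    simp only [← mul_assoc] at this ⊢
    rw [← this]
    congr 1; ring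
  simp only [e1] at hc3
  have h2 := (pow_le_pow_left₀ (by positivity) hc3 (2 ^ L.length)).trans
    (gowers_nab L hL hlow hc1 (fun h => (hχ h).2.1) hFn)
  rw [Finset.expect_comm] at h2
  obtain ⟨k'', -, hk''⟩ := Finset.exists_le_of_le_expect Finset.univ_nonempty h2
  have hdens2 := expect_boole_of_le (fun h => by
    split_ifs
    · exact Φ_le fun n => X.B_mul (Eig.cube L hχ h k'').2.1 (B_nab (hFn n) L h k'')
    · norm_num) (by positivity) hk''
  rw [← hε] at hdens2
  set S : Idx L → Prop := fun h => ε ≤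
    if c h ≠ 0 then ‖X.Φ (fun n => cube L χ h k'' * X.nab L h k'' (Fn n))‖ else 0 with hSdef
  have hS0 : ∀ h, S h → c h ≠ 0 := by
    intro h hh h0
    simp only [hSdef, h0, ne_eq, not_true_eq_false, if_false] at hh
    linarith
  have hS : ∀ h, S h → cube L l h k'' ∈ Polynomial.nthRootsFinset Q (1 : ℂ) := by
    intro h hh
    rw [Polynomial.mem_nthRootsFinset hQ]
    refine hE h k'' _ _ (Eig.cube L hχ h k'') ?_
    have := hS0 h hh
    simpa only [hSdef, ne_eq, this, not_false_eq_true, if_true] using hh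
  have hZ : (Polynomial.nthRootsFinset Q (1 : ℂ)).Nonempty :=
    ⟨1, by rw [Polynomial.mem_nthRootsFinset hQ, one_pow]⟩
  have hZc : (0 : ℝ) < (Polynomial.nthRootsFinset Q (1 : ℂ)).card := by exact_mod_cast hZ.card_pos
  obtain ⟨ζ, -, hζ⟩ := exists_pigeon S _ hZ (fun h => cube L l h k'') hS hdens2
  obtain ⟨h₁, hh₁⟩ : ∃ h, S h ∧ cube L l h k'' = ζ := by
    by_contra hcon
    push Not at hcon
    have : 𝔼 h, (if S h ∧ cube L l h k'' = ζ then (1 : ℝ) else 0) = 0 := by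
      refine (Finset.expect_congr rfl fun h _ => ?_).trans (Fintype.expect_const (ι := Idx L) (0 : ℝ))
      exact if_neg fun ⟨a, b⟩ => hcon h a b
    rw [this] at hζ
    have : 0 < ε / (Polynomial.nthRootsFinset Q (1 : ℂ)).card := by positivity
    linarith
  set ρ := cube L χ h₁ k'' with hρdef
  have hρ : X.Eig ζ ρ := hh₁.2 ▸ Eig.cube L hχ h₁ k''
  have hintg₂ : ∀ h, S h ∧ cube L l h k'' = ζ →
      δ / 4 ≤ ‖X.int (X.nab L h k' F * star (rest L χ h k'') * ρ)‖ := by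
    rintro h ⟨hh, hhζ⟩
    have h3 := hintg h (hc2 h (hS0 h hh))
    have hκ : X.Eig ζ (cube L χ h k'') := hhζ ▸ Eig.cube L hχ h k''
    rw [← X.eig_unique ζ (cube L χ h k'') ρ hκ.1 hκ.2.1 hρ.2.1 hκ.2.2.1 hκ.2.2.2 hρ.2.2.1 hρ.2.2.2]
    rw [← (Eig.rest L hχ h k'').2.2.2] at h3
    rw [cube_eq]
    convert h3 using 3
    ring
  obtain ⟨c', hc1', -, hc3'⟩ := exists_phases _ _ (by positivity) hintg₂ hζ
  have hlow2 : Low X.B L (fun h => rest L (fun k => X.sh (tot k : ℕ) F) h k' *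
      star (rest L χ h k'')) :=
    hlow.mul (fun _ _ => X.B_mul) (Low.star (P := X.B) (fun _ => X.B_star)
      (low_rest (P := X.B) (fun _ _ => X.B_mul) (fun _ => X.B_star) L _ k'' fun k => (hχ k).2.1))
  have e2 : ∀ h, X.int (X.nab L h k' F * star (rest L χ h k'') * ρ) = X.Φ (fun _ =>
      rest L (fun k => X.sh (tot k : ℕ) F) h k' * star (rest L χ h k'') *
        (ρ * X.sh (tot h : ℕ) F)) := by
    intro h
    rw [Φ_const, hr]
    congr 1; ring
  simp only [e2] at hc3'
  refine (pow_le_pow_left₀ (by positivity) hc3' (2 ^ L.length)).trans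
    ((gowers_nab L hL hlow2 hc1' (fun _ => hρ.2.1) (fun _ => hF)).trans ?_)
  refine Finset.expect_le_expect fun h _ => Finset.expect_le_expect fun h' _ => ?_
  split_ifs
  · obtain ⟨H, L', rfl⟩ := List.exists_cons_of_ne_nil hLne
    rw [Φ_const, mul_comm, int_cube_const hρ]
  · exact norm_nonneg _

/-- Degree lowering for box seminorms of dual functions. -/
theorem Ctrl.lower {δ : ℝ} (hδ : 0 < δ) (C r : ℕ) : ∃ ε : ℝ, 0 < ε ∧ ∀ Q : ℕ, 0 < Q →
    ∃ δ' : ℝ, 0 < δ' ∧ ∀ (F : 𝓐) (Fn : ℕ → 𝓐), X.B F → (∀ n, X.B (Fn n)) →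
    (∀ g, X.int (g * F) = X.Φ (fun n => g * Fn n)) →
    (∀ (L : List ℕ) (h h' : Idx L) (l : ℂ) (χ : 𝓐), L ≠ [] → X.Eig l χ →
      ε ≤ ‖X.Φ (fun n => χ * X.nab L h h' (Fn n))‖ → l ^ Q = 1) →
    0 < C → X.Ctrl F δ C (r + 1) → X.Ctrl F δ' C r := by
  refine ⟨(δ / 4 * (δ / 2)) ^ 2 ^ (r + 1) / 2, by positivity, fun Q hQ => ?_⟩
  set ε := (δ / 4 * (δ / 2)) ^ 2 ^ (r + 1) / 2 with hε
  have hZ : (Polynomial.nthRootsFinset Q (1 : ℂ)).Nonempty :=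
    ⟨1, by rw [Polynomial.mem_nthRootsFinset hQ, one_pow]⟩
  have hZc : (0 : ℝ) < (Polynomial.nthRootsFinset Q (1 : ℂ)).card := by exact_mod_cast hZ.card_pos
  refine ⟨(δ / 4 * (ε / (Polynomial.nthRootsFinset Q (1 : ℂ)).card)) ^ 2 ^ (r + 1),
    by positivity, ?_⟩
  intro F Fn hF hFn hd hE hC hctrl L hLr hL
  have : Nonempty (Idx L) := nonempty L fun H hH => (hL H hH).1
  refine le_of_forall_pos_le_add fun η hη => ?_
  have hev : ∀ᶠ j : ℕ in atTop, ∀ p : Idx L × Idx L,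
      𝔼 i : Fin j.factorial, 𝔼 i' : Fin j.factorial,
        ‖X.int (X.sh (i : ℕ) (X.nab L p.1 p.2 F) * Star.star (X.sh (i' : ℕ) (X.nab L p.1 p.2 F)))‖ ≤
          X.sn (X.nab L p.1 p.2 F) + η :=
    eventually_all.2 fun p => sn_extract (B_nab hF L p.1 p.2) hη
  obtain ⟨j, hj, hjC⟩ := (hev.and (eventually_ge_atTop C)).exists
  have hlen : (j.factorial :: L).length = r + 1 := by simp [hLr]
  have hpos : ∀ H ∈ j.factorial :: L, 0 < H ∧ C ∣ H := by
    intro H hH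
    rcases List.mem_cons.1 hH with rfl | hH
    · exact ⟨j.factorial_pos, Nat.dvd_factorial hC hjC⟩
    · exact hL H hH
  have key := int_nab_of_V hδ hQ (j.factorial :: L) (by simp) (fun H hH => (hpos H hH).1)
    (ε := ε) (by rw [hlen]) hF hFn hd (fun h h' l χ hχ => hE _ h h' l χ (by simp) hχ)
    (hctrl _ hlen hpos)
  rw [hlen] at key
  refine key.trans ?_
  have e : 𝔼 h : Idx (j.factorial :: L), 𝔼 h' : Idx (j.factorial :: L),
      ‖X.int (X.nab (j.factorial :: L) h h' F)‖ = 𝔼 k : Idx L, 𝔼 k' : Idx L,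
      𝔼 i : Fin j.factorial, 𝔼 i' : Fin j.factorial,
        ‖X.int (X.sh (i : ℕ) (X.nab L k k' F) * Star.star (X.sh (i' : ℕ) (X.nab L k k' F)))‖ := by
    rw [expect_cons, Finset.expect_comm]
    refine Finset.expect_congr (M := ℝ) rfl fun k _ => ?_
    rw [Finset.expect_comm (s := (Finset.univ : Finset (Idx L)))]
    refine Finset.expect_congr (M := ℝ) rfl fun i _ => ?_
    rw [expect_cons, Finset.expect_comm]
    simp only [nab_cons', fst_cons, snd_cons]
  rw [e]
  have hle : X.V L F + η = 𝔼 k : Idx L, 𝔼 k' : Idx L, (X.sn (X.nab L k k' F) + η) := by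
    simp only [Finset.expect_add_distrib, Fintype.expect_const]
    rfl
  rw [hle]
  exact Finset.expect_le_expect fun k _ => Finset.expect_le_expect fun k' _ => hj (k, k')

/-- Iterated degree lowering. -/
theorem Ctrl.le_sn (q : ℝ → ℕ) (hq : ∀ ε, 0 < ε → 0 < q ε) {C : ℕ} (hC : 0 < C) (r : ℕ) :
    ∀ {δ : ℝ}, 0 < δ → ∃ δ' : ℝ, 0 < δ' ∧ ∀ (F : 𝓐) (Fn : ℕ → 𝓐), X.B F → (∀ n, X.B (Fn n)) →
    (∀ g, X.int (g * F) = X.Φ (fun n => g * Fn n)) →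
    (∀ ε : ℝ, 0 < ε → ∀ (L : List ℕ) (h h' : Idx L) (l : ℂ) (χ : 𝓐), L ≠ [] → X.Eig l χ →
      ε ≤ ‖X.Φ (fun n => χ * X.nab L h h' (Fn n))‖ → l ^ q ε = 1) →
    X.Ctrl F δ C r → δ' ≤ X.sn F := by
  induction r with
  | zero =>
    intro δ hδ
    refine ⟨δ, hδ, fun F Fn _ _ _ _ hc => ?_⟩
    rw [← V_nil]
    exact hc [] rfl (by simp)
  | succ r ih =>
    intro δ hδ
    obtain ⟨ε, hε, h1⟩ := Ctrl.lower (X := X) hδ C r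
    obtain ⟨δ₁, hδ₁, h2⟩ := h1 (q ε) (hq ε hε)
    obtain ⟨δ₂, hδ₂, h3⟩ := ih hδ₁
    exact ⟨δ₂, hδ₂, fun F Fn hF hFn hd hE hc => h3 F Fn hF hFn hd hE
      (h2 F Fn hF hFn hd (hE ε hε) hC hc)⟩

end ErgSys

/-- The `k`-th difference of the sequence `p` is constant, equal to `c`. -/
def DiffConst {A : Type*} [AddCommGroup A] : ℕ → A → (ℕ → A) → Prop
  | 0, c, p => ∀ n, p n = c
  | k + 1, c, p => DiffConst k c (fun n => p (n + 1) - p n)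

namespace DiffConst

variable {A A' : Type*} [AddCommGroup A] [AddCommGroup A']

theorem add : ∀ {k : ℕ} {c c' : A} {p p' : ℕ → A}, DiffConst k c p → DiffConst k c' p' →
    DiffConst k (c + c') (fun n => p n + p' n)
  | 0, _, _, _, _, h, h' => fun n => congrArg₂ (· + ·) (h n) (h' n)
  | k + 1, _, _, p, p', h, h' => by
    have := add (k := k) h h'
    rw [DiffConst]
    convert this using 2
    abel

theorem map (φ : A →+ A') : ∀ {k : ℕ} {c : A} {p : ℕ → A}, DiffConst k c p →
    DiffConst k (φ c) (fun n => φ (p n))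
  | 0, _, _, h => fun n => congrArg φ (h n)
  | k + 1, _, p, h => by
    have := map (k := k) φ h
    rw [DiffConst]
    convert this using 2
    rw [map_sub]

theorem sum {ι : Type*} {k : ℕ} (s : Finset ι) {p : ι → ℕ → A}
    (h : ∀ i ∈ s, DiffConst k 0 (p i)) : DiffConst k 0 (fun n => ∑ i ∈ s, p i n) := by
  classical
  induction s using Finset.induction_on with
  | empty =>
    simp only [Finset.sum_empty]
    clear h
    induction k with
    | zero => exact fun _ => rfl
    | succ k ih => rw [DiffConst]; simpa using ih
  | insert a s ha ih =>
    have := (h a (by simp)).add (ih fun i hi => h i (by simp [hi]))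
    simp only [Finset.sum_insert ha]
    rwa [add_zero] at this

theorem shift_sub (i j : ℕ) : ∀ {k : ℕ} {c : A} {p : ℕ → A}, DiffConst (k + 1) c p →
    DiffConst k (((i : ℤ) - j) • c) (fun n => p (n + i) - p (n + j))
  | 0, c, p, h => by
    have h1 : ∀ n i, p (n + i) = p n + (i : ℤ) • c := by
      intro n i
      induction i with
      | zero => simp
      | succ i ih =>
        have := h (n + i)
        rw [sub_eq_iff_eq_add] at this
        rw [← add_assoc, this, ih]
        push_cast
        rw [add_smul, one_smul]
        abel
    intro n
    change p (n + i) - p (n + j) = _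
    rw [h1, h1 n j, sub_smul]
    abel
  | k + 1, c, p, h => by
    have := shift_sub i j (k := k) (p := fun n => p (n + 1) - p n) h
    rw [DiffConst]
    convert this using 2
    rw [add_right_comm _ 1 i, add_right_comm _ 1 j]
    abel

theorem of_fwdDiff : ∀ {k : ℕ} {c : A} {P : ℤ → A}, (fwdDiff 1)^[k] P = (fun _ => c) →
    DiffConst k c (fun n : ℕ => P n)
  | 0, _, _, h => fun n => congrFun h n
  | k + 1, _, P, h => by
    have := of_fwdDiff (k := k) (P := fwdDiff 1 P) h
    rw [DiffConst]
    simpa [fwdDiff] using this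

theorem pow_of_lt (q : ℕ) {d k : ℕ} (h : d < k) :
    DiffConst k (0 : ℤ) (fun n : ℕ => ((q * n : ℕ) : ℤ) ^ d) := by
  have h1 := of_fwdDiff (P := fun r : ℤ => r ^ d) (k := k) (c := 0)
    (fwdDiff_iter_pow_eq_zero_of_lt h)
  have := h1.map (AddMonoidHom.mulLeft ((q : ℤ) ^ d))
  simpa [mul_pow] using this

theorem pow_self (q k : ℕ) :
    DiffConst k ((q : ℤ) ^ k * k.factorial) (fun n : ℕ => ((q * n : ℕ) : ℤ) ^ k) := by
  have h1 := of_fwdDiff (P := fun r : ℤ => r ^ k) (k := k) (c := (k.factorial : ℤ))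
    (fwdDiff_iter_eq_factorial (R := ℤ))
  have := h1.map (AddMonoidHom.mulLeft ((q : ℤ) ^ k))
  simpa [mul_pow] using this

end DiffConst

namespace ErgSys

variable {𝓐 : Type*} [CommRing 𝓐] [StarRing 𝓐] [Algebra ℂ 𝓐] [StarModule ℂ 𝓐] {X : ErgSys 𝓐}

theorem Φ_smul_one (u : ℕ → ℂ) : X.Φ (fun n => u n • (1 : 𝓐)) = X.m u := by
  rw [Φ_apply]
  congr 1
  ext n
  rw [map_smul, X.int_one, smul_eq_mul, mul_one]

theorem m_shift_add {u : ℕ → ℂ} (hu : ∀ n, ‖u n‖ ≤ 1) (h : ℕ) :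
    X.m (fun n => u (n + h)) = X.m u := by
  have := Φ_shift (X := X) (u := fun n => u n • (1 : 𝓐)) (fun n => B_smul (hu n) X.B_one) h
  rwa [Φ_smul_one (fun n => u (n + h)), Φ_smul_one] at this

/-- Off-diagonal form of van der Corput's inequality. -/
theorem vdc_ne {ε : ℝ} (hε : 0 < ε) {H : ℕ} (hb : 2 < ε ^ 2 * H)
    {g : 𝓐} (hg : X.B g) {u : ℕ → 𝓐} (hu : ∀ n, X.B (u n))
    (h : ε ≤ ‖X.Φ (fun n => g * u n)‖) : ∃ i j : Fin H, i ≠ j ∧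
      ε ^ 2 / 2 ≤ ‖X.Φ (fun n => u (n + i) * star (u (n + j)))‖ := by
  have hH : 0 < H := by
    rcases Nat.eq_zero_or_pos H with rfl | h
    · norm_num at hb
    · exact h
  obtain ⟨i, j, h1, h2⟩ := vdc_pair hε H 1 hH (by simpa using hb) (bad := fun i j => i = j)
    (fun k => ⟨{k}, by simp, by simp⟩) hg hu h
  exact ⟨i, j, h1, h2⟩

/-- A unimodular sequence whose `(k+1)`-st multiplicative difference is `z` can only correlate with
a periodic sequence if `z` is a root of unity of controlled order. -/
theorem weyl_top (k : ℕ) : ∀ (P : ℕ), 0 < P → ∀ ε : ℝ, 0 < ε → ∃ Q : ℕ, 0 < Q ∧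
    ∀ (w : ℕ → ℂ) (p : ℕ → Additive Circle) (z : Additive Circle), (∀ n, ‖w n‖ ≤ 1) →
      (∀ n, w (n + P) = w n) → DiffConst (k + 1) z p →
      ε ≤ ‖X.m (fun n => w n * (p n).toMul)‖ → Q • z = 0 := by
  have hB : ∀ (w : ℕ → ℂ) (p : ℕ → Additive Circle), (∀ n, ‖w n‖ ≤ 1) →
      ∀ n, ‖w n * (p n).toMul‖ ≤ 1 := by
    intro w p hw n
    rw [norm_mul, Circle.norm_coe, mul_one]
    exact hw n
  induction k with
  | zero =>
    intro P hP ε hε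
    refine ⟨P, hP, fun w p z hw hwP hp h => ?_⟩
    have h1 : ∀ n, p (n + P) = P • z + p n := by
      intro n
      have := DiffConst.shift_sub P 0 hp n
      simp only [add_zero, Nat.cast_zero, sub_zero, natCast_zsmul] at this
      exact sub_eq_iff_eq_add.1 this
    have h2 := m_shift_add (X := X) (hB w p hw) P
    have h3 : (fun n => w (n + P) * ((p (n + P)).toMul : ℂ)) =
        (((P • z).toMul : Circle) : ℂ) • fun n => w n * ((p n).toMul : ℂ) := by
      ext n
      rw [hwP, h1, toMul_add, Circle.coe_mul, Pi.smul_apply, smul_eq_mul]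
      ring
    rw [h3, map_smul, smul_eq_mul] at h2
    have h4 : X.m (fun n => w n * ((p n).toMul : ℂ)) ≠ 0 := by
      intro h0
      rw [h0, norm_zero] at h
      linarith
    have h5 : (((P • z).toMul : Circle) : ℂ) = 1 := mul_right_cancel₀ h4 (by rw [h2, one_mul])
    have h6 : (P • z).toMul = 1 := Circle.ext h5
    exact h6
  | succ k ih =>
    intro P hP ε hε
    obtain ⟨Q, hQ, hQ'⟩ := ih P hP (ε ^ 2 / 2) (by positivity)
    obtain ⟨H, hH⟩ := exists_nat_gt (2 / ε ^ 2)
    rw [div_lt_iff₀ (by positivity), mul_comm] at hH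
    refine ⟨H.factorial * Q, Nat.mul_pos H.factorial_pos hQ, fun w p z hw hwP hp h => ?_⟩
    rw [← Φ_smul_one] at h
    have h' : ε ≤ ‖X.Φ (fun n => 1 * ((w n * ((p n).toMul : ℂ)) • (1 : 𝓐)))‖ := by
      simpa only [one_mul] using h
    obtain ⟨i, j, hij, h1⟩ := vdc_ne hε hH X.B_one (fun n => B_smul (hB w p hw n) X.B_one) h'
    have e : (fun n => ((w (n + i) * ((p (n + i)).toMul : ℂ)) • (1 : 𝓐)) *
        star ((w (n + j) * ((p (n + j)).toMul : ℂ)) • (1 : 𝓐))) = fun n =>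
        (w (n + i) * star (w (n + j)) * ((p (n + i) - p (n + j)).toMul : Circle)) • (1 : 𝓐) := by
      ext n
      rw [star_smul, star_one, smul_mul_smul_comm, mul_one, star_mul', toMul_sub, Circle.coe_div,
        div_eq_mul_inv, ← Circle.coe_inv, Circle.coe_inv_eq_conj, Complex.star_def]
      congr 1
      ring
    rw [e, Φ_smul_one] at h1
    have h2 := hQ' (fun n => w (n + i) * star (w (n + j))) (fun n => p (n + i) - p (n + j)) _
      (fun n => ?_) (fun n => ?_) (hp.shift_sub i j) h1
    · have hne : ((i : ℕ) : ℤ) - (j : ℕ) ≠ 0 := by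
        rw [sub_ne_zero]
        exact_mod_cast fun h => hij (Fin.ext h)
      have h3 : Q • (((i : ℕ) : ℤ) - (j : ℕ)).natAbs • z = 0 := by
        rcases Int.natAbs_eq (((i : ℕ) : ℤ) - (j : ℕ)) with h4 | h4
        · rw [h4, natCast_zsmul] at h2
          exact h2
        · rw [h4, neg_smul, natCast_zsmul, smul_neg, neg_eq_zero] at h2
          exact h2
      obtain ⟨N, hN⟩ := Nat.dvd_factorial (m := (((i : ℕ) : ℤ) - (j : ℕ)).natAbs) (n := H)
        (Int.natAbs_pos.2 hne) (by have := i.2; have := j.2; omega)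
      rw [hN, mul_comm _ N, mul_assoc, mul_smul, mul_comm _ Q, mul_smul, h3, smul_zero]
    · rw [norm_mul, norm_star]
      exact mul_le_one₀ (hw _) (norm_nonneg _) (hw _)
    · rw [add_right_comm, add_right_comm n P, hwP, hwP]

/-- The phase `∏ λ_d ^ (q n) ^ d`. -/
noncomputable def _root_.phase (q : ℕ) (D : Finset ℕ) (z : ℕ → Circle) (n : ℕ) : Circle :=
  ∏ d ∈ D, z d ^ (q * n) ^ d

theorem _root_.pow_mul_add_periodic {G : Type*} [Group G] {z : G} {Q : ℕ} (h : z ^ Q = 1) (q d n : ℕ) :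
    z ^ (q * (n + Q)) ^ d = z ^ (q * n) ^ d := by
  rw [pow_eq_pow_iff_modEq]
  refine Nat.ModEq.pow _ ?_
  refine Nat.ModEq.of_dvd (orderOf_dvd_of_pow_eq_one h) ?_
  rw [mul_add]
  simp [Nat.ModEq]

/-- Weyl's theorem, in quantitative form. -/
theorem weyl (q : ℕ) (D : Finset ℕ) (hD : ∀ d ∈ D, 0 < d) : ∀ (P : ℕ), 0 < P →
    ∀ ε : ℝ, 0 < ε → ∃ Q : ℕ, 0 < Q ∧ ∀ (w : ℕ → ℂ) (z : ℕ → Circle), (∀ n, ‖w n‖ ≤ 1) →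
      (∀ n, w (n + P) = w n) → 0 < q → ε ≤ ‖X.m (fun n => w n * phase q D z n)‖ →
      ∀ d ∈ D, z d ^ Q = 1 := by
  induction D using Finset.induction_on_max with
  | empty => exact fun P hP ε hε => ⟨1, one_pos, by simp⟩
  | insert m D hm ih =>
    intro P hP ε hε
    rcases Nat.eq_zero_or_pos q with rfl | hq
    · exact ⟨1, one_pos, fun _ _ _ _ h => absurd h (lt_irrefl _)⟩
    have hmD : m ∉ D := fun h => lt_irrefl _ (hm m h)
    have hm0 : 0 < m := hD m (by simp)
    obtain ⟨k, rfl⟩ : ∃ k, m = k + 1 := ⟨m - 1, by omega⟩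
    obtain ⟨Q₁, hQ₁, h1⟩ := weyl_top (X := X) k P hP ε hε
    set Q₂ := Q₁ * (q ^ (k + 1) * (k + 1).factorial) with hQ₂
    have hQ₂p : 0 < Q₂ := by positivity
    obtain ⟨Q₃, hQ₃, h3⟩ := ih (fun d hd => hD d (by simp [hd])) (P * Q₂) (by positivity) ε hε
    refine ⟨Q₂ * Q₃, by positivity, fun w z hw hwP _ h => ?_⟩
    have hphase : ∀ n, Additive.ofMul (phase q (insert (k + 1) D) z n) =
        zmultiplesHom _ (Additive.ofMul (z (k + 1))) (((q * n : ℕ) : ℤ) ^ (k + 1)) +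
        ∑ d ∈ D, zmultiplesHom _ (Additive.ofMul (z d)) (((q * n : ℕ) : ℤ) ^ d) := by
      intro n
      simp only [zmultiplesHom_apply]
      simp only [← Nat.cast_pow, natCast_zsmul, ← ofMul_pow, ← ofMul_prod, ← ofMul_mul]
      rw [phase, Finset.prod_insert hmD]
    have hdiff : DiffConst (k + 1) (zmultiplesHom _ (Additive.ofMul (z (k + 1)))
        ((q : ℤ) ^ (k + 1) * (k + 1).factorial) + 0)
        (fun n => Additive.ofMul (phase q (insert (k + 1) D) z n)) := by
      simp only [hphase]
      refine ((DiffConst.pow_self q (k + 1)).map _).add (DiffConst.sum D fun d hd => ?_)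
      have := (DiffConst.pow_of_lt q (hm d hd)).map (zmultiplesHom _ (Additive.ofMul (z d)))
      rwa [map_zero] at this
    have h4 := h1 w _ _ hw hwP hdiff h
    have h5 : z (k + 1) ^ Q₂ = 1 := by
      rw [add_zero, zmultiplesHom_apply] at h4
      have e : ((q : ℤ) ^ (k + 1) * (k + 1).factorial) =
        ((q ^ (k + 1) * (k + 1).factorial : ℕ) : ℤ) := by push_cast; ring
      rw [e, natCast_zsmul, ← mul_smul, ← ofMul_pow] at h4
      exact h4
    intro d hd
    rcases Finset.mem_insert.1 hd with rfl | hd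
    · rw [pow_mul, h5, one_pow]
    · rw [mul_comm, pow_mul]
      rw [h3 (fun n => w n * (z (k + 1) ^ (q * n) ^ (k + 1) : Circle)) z (fun n => ?_)
        (fun n => ?_) hq ?_ d hd, one_pow]
      · convert h using 4 with n
        rw [phase, phase, Finset.prod_insert hmD, Circle.coe_mul]
        ring
      · rw [norm_mul, Circle.norm_coe, mul_one]
        exact hw n
      · have e1 : w (n + P * Q₂) = w n := by
          have : ∀ N, w (n + P * N) = w n := by
            intro N
            induction N with
            | zero => rfl
            | succ N ih => rw [mul_add, mul_one, ← add_assoc, hwP, ih]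
          exact this Q₂
        rw [e1, mul_comm P, pow_mul_add_periodic (by rw [pow_mul, h5, one_pow])]

end ErgSys

theorem Finset.exists_pos_forall_le {ι : Type*} (T : Finset ι) (f : ι → ℝ) (hf : ∀ t ∈ T, 0 < f t) :
    ∃ δ : ℝ, 0 < δ ∧ ∀ t ∈ T, δ ≤ f t := by
  rcases T.eq_empty_or_nonempty with rfl | hT
  · exact ⟨1, one_pos, by simp⟩
  · obtain ⟨t, ht, h⟩ := T.exists_min_image f hT
    exact ⟨f t, hf t ht, h⟩

namespace ErgSys

open Idx Polynomial

variable {𝓐 : Type*} [CommRing 𝓐] [StarRing 𝓐] [Algebra ℂ 𝓐] [StarModule ℂ 𝓐]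

section

variable (X : ErgSys 𝓐)

/-- Product of translates along the monomials `(q n) ^ d`. -/
noncomputable def monProd (q : ℕ) (l : List (ℕ × 𝓐)) (n : ℕ) : 𝓐 :=
  (l.map fun t => X.sh (((q * n : ℕ) : ℤ) ^ t.1) t.2).prod

/-- Multiple correlation along the monomials `(q n) ^ d`, twisted by a polynomial phase. -/
noncomputable def val (q : ℕ) (D : Finset ℕ) (z : ℕ → Circle) (f₀ : 𝓐) (l : List (ℕ × 𝓐)) : ℂ :=
  X.Φ fun n => (phase q D z n : ℂ) • (f₀ * X.monProd q l n)

/-- If a correlation with exponents `ds` is nonnegligible, then the frequencies outside `ds` are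
roots of unity of controlled order. -/
def RootOrder (q : ℕ) (D : Finset ℕ) (ds : List ℕ) : Prop :=
  ∀ ε : ℝ, 0 < ε → ∃ Q : ℕ, 0 < Q ∧ ∀ (z : ℕ → Circle) (f₀ : 𝓐) (l : List (ℕ × 𝓐)),
    l.map Prod.fst = ds → X.B f₀ → (∀ t ∈ l, X.B t.2) → ε ≤ ‖X.val q D z f₀ l‖ →
    ∀ d ∈ D, d ∉ ds → z d ^ Q = 1

/-- `f` is orthogonal to all functions invariant under a nonzero power of the shift. -/
def RatOrth (f : 𝓐) : Prop :=
  ∀ b : ℤ, b ≠ 0 → ∀ G, X.B G → (∀ g, X.B g → X.int (g * X.sh b G) = X.int (g * G)) →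
    X.int (f * G) = 0

end

variable {X : ErgSys 𝓐}

theorem monProd_nil (q n : ℕ) : X.monProd q [] n = 1 := rfl

theorem monProd_cons (q : ℕ) (t : ℕ × 𝓐) (l : List (ℕ × 𝓐)) (n : ℕ) :
    X.monProd q (t :: l) n = X.sh (((q * n : ℕ) : ℤ) ^ t.1) t.2 * X.monProd q l n := by
  simp [monProd]

theorem monProd_append (q : ℕ) (l l' : List (ℕ × 𝓐)) (n : ℕ) :
    X.monProd q (l ++ l') n = X.monProd q l n * X.monProd q l' n := by
  simp [monProd]

theorem B_monProd {l : List (ℕ × 𝓐)} (hl : ∀ t ∈ l, X.B t.2) (q n : ℕ) :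
    X.B (X.monProd q l n) := by
  refine B_prod_list _ ?_
  simp only [List.mem_map, forall_exists_index, and_imp]
  rintro _ t ht rfl
  exact X.B_sh _ (hl t ht)

theorem nab_one : ∀ (L : List ℕ) (h h' : Idx L), X.nab L h h' 1 = 1
  | [], h, h' => by
    rw [nab]
    exact map_one (X.sh _)
  | H :: L, h, h' => by
    rw [nab_cons, map_one (X.sh _), map_one (X.sh _), star_one, mul_one, nab_one L]

theorem nab_smul {L : List ℕ} (hL : L ≠ []) (h h' : Idx L) {c : ℂ} (hc : ‖c‖ = 1) (F : 𝓐) :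
    X.nab L h h' (c • F) = X.nab L h h' F := by
  cases L with
  | nil => exact absurd rfl hL
  | cons H L =>
    have h1 : c * star c = 1 := by
      rw [Complex.star_def, Complex.mul_conj, Complex.normSq_eq_norm_sq, hc]
      norm_num
    rw [nab_cons, nab_cons, map_smul (X.sh _), map_smul (X.sh _), star_smul, smul_mul_smul_comm, h1,
      one_smul]

theorem nab_monProd (L : List ℕ) (h h' : Idx L) (q : ℕ) (l : List (ℕ × 𝓐)) (n : ℕ) :
    X.nab L h h' (X.monProd q l n) =
      X.monProd q (l.map fun t => (t.1, X.nab L h h' t.2)) n := by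
  induction l with
  | nil => exact nab_one L h h'
  | cons t l ih => rw [List.map_cons, monProd_cons, monProd_cons, nab_mul, nab_sh, ih]

theorem Eig.Φ_mul_sh {l : ℂ} {χ : 𝓐} (h : X.Eig l χ) (a : ℕ → ℕ) (w : ℕ → ℂ) (G : ℕ → 𝓐) :
    X.Φ (fun n => χ * (w n • X.sh (-(a n : ℤ)) (G n))) =
      X.Φ (fun n => (w n * l ^ a n) • (χ * G n)) := by
  rw [Φ_apply, Φ_apply]
  congr 1
  ext n
  rw [mul_smul_comm, map_smul, map_smul, ← X.int_sh (a n : ℤ), map_mul (X.sh _), ← X.sh_add,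
    add_neg_cancel, X.sh_zero, mul_comm, h.sh, zpow_natCast, smul_eq_mul, smul_eq_mul,
    mul_comm (G n), mul_assoc]

theorem val_eq_int {q : ℕ} {D : Finset ℕ} {z : ℕ → Circle} {f₀ fm F : 𝓐} {m : ℕ}
    {l : List (ℕ × 𝓐)} (hF : ∀ g, X.int (g * F) = X.Φ (fun n => g *
      ((phase q D z n : ℂ) • X.sh (-(((q * n) ^ m : ℕ) : ℤ)) (f₀ * X.monProd q l n)))) :
    X.val q D z f₀ ((m, fm) :: l) = X.int (fm * F) := by
  rw [hF, val, Φ_apply, Φ_apply]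
  congr 1
  ext n
  rw [mul_smul_comm, map_smul, map_smul, ← X.int_sh (((q * n) ^ m : ℕ) : ℤ) (fm * _),
    map_mul (X.sh _), ← X.sh_add, add_neg_cancel, X.sh_zero, monProd_cons]
  push_cast
  congr 2
  ring

theorem phase_update {q : ℕ} {D : Finset ℕ} {m : ℕ} (hm : m ∈ D) (z : ℕ → Circle) (c : Circle)
    (n : ℕ) : phase q D (Function.update z m (z m * c)) n = phase q D z n * c ^ (q * n) ^ m := by
  rw [phase, phase, ← Finset.mul_prod_erase D _ hm, ← Finset.mul_prod_erase D _ hm,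
    Function.update_self, mul_pow, Finset.prod_congr rfl (g := fun d => z d ^ (q * n) ^ d)]
  · exact mul_right_comm _ _ _
  · intro d hd
    rw [Function.update_of_ne (Finset.ne_of_mem_erase hd)]

theorem Eig.exists_circle {l : ℂ} {χ : 𝓐} (h : X.Eig l χ) : ∃ c : Circle, (c : ℂ) = l :=
  ⟨⟨l, mem_sphere_zero_iff_norm.2 h.1⟩, rfl⟩

/-- The function attached to the largest exponent may be replaced by an eigenfunction. -/
theorem val_reduce {q : ℕ} (hq : 0 < q) {D : Finset ℕ} {ds : List ℕ} (hc : X.RootOrder q D ds)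
    {m : ℕ} (hm : m ∈ D) (hm0 : 0 < m) (hds : ∀ d ∈ ds, d < m) {ε : ℝ} (hε : 0 < ε) :
    ∃ δ : ℝ, 0 < δ ∧ ∀ (z : ℕ → Circle) (f₀ fm : 𝓐) (l : List (ℕ × 𝓐)), l.map Prod.fst = ds →
      X.B f₀ → X.B fm → (∀ t ∈ l, X.B t.2) → ε ≤ ‖X.val q D z f₀ ((m, fm) :: l)‖ →
      ∃ (c : Circle) (χ : 𝓐), X.Eig c χ ∧
        δ ≤ ‖X.val q D (Function.update z m (z m * c)) (f₀ * χ) l‖ := by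
  set mon : ℕ → ℤ[X] := fun d => (C (q : ℤ) * Polynomial.X) ^ d with hmon
  have hq' : (q : ℤ) ≠ 0 := by exact_mod_cast hq.ne'
  have hdeg : ∀ d, (mon d).natDegree = d := by
    intro d
    rw [hmon]
    simp only [natDegree_pow, natDegree_C_mul_X _ hq', mul_one]
  have heval : ∀ d (n : ℕ), (mon d).eval (n : ℤ) = (((q * n : ℕ) : ℤ)) ^ d := by
    intro d n
    simp [hmon]
  have hL : Leads (mon m) (ds.map mon) := by
    refine ⟨by rwa [hdeg], fun P hP => ?_⟩
    obtain ⟨d, hd, rfl⟩ := List.mem_map.1 hP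
    have h1 : (mon d).natDegree < (mon m).natDegree := by rw [hdeg, hdeg]; exact hds d hd
    exact ⟨h1.le, by rw [natDegree_sub_eq_left_of_natDegree_lt h1, hdeg]; exact hm0⟩
  obtain ⟨T, hT, hT'⟩ := polyCtrl_of_leads (X := X) _ _ hL (ε ^ 2) (by positivity)
  choose Q hQ hQ' using hc
  classical
  set qq : ℝ → ℕ := fun ε => if h : 0 < ε then Q ε h else 1 with hqq
  have hqq0 : ∀ ε, 0 < ε → 0 < qq ε := by
    intro ε h
    rw [hqq]
    simp only [h, dif_pos]
    exact hQ ε h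
  have hsn := fun (t : ℕ × ℝ × ℕ) (ht : t ∈ T) =>
    Ctrl.le_sn (X := X) qq hqq0 (hT t ht).2 t.1 (hT t ht).1
  choose! δ' hδ' hsn using hsn
  obtain ⟨δ, hδ, hδT⟩ := T.exists_pos_forall_le δ' hδ'
  refine ⟨δ / 2, by positivity, fun z f₀ fm l hl hf₀ hfm hlB h => ?_⟩
  set Fn : ℕ → 𝓐 := fun n =>
    (phase q D z n : ℂ) • X.sh (-(((q * n) ^ m : ℕ) : ℤ)) (f₀ * X.monProd q l n) with hFn
  have hFnB : ∀ n, X.B (Fn n) := fun n => B_smul (Circle.norm_coe _).le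
    (X.B_sh _ (X.B_mul hf₀ (B_monProd hlB q n)))
  obtain ⟨F, hFB, hF⟩ := X.dual Fn hFnB
  replace hF : ∀ g, X.int (g * F) = X.Φ (fun n => g * Fn n) := hF
  rw [val_eq_int hF] at h
  have h1 : ε ^ 2 ≤ ‖X.Φ (fun n => f₀ * ((phase q D z n : ℂ) • (X.sh ((mon m).eval (n : ℤ)) (star F) *
      X.polyProd (l.map fun t => (mon t.1, t.2)) n)))‖ := by
    have e : X.Φ (fun n => f₀ * ((phase q D z n : ℂ) • (X.sh ((mon m).eval (n : ℤ)) (star F) *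
      X.polyProd (l.map fun t => (mon t.1, t.2)) n))) = X.int (star F * F) := by
      rw [← val_eq_int hF, val]
      congr 1
      ext n
      rw [monProd_cons, heval, mul_smul_comm, polyProd, monProd, List.map_map]
      simp only [Function.comp_def, heval]
    rw [e, mul_comm]
    exact (pow_le_pow_left₀ hε.le h 2).trans ((X.int_cs hfm hFB).trans (Complex.re_le_norm _))
  obtain ⟨t, ht, hct⟩ := hT' _ f₀ (star F) _ (by
    rw [List.map_map, ← hl, List.map_map]; rfl) (fun n => (Circle.norm_coe _).le) hf₀
    (X.B_star hFB) (by
      intro s hs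
      obtain ⟨s', hs', rfl⟩ := List.mem_map.1 hs
      exact hlB s' hs') h1
  have hle := hsn t ht F Fn hFB hFnB hF ?_ hct.star
  · obtain ⟨c, χ, hE, h2⟩ := exists_eig_of_lt
      (show δ / 2 < X.sn F by linarith [hδT t ht])
    obtain ⟨c, rfl⟩ := hE.exists_circle
    refine ⟨c, χ, hE, ?_⟩
    refine h2.le.trans (le_of_eq ?_)
    rw [mul_comm, hF, hE.Φ_mul_sh (fun n => (q * n) ^ m), val]
    congr 2
    ext n
    rw [phase_update hm, Circle.coe_mul, Circle.coe_pow, mul_left_comm, mul_assoc]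
  · intro ε' hε' L h h' c χ hL hE h3
    obtain ⟨c, rfl⟩ := hE.exists_circle
    have e : X.Φ (fun n => χ * X.nab L h h' (Fn n)) = X.val q D (Function.update 1 m
        ((1 : ℕ → Circle) m * c)) (χ * X.nab L h h' f₀)
        (l.map fun t => (t.1, X.nab L h h' t.2)) := by
      have e1 : ∀ n, X.nab L h h' (Fn n) = (1 : ℂ) • X.sh (-(((q * n) ^ m : ℕ) : ℤ))
          (X.nab L h h' f₀ * X.monProd q (l.map fun t => (t.1, X.nab L h h' t.2)) n) := by
        intro n
        rw [hFn, nab_smul hL _ _ (Circle.norm_coe _), nab_sh, nab_mul, nab_monProd, one_smul]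
      simp only [e1]
      rw [hE.Φ_mul_sh (fun n => (q * n) ^ m) (fun _ => 1), val]
      congr 1
      ext n
      rw [phase_update hm 1, Circle.coe_mul, Circle.coe_pow, mul_assoc]
      simp [phase]
    rw [e] at h3
    have h4 := hQ' ε' hε' _ _ _ (by rw [List.map_map, ← hl]; rfl)
      (X.B_mul hE.2.1 (B_nab hf₀ L h h')) (by
        intro s hs
        obtain ⟨s', hs', rfl⟩ := List.mem_map.1 hs
        exact B_nab (hlB s' hs') L h h') h3 m hm (fun hmd => lt_irrefl _ (hds m hmd))
    rw [Function.update_self, Pi.one_apply, one_mul] at h4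
    have h5 : qq ε' = Q ε' hε' := by
      rw [hqq]
      simp only [hε', dif_pos]
    rw [h5]
    rw [← Circle.coe_pow, h4, Circle.coe_one]

theorem rootOrder {q : ℕ} (hq : 0 < q) {D : Finset ℕ} (hD : ∀ d ∈ D, 0 < d) :
    ∀ {ds : List ℕ}, ds.Pairwise (· > ·) → (∀ d ∈ ds, d ∈ D) → X.RootOrder q D ds
  | [], _, _ => by
    intro ε hε
    obtain ⟨Q, hQ, h⟩ := weyl (X := X) q D hD 1 one_pos ε hε
    refine ⟨Q, hQ, fun z f₀ l hl hf₀ _ hv d hd _ => ?_⟩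
    rw [List.map_eq_nil_iff] at hl
    subst hl
    refine h (fun _ => X.int f₀) z (fun _ => X.int_le hf₀) (fun _ => rfl) hq ?_ d hd
    rw [val, Φ_apply] at hv
    simp only [map_smul, monProd_nil, mul_one, smul_eq_mul, mul_comm _ (X.int f₀)] at hv
    exact hv
  | m :: ds, hp, hds => by
    have ih := rootOrder hq hD (ds := ds) hp.of_cons fun d hd => hds d (by simp [hd])
    have hm := hds m (by simp)
    intro ε hε
    obtain ⟨δ, hδ, h1⟩ := val_reduce hq ih hm (hD m hm)
      (fun d hd => List.rel_of_pairwise_cons hp hd) hε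
    obtain ⟨Q, hQ, h2⟩ := ih δ hδ
    refine ⟨Q, hQ, fun z f₀ l hl hf₀ hlB hv d hd hd' => ?_⟩
    rw [List.map_eq_cons_iff] at hl
    obtain ⟨⟨m', fm⟩, l, rfl, rfl, hl⟩ := hl
    obtain ⟨c, χ, hE, h3⟩ := h1 z f₀ fm l hl hf₀ (hlB (m', fm) (by simp))
      (fun t ht => hlB t (by simp [ht])) hv
    have h4 := h2 _ _ l hl (X.B_mul hf₀ hE.2.1) (fun t ht => hlB t (by simp [ht])) h3 d hd
      (fun h => hd' (by simp [h]))
    rwa [Function.update_of_ne (fun h => hd' (by simp [h]))] at h4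

/-- A rationally orthogonal function has vanishing averages along nonconstant polynomials. -/
theorem Φ_eq_zero_of_ratOrth {f : 𝓐} (hf : X.B f) (hr : X.RatOrth f) {P : ℕ} (hP : 0 < P) (k : ℕ) :
    ∀ {w : ℕ → ℂ} {c : ℤ} {p : ℕ → ℤ} {φ : 𝓐}, (∀ n, ‖w n‖ ≤ 1) → (∀ n, w (n + P) = w n) →
      DiffConst (k + 1) c p → c ≠ 0 → X.B φ →
      X.Φ (fun n => φ * (w n • X.sh (p n) f)) = 0 := by
  induction k with
  | zero =>
    intro w c p φ hw hwP hp hc hφ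
    have hB : ∀ n, X.B (w n • X.sh (p n) f) := fun n => B_smul (hw n) (X.B_sh _ hf)
    obtain ⟨F, hFB, hF⟩ := X.dual _ hB
    replace hF : ∀ g, X.int (g * F) = X.Φ (fun n => g * (w n • X.sh (p n) f)) := hF
    have hpP : ∀ n, p (n + P) = c * P + p n := by
      intro n
      have := DiffConst.shift_sub P 0 hp n
      simp only [add_zero, Nat.cast_zero, sub_zero, smul_eq_mul] at this
      linarith
    have hinv : ∀ g, X.B g → X.int (g * X.sh (c * P) F) = X.int (g * F) := by
      intro g hg
      rw [← X.int_sh (-(c * P)), map_mul (X.sh _), ← X.sh_add, neg_add_cancel, X.sh_zero, hF, hF,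
        Φ_apply]
      have e : ∀ n, X.int (X.sh (-(c * P)) g * (w n • X.sh (p n) f)) =
          X.int (g * (w (n + P) • X.sh (p (n + P)) f)) := by
        intro n
        rw [← X.int_sh (c * P), map_mul (X.sh _), ← X.sh_add, add_neg_cancel, X.sh_zero,
          map_smul (X.sh _), ← X.sh_add, hwP, hpP]
      simp only [e]
      exact Φ_shift (u := fun n => g * (w n • X.sh (p n) f)) (fun n => X.B_mul hg (hB n)) P
    have h0 : X.int (F * star F) = 0 := by
      rw [mul_comm, hF, Φ_apply]
      have e : ∀ n, X.int (star F * (w n • X.sh (p n) f)) = 0 := by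
        intro n
        rw [mul_smul_comm, map_smul, ← X.int_sh (-(p n)), map_mul (X.sh _), ← X.sh_add,
          neg_add_cancel, X.sh_zero, mul_comm, hr (c * P) (by positivity) _
          (X.B_sh _ (X.B_star hFB)), smul_zero]
        intro g hg
        have h1 := hinv (X.sh (p n) (star g)) (X.B_sh _ (X.B_star hg))
        have h2 := congrArg star h1
        rw [← X.int_star, ← X.int_star, star_mul', star_mul', ← map_star (X.sh _), star_star,
          ← map_star (X.sh _), ← X.int_sh (-(p n)), ← X.int_sh (-(p n)) (_ * star F),
          map_mul (X.sh _), map_mul (X.sh _), ← X.sh_add, neg_add_cancel, X.sh_zero, sh_comm] at h2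
        exact h2
      simp only [e]
      exact map_zero X.m
    have h1 := X.int_cs hφ hFB
    rw [h0, Complex.zero_re, hF] at h1
    exact norm_eq_zero.1 (pow_eq_zero_iff two_ne_zero |>.1 (le_antisymm h1 (by positivity)))
  | succ k ih =>
    intro w c p φ hw hwP hp hc hφ
    by_contra hne
    have hε := norm_pos_iff.2 hne
    set ε := ‖X.Φ (fun n => φ * (w n • X.sh (p n) f))‖ with hεdef
    obtain ⟨H, hH⟩ := exists_nat_gt (2 / ε ^ 2)
    rw [div_lt_iff₀ (by positivity), mul_comm] at hH
    obtain ⟨i, j, hij, h1⟩ := vdc_ne hε hH hφ (u := fun n => w n • X.sh (p n) f)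
      (fun n => B_smul (hw n) (X.B_sh _ hf)) le_rfl
    have e : X.Φ (fun n => w (n + i) • X.sh (p (n + i)) f * star (w (n + j) • X.sh (p (n + j)) f)) =
        X.Φ (fun n => star f * ((w (n + i) * star (w (n + j))) •
          X.sh (p (n + i) - p (n + j)) f)) := by
      rw [← Φ_sh (fun n => -(p (n + j)))]
      congr 1
      ext n
      rw [star_smul, smul_mul_smul_comm, map_smul (X.sh _), map_mul (X.sh _), map_star (X.sh _),
        ← X.sh_add, ← X.sh_add, neg_add_cancel, X.sh_zero, mul_smul_comm, mul_comm (star f),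
        neg_add_eq_sub]
    rw [e, ih (c := (((i : ℕ) : ℤ) - (j : ℕ)) • c) (fun n => ?_) (fun n => ?_) (hp.shift_sub i j) ?_
      (X.B_star hf), norm_zero] at h1
    · have : 0 < ε ^ 2 / 2 := by positivity
      linarith
    · rw [smul_eq_mul]
      refine mul_ne_zero ?_ hc
      rw [sub_ne_zero]
      exact_mod_cast fun h => hij (Fin.ext h)
    · rw [norm_mul, norm_star]
      exact mul_le_one₀ (hw _) (norm_nonneg _) (hw _)
    · rw [add_right_comm, add_right_comm n P, hwP, hwP]

theorem int_mul_sh_mul {q : ℕ} {g : 𝓐}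
    (hg : ∀ h, X.B h → X.int (h * X.sh q g) = X.int (h * g)) (t : ℕ) :
    ∀ {h : 𝓐}, X.B h → X.int (h * X.sh (q * t) g) = X.int (h * g) := by
  induction t with
  | zero =>
    intro h _
    rw [Nat.cast_zero, mul_zero, X.sh_zero]
  | succ t ih =>
    intro h hh
    rw [Nat.cast_succ, mul_add, mul_one, X.sh_add, ← X.int_sh (-(q * t : ℤ)), map_mul (X.sh _),
      ← X.sh_add, neg_add_cancel, X.sh_zero, hg _ (X.B_sh _ hh), ← X.int_sh (q * t : ℤ),
      map_mul (X.sh _), ← X.sh_add, add_neg_cancel, X.sh_zero, ih hh]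

theorem int_mul_monProd {q : ℕ} (n : ℕ) {l : List (ℕ × 𝓐)} (hl : ∀ t ∈ l, 0 < t.1) (hlB : ∀ t ∈ l, X.B t.2)
    (hg : ∀ t ∈ l, ∀ h, X.B h → X.int (h * X.sh q t.2) = X.int (h * t.2)) :
    ∀ {h : 𝓐}, X.B h → X.int (h * X.monProd q l n) = X.int (h * (l.map Prod.snd).prod) := by
  induction l with
  | nil => intro h _; rfl
  | cons t l ih =>
    intro h hh
    obtain ⟨N, hN⟩ : q ∣ (q * n) ^ t.1 := dvd_pow (dvd_mul_right q n) (hl t (by simp)).ne'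
    have e : ((q * n : ℕ) : ℤ) ^ t.1 = (q : ℤ) * (N : ℕ) := by exact_mod_cast hN
    have hl' : ∀ t ∈ l, X.B t.2 := fun t ht => hlB t (by simp [ht])
    have ht := hlB t (by simp)
    rw [monProd_cons, e, mul_left_comm, mul_comm, int_mul_sh_mul (hg t (by simp)) N
      (X.B_mul hh (B_monProd hl' q n)), mul_right_comm,
      ih (fun t ht => hl t (by simp [ht])) hl' (fun t ht => hg t (by simp [ht])) (X.B_mul hh ht),
      List.map_cons, List.prod_cons, mul_assoc]

theorem val_eq_zero_of_ratOrth {q : ℕ} (hq : 0 < q) {D : Finset ℕ} (hD : ∀ d ∈ D, 0 < d)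
    {d₀ : ℕ} {e : 𝓐} (he : X.RatOrth e) {l₂ : List (ℕ × 𝓐)}
    (hg : ∀ t ∈ l₂, ∀ h, X.B h → X.int (h * X.sh q t.2) = X.int (h * t.2)) (l₁ : List (ℕ × 𝓐)) :
    ∀ {z : ℕ → Circle} {f₀ : 𝓐}, ((l₁ ++ (d₀, e) :: l₂).map Prod.fst).Pairwise (· > ·) →
      (∀ t ∈ l₁ ++ (d₀, e) :: l₂, t.1 ∈ D ∧ X.B t.2 ∧ z t.1 = 1) → X.B f₀ →
      X.val q D z f₀ (l₁ ++ (d₀, e) :: l₂) = 0 := by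
  induction l₁ with
  | nil =>
    intro z f₀ hp hl hf₀
    rw [List.nil_append] at hp hl ⊢
    by_contra hne
    obtain ⟨Q, hQ, h1⟩ := rootOrder (X := X) hq hD hp (by
      intro d hd
      obtain ⟨t, ht, rfl⟩ := List.mem_map.1 hd
      exact (hl t ht).1) _ (norm_pos_iff.2 hne)
    have h2 := h1 z f₀ _ rfl hf₀ (fun t ht => (hl t ht).2.1) le_rfl
    have h3 : ∀ d ∈ D, z d ^ Q = 1 := by
      intro d hd
      by_cases hm : d ∈ ((d₀, e) :: l₂).map Prod.fst
      · obtain ⟨t, ht, rfl⟩ := List.mem_map.1 hm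
        rw [(hl t ht).2.2, one_pow]
      · exact h2 d hd hm
    refine hne ?_
    have hB₂ : ∀ t ∈ l₂, X.B t.2 := fun t ht => (hl t (by simp [ht])).2.1
    have heB : X.B e := (hl (d₀, e) (by simp)).2.1
    have hd₀ : 0 < d₀ := hD _ (hl (d₀, e) (by simp)).1
    have e1 : X.val q D z f₀ ((d₀, e) :: l₂) = X.Φ (fun n => (f₀ * (l₂.map Prod.snd).prod) *
        ((phase q D z n : ℂ) • X.sh (((q * n : ℕ) : ℤ) ^ d₀) e)) := by
      rw [val, Φ_apply, Φ_apply]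
      congr 1
      ext n
      rw [monProd_cons, ← mul_assoc, map_smul, int_mul_monProd n
        (fun t ht => hD _ (hl t (by simp [ht])).1) hB₂ hg (X.B_mul hf₀ (X.B_sh _ heB)),
        mul_smul_comm, map_smul, mul_right_comm]
    obtain ⟨k, rfl⟩ : ∃ k, d₀ = k + 1 := ⟨d₀ - 1, by omega⟩
    rw [e1]
    refine Φ_eq_zero_of_ratOrth heB he hQ k (fun n => (Circle.norm_coe _).le) (fun n => ?_)
      (DiffConst.pow_self q (k + 1)) (by positivity) (X.B_mul hf₀ (B_prod_list _ ?_))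
    · congr 1
      exact Finset.prod_congr rfl fun d hd => pow_mul_add_periodic (h3 d hd) q d n
    · intro g hg
      obtain ⟨t, ht, rfl⟩ := List.mem_map.1 hg
      exact hB₂ t ht
  | cons t l₁ ih =>
    intro z f₀ hp hl hf₀
    rw [List.cons_append] at hp hl ⊢
    rw [List.map_cons] at hp
    by_contra hne
    obtain ⟨m, fm⟩ := t
    have hm := hl (m, fm) (by simp)
    have hlt : ∀ d ∈ (l₁ ++ (d₀, e) :: l₂).map Prod.fst, d < m := fun d hd =>
      List.rel_of_pairwise_cons hp hd
    obtain ⟨δ, hδ, h1⟩ := val_reduce (X := X) hq (rootOrder hq hD hp.of_cons (by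
      intro d hd
      obtain ⟨t, ht, rfl⟩ := List.mem_map.1 hd
      exact (hl t (List.mem_cons_of_mem _ ht)).1)) hm.1 (hD m hm.1) hlt (norm_pos_iff.2 hne)
    obtain ⟨c, χ, hE, h2⟩ := h1 z f₀ fm _ rfl hf₀ hm.2.1
      (fun t ht => (hl t (List.mem_cons_of_mem _ ht)).2.1) le_rfl
    rw [ih hp.of_cons ?_ (X.B_mul hf₀ hE.2.1), norm_zero] at h2
    · linarith
    · intro t ht
      have h3 := hl t (List.mem_cons_of_mem _ ht)
      refine ⟨h3.1, h3.2.1, ?_⟩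
      rw [Function.update_of_ne, h3.2.2]
      exact (hlt _ (List.mem_map_of_mem ht)).ne

theorem val_add (q : ℕ) (D : Finset ℕ) (z : ℕ → Circle) (f₀ : 𝓐) (l₁ l₂ : List (ℕ × 𝓐)) (d : ℕ)
    (f g : 𝓐) : X.val q D z f₀ (l₁ ++ (d, f + g) :: l₂) =
      X.val q D z f₀ (l₁ ++ (d, f) :: l₂) + X.val q D z f₀ (l₁ ++ (d, g) :: l₂) := by
  rw [val, val, val, ← map_add]
  congr 1
  ext n
  simp only [monProd_append, monProd_cons, Pi.add_apply]
  rw [map_add (X.sh _), ← smul_add]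
  congr 1
  ring

theorem val_le_of_weak {q : ℕ} {D : Finset ℕ} {z : ℕ → Circle} {f₀ : 𝓐} {l₁ l₂ : List (ℕ × 𝓐)}
    {d : ℕ} {r : 𝓐} {η : ℝ} (hr : ∀ b, X.B b → ‖X.int (b * r)‖ ≤ η) (hf₀ : X.B f₀)
    (h₁ : ∀ t ∈ l₁, X.B t.2) (h₂ : ∀ t ∈ l₂, X.B t.2) :
    ‖X.val q D z f₀ (l₁ ++ (d, r) :: l₂)‖ ≤ η := by
  refine X.m_le fun n => ?_
  change ‖X.int _‖ ≤ _
  have e : f₀ * X.monProd q (l₁ ++ (d, r) :: l₂) n =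
      (f₀ * (X.monProd q l₁ n * X.monProd q l₂ n)) * X.sh (((q * n : ℕ) : ℤ) ^ d) r := by
    rw [monProd_append, monProd_cons]
    ring
  rw [map_smul, norm_smul, Circle.norm_coe, one_mul, e, ← X.int_sh (-(((q * n : ℕ) : ℤ) ^ d)),
    map_mul (X.sh _), ← X.sh_add, neg_add_cancel, X.sh_zero]
  exact hr _ (X.B_sh _ (X.B_mul hf₀ (X.B_mul (B_monProd h₁ q n) (B_monProd h₂ q n))))

/-- Replacing all functions by their conditional expectation on a rational factor. -/
theorem val_sub_le {q : ℕ} (hq : 0 < q) {D : Finset ℕ} (hD : ∀ d ∈ D, 0 < d) {f₀ f g e r : 𝓐}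
    (hf₀ : X.B f₀) (hf : X.B f) (hg : X.B g) (heB : X.B e) (he : X.RatOrth e)
    (hgq : ∀ h, X.B h → X.int (h * X.sh q g) = X.int (h * g)) {η : ℝ}
    (hr : ∀ b, X.B b → ‖X.int (b * r)‖ ≤ η) (hfg : f = g + (e + r)) (ds₂ : List ℕ) :
    ∀ ds₁ : List ℕ, (ds₁ ++ ds₂).Pairwise (· > ·) → (∀ d ∈ ds₁ ++ ds₂, d ∈ D) →
      ‖X.val q D 1 f₀ ((ds₁ ++ ds₂).map fun d => (d, f)) -
        X.val q D 1 f₀ (ds₁.map (fun d => (d, f)) ++ ds₂.map fun d => (d, g))‖ ≤ ds₂.length * η := by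
  induction ds₂ with
  | nil => intro ds₁ _ _; simp
  | cons d ds₂ ih =>
    intro ds₁ hp hd
    have e1 : ds₁ ++ d :: ds₂ = (ds₁ ++ [d]) ++ ds₂ := by simp
    have h1 := ih (ds₁ ++ [d]) (e1 ▸ hp) (e1 ▸ hd)
    rw [← e1] at h1
    have h2 : X.val q D 1 f₀ ((ds₁ ++ [d]).map (fun d => (d, f)) ++ ds₂.map fun d => (d, g)) =
        X.val q D 1 f₀ (ds₁.map (fun d => (d, f)) ++ (d :: ds₂).map fun d => (d, g)) +
        X.val q D 1 f₀ (ds₁.map (fun d => (d, f)) ++ (d, r) :: ds₂.map fun d => (d, g)) := by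
      have h3 : X.val q D 1 f₀ (ds₁.map (fun d => (d, f)) ++ (d, e) :: ds₂.map fun d => (d, g)) = 0 := by
        refine val_eq_zero_of_ratOrth hq hD he ?_ _ ?_ ?_ hf₀
        · intro t ht
          obtain ⟨d', _, rfl⟩ := List.mem_map.1 ht
          exact hgq
        · simpa [Function.comp_def] using hp
        · intro t ht
          simp only [List.mem_append, List.mem_cons, List.mem_map] at ht
          rcases ht with ⟨d', h, rfl⟩ | rfl | ⟨d', h, rfl⟩
          · exact ⟨hd _ (by simp [h]), hf, rfl⟩
          · exact ⟨hd _ (by simp), heB, rfl⟩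
          · exact ⟨hd _ (by simp [h]), hg, rfl⟩
      have h4 := val_add (X := X) q D 1 f₀ (ds₁.map (fun d => (d, f)))
        (ds₂.map fun d => (d, g)) d g (e + r)
      rw [val_add q D 1 f₀ _ _ d e r, h3, zero_add, ← hfg] at h4
      simpa using h4
    have h5 : ‖X.val q D 1 f₀ (ds₁.map (fun d => (d, f)) ++ (d, r) :: ds₂.map fun d => (d, g))‖ ≤ η := by
      refine val_le_of_weak hr hf₀ ?_ ?_
      · intro t ht
        obtain ⟨d', _, rfl⟩ := List.mem_map.1 ht
        exact hf
      · intro t ht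
        obtain ⟨d', _, rfl⟩ := List.mem_map.1 ht
        exact hg
    rw [h2] at h1
    rw [← sub_sub] at h1
    have := norm_le_norm_sub_add (X.val q D 1 f₀ ((ds₁ ++ d :: ds₂).map fun d => (d, f)) -
      X.val q D 1 f₀ (ds₁.map (fun d => (d, f)) ++ (d :: ds₂).map fun d => (d, g)))
      (X.val q D 1 f₀ (ds₁.map (fun d => (d, f)) ++ (d, r) :: ds₂.map fun d => (d, g)))
    rw [List.length_cons]
    push_cast
    linarith

theorem val_one_of_invariant {q : ℕ} {D : Finset ℕ} {f₀ g : 𝓐} (hf₀ : X.B f₀) (hg : X.B g)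
    (hgq : ∀ h, X.B h → X.int (h * X.sh q g) = X.int (h * g)) {ds : List ℕ} (hds : ∀ d ∈ ds, 0 < d) :
    X.val q D 1 f₀ (ds.map fun d => (d, g)) = X.int (f₀ * g ^ ds.length) := by
  rw [val, Φ_apply]
  have e : ∀ n, X.int ((phase q D 1 n : ℂ) • (f₀ * X.monProd q (ds.map fun d => (d, g)) n)) =
      X.int (f₀ * g ^ ds.length) := by
    intro n
    have h1 : phase q D 1 n = 1 := by simp [phase]
    rw [h1, Circle.coe_one, one_smul, int_mul_monProd n ?_ ?_ ?_ hf₀]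
    · simp [Function.comp_def]
    all_goals
      intro t ht
      obtain ⟨d', h, rfl⟩ := List.mem_map.1 ht
    · exact hds _ h
    · exact hg
    · exact hgq
  simp only [e]
  rw [← Φ_apply (fun _ => f₀ * g ^ ds.length), Φ_const]

end ErgSys

section Mean

open Topology

/-- Cesàro averages. -/
noncomputable def cesaro (u : ℕ → ℂ) (N : ℕ) : ℂ := (N : ℂ)⁻¹ * ∑ n ∈ Finset.range N, u n

theorem cesaro_add (u v : ℕ → ℂ) (N : ℕ) : cesaro (u + v) N = cesaro u N + cesaro v N := by
  simp [cesaro, Finset.sum_add_distrib, mul_add]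

theorem cesaro_smul (c : ℂ) (u : ℕ → ℂ) (N : ℕ) : cesaro (c • u) N = c * cesaro u N := by
  simp only [cesaro, Pi.smul_apply, smul_eq_mul, ← Finset.mul_sum]
  ring

theorem norm_cesaro_le {u : ℕ → ℂ} {c : ℝ} (hu : ∀ n, ‖u n‖ ≤ c) (N : ℕ) : ‖cesaro u N‖ ≤ c := by
  have hc : 0 ≤ c := (norm_nonneg _).trans (hu 0)
  rcases Nat.eq_zero_or_pos N with rfl | hN
  · simpa [cesaro] using hc
  rw [cesaro, norm_mul, norm_inv, Complex.norm_natCast, inv_mul_le_iff₀ (by exact_mod_cast hN)]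
  refine (norm_sum_le _ _).trans ((Finset.sum_le_card_nsmul _ _ c fun n _ => hu n).trans ?_)
  simp

/-- The bounded sequences. -/
def bddSeq : Submodule ℂ (ℕ → ℂ) where
  carrier := {u | ∃ c : ℝ, ∀ n, ‖u n‖ ≤ c}
  zero_mem' := ⟨0, by simp⟩
  add_mem' := by
    rintro u v ⟨c, hc⟩ ⟨d, hd⟩
    exact ⟨c + d, fun n => (norm_add_le _ _).trans (add_le_add (hc n) (hd n))⟩
  smul_mem' := by
    rintro a u ⟨c, hc⟩
    refine ⟨‖a‖ * c, fun n => ?_⟩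
    rw [Pi.smul_apply, norm_smul]
    exact mul_le_mul_of_nonneg_left (hc n) (norm_nonneg a)

theorem exists_mean : ∃ m : (ℕ → ℂ) →ₗ[ℂ] ℂ, ∀ u : ℕ → ℂ, ∀ c : ℝ, (∀ n, ‖u n‖ ≤ c) →
    Tendsto (cesaro u) (hyperfilter ℕ : Ultrafilter ℕ) (𝓝 (m u)) := by
  have h1 : ∀ u : bddSeq, ∃ a, Tendsto (cesaro u) (hyperfilter ℕ : Ultrafilter ℕ) (𝓝 a) := by
    rintro ⟨u, c, hc⟩
    obtain ⟨a, _, ha⟩ := (isCompact_closedBall (0 : ℂ) c).ultrafilter_le_nhds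
      ((hyperfilter ℕ : Ultrafilter ℕ).map (cesaro u)) (by
        rw [le_principal_iff, Ultrafilter.mem_coe, Ultrafilter.mem_map]
        refine univ_mem' fun N => ?_
        simpa using norm_cesaro_le hc N)
    exact ⟨a, ha⟩
  choose L hL using h1
  have hadd : ∀ u v, L (u + v) = L u + L v := by
    intro u v
    refine tendsto_nhds_unique (hL (u + v)) ?_
    have := (hL u).add (hL v)
    refine this.congr fun N => ?_
    exact (cesaro_add _ _ N).symm
  have hsmul : ∀ (c : ℂ) u, L (c • u) = c • L u := by
    intro c u
    refine tendsto_nhds_unique (hL (c • u)) ?_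
    have := (hL u).const_mul c
    refine this.congr fun N => ?_
    exact (cesaro_smul _ _ N).symm
  obtain ⟨m, hm⟩ := LinearMap.exists_extend (p := bddSeq)
    { toFun := L, map_add' := hadd, map_smul' := hsmul }
  refine ⟨m, fun u c hc => ?_⟩
  have := hL ⟨u, c, hc⟩
  have e : m u = L ⟨u, c, hc⟩ := LinearMap.congr_fun hm ⟨u, c, hc⟩
  rwa [e]

/-- An invariant mean on sequences. -/
noncomputable def mean : (ℕ → ℂ) →ₗ[ℂ] ℂ := exists_mean.choose

theorem tendsto_mean {u : ℕ → ℂ} {c : ℝ} (hu : ∀ n, ‖u n‖ ≤ c) :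
    Tendsto (cesaro u) (hyperfilter ℕ : Ultrafilter ℕ) (𝓝 (mean u)) :=
  exists_mean.choose_spec u c hu

theorem hyperfilter_le_atTop : ((hyperfilter ℕ : Ultrafilter ℕ) : Filter ℕ) ≤ atTop :=
  Nat.hyperfilter_le_atTop

theorem mean_one : mean 1 = 1 := by
  refine tendsto_nhds_unique (tendsto_mean (c := 1) (by simp)) ?_
  refine Tendsto.mono_left ?_ hyperfilter_le_atTop
  refine tendsto_const_nhds.congr' ?_
  filter_upwards [eventually_gt_atTop 0] with N hN
  have : (N : ℂ) ≠ 0 := by exact_mod_cast hN.ne'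
  simp [cesaro, this]

theorem mean_le {u : ℕ → ℂ} {c : ℝ} (hu : ∀ n, ‖u n‖ ≤ c) : ‖mean u‖ ≤ c :=
  le_of_tendsto (tendsto_mean hu).norm (Eventually.of_forall fun N => norm_cesaro_le hu N)

theorem cesaro_re (u : ℕ → ℂ) (N : ℕ) :
    (cesaro u N).re = (N : ℝ)⁻¹ * ∑ n ∈ Finset.range N, (u n).re := by
  rw [cesaro, ← Complex.ofReal_natCast, ← Complex.ofReal_inv, Complex.re_ofReal_mul, Complex.re_sum]

theorem mean_mono {u v : ℕ → ℂ} {c d : ℝ} (hu : ∀ n, ‖u n‖ ≤ c) (hv : ∀ n, ‖v n‖ ≤ d)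
    (h : ∀ n, (u n).re ≤ (v n).re) : (mean u).re ≤ (mean v).re := by
  refine le_of_tendsto_of_tendsto ((Complex.continuous_re.tendsto _).comp (tendsto_mean hu))
    ((Complex.continuous_re.tendsto _).comp (tendsto_mean hv)) (Eventually.of_forall fun N => ?_)
  simp only [Function.comp_apply, cesaro_re]
  exact mul_le_mul_of_nonneg_left (Finset.sum_le_sum fun n _ => h n) (by positivity)

theorem mean_shift {u : ℕ → ℂ} {c : ℝ} (hu : ∀ n, ‖u n‖ ≤ c) : mean (fun n => u (n + 1)) = mean u := by
  rw [← sub_eq_zero]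
  refine tendsto_nhds_unique ((tendsto_mean fun n => hu (n + 1)).sub (tendsto_mean hu)) ?_
  refine Tendsto.mono_left ?_ hyperfilter_le_atTop
  refine squeeze_zero_norm (a := fun N : ℕ => 2 * c * (N : ℝ)⁻¹) (fun N => ?_) ?_
  · rw [cesaro, cesaro, ← mul_sub, ← Finset.sum_sub_distrib, Finset.sum_range_sub, norm_mul,
      norm_inv, Complex.norm_natCast, mul_comm]
    gcongr
    refine (norm_sub_le _ _).trans ?_
    linarith [hu N, hu 0]
  · simpa using tendsto_natCast_atTop_atTop.inv_tendsto_atTop.const_mul (2 * c)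

theorem mean_cs {u : ℕ → ℂ} (hu : ∀ n, ‖u n‖ ≤ 1) :
    ‖mean u‖ ^ 2 ≤ (mean (fun n => ((‖u n‖ ^ 2 : ℝ) : ℂ))).re := by
  have h1 : ∀ n, ‖((‖u n‖ ^ 2 : ℝ) : ℂ)‖ ≤ 1 := by
    intro n
    rw [Complex.norm_real, Real.norm_of_nonneg (by positivity)]
    exact pow_le_one₀ (norm_nonneg _) (hu n)
  refine le_of_tendsto_of_tendsto ((tendsto_mean hu).norm.pow 2)
    ((Complex.continuous_re.tendsto _).comp (tendsto_mean h1)) (Eventually.of_forall fun N => ?_)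
  simp only [Function.comp_apply, cesaro_re, Complex.ofReal_re]
  rcases Nat.eq_zero_or_pos N with rfl | hN
  · simp [cesaro]
  have hN' : (0 : ℝ) < N := by exact_mod_cast hN
  rw [cesaro, norm_mul, norm_inv, Complex.norm_natCast, mul_pow]
  have h2 := sq_sum_le_card_mul_sum_sq (s := Finset.range N) (f := fun n => ‖u n‖)
  rw [Finset.card_range] at h2
  have h3 := pow_le_pow_left₀ (norm_nonneg _) (norm_sum_le (Finset.range N) u) 2
  calc (N : ℝ)⁻¹ ^ 2 * ‖∑ n ∈ Finset.range N, u n‖ ^ 2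
      ≤ (N : ℝ)⁻¹ ^ 2 * (N * ∑ n ∈ Finset.range N, ‖u n‖ ^ 2) := by
        gcongr
        exact h3.trans h2
    _ = _ := by field_simp

end Mean

section Algebra

/-- The algebra of bounded measurable functions. -/
def BM (X : Type*) [MeasurableSpace X] : StarSubalgebra ℂ (X → ℂ) where
  carrier := {f | Measurable f ∧ ∃ c : ℝ, ∀ x, ‖f x‖ ≤ c}
  mul_mem' := by
    rintro f g ⟨hf, c, hc⟩ ⟨hg, d, hd⟩
    refine ⟨hf.mul hg, c * d, fun x => ?_⟩
    rw [Pi.mul_apply, norm_mul]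
    exact mul_le_mul (hc x) (hd x) (norm_nonneg _) ((norm_nonneg _).trans (hc x))
  add_mem' := by
    rintro f g ⟨hf, c, hc⟩ ⟨hg, d, hd⟩
    exact ⟨hf.add hg, c + d, fun x => (norm_add_le _ _).trans (add_le_add (hc x) (hd x))⟩
  algebraMap_mem' := by
    intro r
    exact ⟨measurable_const, ‖r‖, fun x => le_rfl⟩
  star_mem' := by
    rintro f ⟨hf, c, hc⟩
    refine ⟨Complex.continuous_conj.measurable.comp hf, c, fun x => ?_⟩
    rw [Pi.star_apply, norm_star]
    exact hc x

variable {X : Type*} [MeasurableSpace X]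

namespace BM

instance : CoeFun (BM X) (fun _ => X → ℂ) := ⟨fun f => f.1⟩

theorem measurable (f : BM X) : Measurable f := f.2.1

@[simp] theorem mul_apply (f g : BM X) (x : X) : (f * g) x = f x * g x := rfl
@[simp] theorem add_apply (f g : BM X) (x : X) : (f + g) x = f x + g x := rfl
@[simp] theorem smul_apply (c : ℂ) (f : BM X) (x : X) : (c • f) x = c * f x := rfl
@[simp] theorem star_apply (f : BM X) (x : X) : (star f) x = star (f x) := rfl

theorem sum_apply {ι : Type*} (s : Finset ι) (f : ι → BM X) (x : X) :
    (∑ i ∈ s, f i) x = ∑ i ∈ s, f i x := by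
  classical
  induction s using Finset.induction_on with
  | empty => rfl
  | insert a s ha ih => rw [Finset.sum_insert ha, Finset.sum_insert ha, add_apply, ih]

/-- Composition with a measurable map. -/
def comp (φ : X → X) (hφ : Measurable φ) : BM X →⋆ₐ[ℂ] BM X where
  toFun f := ⟨f ∘ φ, f.2.1.comp hφ, f.2.2.imp fun _ h x => h (φ x)⟩
  map_one' := rfl
  map_mul' _ _ := rfl
  map_zero' := rfl
  map_add' _ _ := rfl
  commutes' _ := rfl
  map_star' _ := rfl

variable (μ : Measure X) [IsProbabilityMeasure μ]

theorem memLp (f : BM X) (p : ENNReal) : MemLp f p μ := by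
  obtain ⟨c, hc⟩ := f.2.2
  exact MemLp.of_bound (BM.measurable f).aestronglyMeasurable c (Eventually.of_forall hc)

theorem integrable (f : BM X) : Integrable f μ := memLp_one_iff_integrable.1 (BM.memLp μ f 1)

/-- The integral as a linear functional. -/
noncomputable def int : BM X →ₗ[ℂ] ℂ where
  toFun f := ∫ x, f x ∂μ
  map_add' f g := integral_add (BM.integrable μ f) (BM.integrable μ g)
  map_smul' c _ := integral_const_mul c _

theorem int_apply (f : BM X) : int μ f = ∫ x, f x ∂μ := rfl

/-- The class in `L²`. -/
noncomputable def toL2 : BM X →ₗ[ℂ] Lp ℂ 2 μ where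
  toFun f := (BM.memLp μ f 2).toLp f
  map_add' f g := MemLp.toLp_add (BM.memLp μ f 2) (BM.memLp μ g 2)
  map_smul' c f := MemLp.toLp_const_smul c (BM.memLp μ f 2)

theorem coeFn_toL2 (f : BM X) : toL2 μ f =ᵐ[μ] f := MemLp.coeFn_toLp (BM.memLp μ f 2)

theorem inner_toL2 (f g : BM X) : inner ℂ (toL2 μ f) (toL2 μ g) = int μ (star f * g) := by
  rw [L2.inner_def, int_apply]
  refine integral_congr_ae ?_
  filter_upwards [coeFn_toL2 μ f, coeFn_toL2 μ g] with x hf hg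
  rw [hf, hg, RCLike.inner_apply, mul_apply, star_apply, mul_comm]
  rfl

theorem norm_sq_toL2 (f : BM X) : ‖toL2 μ f‖ ^ 2 = (int μ (f * star f)).re := by
  rw [← inner_self_eq_norm_sq (𝕜 := ℂ), inner_toL2, mul_comm]
  rfl

theorem int_star (f : BM X) : int μ (star f) = star (int μ f) := by
  rw [int_apply, int_apply]
  exact integral_conj

theorem int_le {f : BM X} (hf : ∀ x, ‖f x‖ ≤ 1) : ‖int μ f‖ ≤ 1 := by
  have := norm_integral_le_of_norm_le_const (μ := μ) (Eventually.of_forall hf)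
  simpa [int_apply] using this

theorem norm_toL2_le {f : BM X} (hf : ∀ x, ‖f x‖ ≤ 1) : ‖toL2 μ f‖ ≤ 1 := by
  have h1 : ‖toL2 μ f‖ ^ 2 ≤ 1 := by
    rw [norm_sq_toL2]
    refine (Complex.re_le_norm _).trans (int_le μ fun x => ?_)
    rw [mul_apply, star_apply, norm_mul, norm_star]
    exact mul_le_one₀ (hf x) (norm_nonneg _) (hf x)
  exact (sq_le_one_iff₀ (norm_nonneg _)).1 h1

theorem int_cs {b g : BM X} (hb : ∀ x, ‖b x‖ ≤ 1) :
    ‖int μ (b * g)‖ ^ 2 ≤ (int μ (g * star g)).re := by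
  have h1 : int μ (b * g) = inner ℂ (toL2 μ (star b)) (toL2 μ g) := by rw [inner_toL2, star_star]
  rw [h1, ← norm_sq_toL2]
  refine pow_le_pow_left₀ (norm_nonneg _) ((norm_inner_le_norm _ _).trans ?_) 2
  refine mul_le_of_le_one_left (norm_nonneg _) (norm_toL2_le μ fun x => ?_)
  rw [star_apply, norm_star]
  exact hb x

/-- Weak equality implies almost everywhere equality. -/
theorem ae_eq_of_forall_int {f g : BM X} (h : ∀ φ, int μ (φ * f) = int μ (φ * g)) : f =ᵐ[μ] g := by
  have h1 : toL2 μ f = toL2 μ g := by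
    rw [← sub_eq_zero, ← map_sub, ← norm_eq_zero, ← pow_eq_zero_iff two_ne_zero, norm_sq_toL2,
      mul_comm, mul_sub, map_sub, h, sub_self, Complex.zero_re]
  filter_upwards [coeFn_toL2 μ f, coeFn_toL2 μ g] with x hf hg
  rw [← hf, ← hg, h1]

theorem int_congr {f g : BM X} (h : f =ᵐ[μ] g) (φ : BM X) : int μ (φ * f) = int μ (φ * g) := by
  refine integral_congr_ae ?_
  filter_upwards [h] with x hx
  rw [mul_apply, mul_apply, hx]

end BM

end Algebra

section Ergodic

open Topology

variable {X : Type*} [MeasurableSpace X]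

theorem MeasureTheory.MeasurePreserving.zpow {μ : Measure X} {T : X ≃ᵐ X}
    (hT : MeasurePreserving T μ μ) (a : ℤ) : MeasurePreserving (⇑(T.toEquiv ^ a)) μ μ := by
  obtain ⟨n, rfl | rfl⟩ := a.eq_nat_or_neg
  · rw [zpow_natCast, Equiv.Perm.coe_pow]
    exact hT.iterate n
  · rw [zpow_neg, zpow_natCast, ← inv_pow, Equiv.Perm.coe_pow]
    exact (MeasurePreserving.symm T hT).iterate n

theorem measurable_zpow (T : X ≃ᵐ X) (a : ℤ) : Measurable (⇑(T.toEquiv ^ a)) := by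
  obtain ⟨n, rfl | rfl⟩ := a.eq_nat_or_neg
  · rw [zpow_natCast, Equiv.Perm.coe_pow]
    exact T.measurable.iterate n
  · rw [zpow_neg, zpow_natCast, ← inv_pow, Equiv.Perm.coe_pow]
    exact T.symm.measurable.iterate n

namespace BM

/-- The Koopman action. -/
def shift (T : X ≃ᵐ X) (a : ℤ) : BM X →⋆ₐ[ℂ] BM X := comp _ (measurable_zpow T a)

theorem shift_apply (T : X ≃ᵐ X) (a : ℤ) (f : BM X) (x : X) :
    shift T a f x = f ((T.toEquiv ^ a) x) := rfl

variable (μ : Measure X) [IsProbabilityMeasure μ] (T : X ≃ᵐ X)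

theorem shift_add (a b : ℤ) (f : BM X) : shift T (a + b) f = shift T a (shift T b f) := by
  ext x
  change f ((T.toEquiv ^ (a + b)) x) = f ((T.toEquiv ^ b) ((T.toEquiv ^ a) x))
  rw [add_comm, zpow_add, Equiv.Perm.mul_apply]

theorem int_shift (hT : MeasurePreserving T μ μ) (a : ℤ) (f : BM X) :
    int μ (shift T a f) = int μ f := by
  have h := hT.zpow a
  rw [int_apply, int_apply]
  have := integral_map (μ := μ) h.measurable.aemeasurable (f := (f : X → ℂ))
    (BM.measurable f).aestronglyMeasurable
  rw [h.map_eq] at this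
  exact this.symm

theorem exists_dual {u : ℕ → BM X} (hu : ∀ n x, ‖u n x‖ ≤ 1) :
    ∃ F : BM X, (∀ x, ‖F x‖ ≤ 1) ∧ ∀ g, int μ (g * F) = mean (fun n => int μ (g * u n)) := by
  have hin : ∀ (g : Lp ℂ 2 μ) n, ‖inner ℂ (toL2 μ (star (u n))) g‖ ≤ ‖g‖ := by
    intro g n
    refine (norm_inner_le_norm _ _).trans (mul_le_of_le_one_left (norm_nonneg _) ?_)
    exact norm_toL2_le μ fun x => by rw [star_apply, norm_star]; exact hu n x
  let Λ₀ : Lp ℂ 2 μ →ₗ[ℂ] ℂ :=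
    { toFun := fun g => mean fun n => inner ℂ (toL2 μ (star (u n))) g
      map_add' := fun g h => by
        rw [← map_add]
        congr 1
        ext n
        exact inner_add_right _ _ _
      map_smul' := fun c g => by
        rw [← map_smul]
        congr 1
        ext n
        exact inner_smul_right _ _ _ }
  let Λ : StrongDual ℂ (Lp ℂ 2 μ) := Λ₀.mkContinuous 1 fun g => by
    rw [one_mul]
    exact mean_le (hin g)
  set F₂ : Lp ℂ 2 μ := (InnerProductSpace.toDual ℂ (Lp ℂ 2 μ)).symm Λ with hF₂
  have hΛ : ∀ g : BM X, inner ℂ F₂ (toL2 μ g) = mean fun n => int μ (g * u n) := by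
    intro g
    rw [hF₂, InnerProductSpace.toDual_symm_apply]
    change mean (fun n => inner ℂ (toL2 μ (star (u n))) (toL2 μ g)) = _
    congr 1
    ext n
    rw [inner_toL2, star_star, mul_comm]
  have hinner : ∀ g : BM X, inner ℂ F₂ (toL2 μ g) = ∫ x, g x * star (F₂ x) ∂μ := by
    intro g
    rw [L2.inner_def]
    refine integral_congr_ae ?_
    filter_upwards [coeFn_toL2 μ g] with x hx
    rw [hx, RCLike.inner_apply]
    rfl
  have hmeas : Measurable F₂ := (Lp.stronglyMeasurable F₂).measurable
  have hF₂i : Integrable F₂ μ := (Lp.memLp F₂).integrable (by norm_num)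
  have hle : (fun x => ‖F₂ x‖) ≤ᵐ[μ] fun _ => (1 : ℝ) := by
    refine ae_le_of_forall_setIntegral_le hF₂i.norm (integrable_const _) fun s hs _ => ?_
    let φ : BM X := ⟨s.indicator fun x => F₂ x / (‖F₂ x‖ : ℂ),
      (hmeas.div (Complex.measurable_ofReal.comp hmeas.norm)).indicator hs, 1, fun x => by
        refine (norm_indicator_le_norm_self _ _).trans ?_
        rw [norm_div, Complex.norm_real, norm_norm]
        exact div_self_le_one _⟩
    have h1 : inner ℂ F₂ (toL2 μ φ) = ((∫ x in s, ‖F₂ x‖ ∂μ : ℝ) : ℂ) := by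
      rw [hinner, ← integral_complex_ofReal, ← integral_indicator hs]
      refine integral_congr_ae (Eventually.of_forall fun x => ?_)
      change s.indicator (fun x => F₂ x / (‖F₂ x‖ : ℂ)) x * star (F₂ x) = _
      by_cases hx : x ∈ s
      · rw [Set.indicator_of_mem hx, Set.indicator_of_mem hx, div_mul_eq_mul_div]
        have : F₂ x * star (F₂ x) = (‖F₂ x‖ : ℂ) * ‖F₂ x‖ := by
          have := Complex.mul_conj' (F₂ x)
          rw [← sq]
          exact this
        rw [this, mul_self_div_self]
      · rw [Set.indicator_of_notMem hx, Set.indicator_of_notMem hx, zero_mul]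
    have h2 : ‖inner ℂ F₂ (toL2 μ φ)‖ ≤ ∫ x in s, (1 : ℝ) ∂μ := by
      rw [hΛ]
      refine mean_le fun n => ?_
      rw [← integral_indicator hs]
      refine norm_integral_le_of_norm_le ((integrable_const _).indicator hs)
        (Eventually.of_forall fun x => ?_)
      change ‖s.indicator (fun x => F₂ x / (‖F₂ x‖ : ℂ)) x * u n x‖ ≤ _
      by_cases hx : x ∈ s
      · rw [Set.indicator_of_mem hx, Set.indicator_of_mem hx, norm_mul, norm_div,
          Complex.norm_real, norm_norm]
        exact mul_le_one₀ (div_self_le_one _) (norm_nonneg _) (hu n x)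
      · rw [Set.indicator_of_notMem hx, Set.indicator_of_notMem hx, zero_mul, norm_zero]
    rw [h1, Complex.norm_real] at h2
    exact (le_abs_self _).trans h2
  classical
  have hbd : ∀ x, ‖if ‖F₂ x‖ ≤ 1 then star (F₂ x) else 0‖ ≤ 1 := by
    intro x
    split_ifs with h
    · rwa [norm_star]
    · simp
  refine ⟨⟨fun x => if ‖F₂ x‖ ≤ 1 then star (F₂ x) else 0,
    Measurable.ite (measurableSet_le hmeas.norm measurable_const)
      (Complex.continuous_conj.measurable.comp hmeas) measurable_const, 1, hbd⟩, hbd, fun g => ?_⟩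
  · rw [← hΛ, hinner]
    refine integral_congr_ae ?_
    filter_upwards [hle] with x hx
    change g x * (if ‖F₂ x‖ ≤ 1 then star (F₂ x) else 0) = _
    rw [if_pos hx]

variable {μ T}

theorem eig_unique (hT : Ergodic T μ) {l : ℂ} {χ ρ : BM X} (hl : ‖l‖ = 1)
    (h1 : ∀ f, int μ (f * shift T 1 χ) = l * int μ (f * χ))
    (h2 : ∀ f, int μ (f * (χ * star χ)) = int μ f)
    (h3 : ∀ f, int μ (f * shift T 1 ρ) = l * int μ (f * ρ))
    (h4 : ∀ f, int μ (f * (ρ * star ρ)) = int μ f) (f : BM X) :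
    ‖int μ (f * χ)‖ = ‖int μ (f * ρ)‖ := by
  have key : ∀ ψ : BM X, (∀ f, int μ (f * shift T 1 ψ) = l * int μ (f * ψ)) →
      (∀ f, int μ (f * (ψ * star ψ)) = int μ f) →
      (∀ᵐ x ∂μ, ψ (T x) = l * ψ x) ∧ ∀ᵐ x ∂μ, ψ x * star (ψ x) = 1 := by
    intro ψ ha hb
    have e1 : shift T 1 ψ =ᵐ[μ] (l • ψ : BM X) := ae_eq_of_forall_int μ fun φ => by
      rw [ha, mul_smul_comm, map_smul, smul_eq_mul]
    have e2 : (ψ * star ψ : BM X) =ᵐ[μ] (1 : BM X) := ae_eq_of_forall_int μ fun φ => by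
      rw [hb, mul_one]
    refine ⟨?_, ?_⟩
    · filter_upwards [e1] with x hx
      rw [shift_apply, zpow_one] at hx
      exact hx
    · filter_upwards [e2] with x hx
      exact hx
  obtain ⟨c1, c2⟩ := key χ h1 h2
  obtain ⟨r1, r2⟩ := key ρ h3 h4
  have hll : l * star l = 1 := by
    have := Complex.mul_conj' l
    rw [hl] at this
    simpa using this
  obtain ⟨c, hc⟩ := hT.ae_eq_const_of_ae_eq_comp_ae (g := ((χ * star ρ : BM X) : X → ℂ))
    (BM.measurable _).aestronglyMeasurable (by
      filter_upwards [c1, r1] with x hx hy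
      change χ (T x) * star (ρ (T x)) = χ x * star (ρ x)
      rw [hx, hy, star_mul']
      linear_combination (χ x * star (ρ x)) * hll)
  have hc1 : ‖c‖ = 1 := by
    have : ∀ᵐ x ∂μ, ‖c‖ = 1 := by
      filter_upwards [hc, c2, r2] with x hx hy hz
      rw [← (show χ x * star (ρ x) = c from hx), norm_mul, norm_star]
      have e : ∀ z : ℂ, z * star z = 1 → ‖z‖ = 1 := by
        intro z hz
        have := congrArg norm hz
        rw [norm_mul, norm_star, norm_one, ← sq] at this
        exact (pow_eq_one_iff_of_nonneg (norm_nonneg _) two_ne_zero).1 this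
      rw [e _ hy, e _ hz, mul_one]
    exact this.exists.choose_spec
  have hχ : χ =ᵐ[μ] (c • ρ : BM X) := by
    filter_upwards [hc, r2] with x hx hz
    have hx' : χ x * star (ρ x) = c := hx
    rw [smul_apply]
    linear_combination (ρ x) * hx' - χ x * hz
  rw [int_congr μ hχ, mul_smul_comm, map_smul, smul_eq_mul, norm_mul, hc1, one_mul]

theorem eig_extract (hT : Ergodic T μ) {l : ℂ} {g : BM X} {δ : ℝ} (hl : ‖l‖ = 1) (hδ : 0 < δ)
    (h : ∀ j : ℕ, δ ^ 2 ≤ (int μ ((∑ k ∈ Finset.range j.factorial,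
        ((j.factorial : ℂ)⁻¹ * (star l) ^ k) • shift T k g) *
      star (∑ k ∈ Finset.range j.factorial,
        ((j.factorial : ℂ)⁻¹ * (star l) ^ k) • shift T k g))).re) :
    ∃ χ : BM X, (∀ x, ‖χ x‖ ≤ 1) ∧ (∀ f, int μ (f * shift T 1 χ) = l * int μ (f * χ)) ∧
      (∀ f, int μ (f * (χ * star χ)) = int μ f) ∧ δ ≤ ‖int μ (g * star χ)‖ := by
  have hTp := hT.toMeasurePreserving
  let U : Lp ℂ 2 μ →L[ℂ] Lp ℂ 2 μ :=
    star l • (Lp.compMeasurePreservingₗᵢ ℂ T hTp).toContinuousLinearMap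
  have hU : ∀ v, U v = star l • Lp.compMeasurePreserving T hTp v := fun _ => rfl
  have hU1 : ‖U‖ ≤ 1 := by
    refine U.opNorm_le_bound zero_le_one fun v => ?_
    rw [hU, norm_smul, norm_star, hl, one_mul, one_mul, Lp.norm_compMeasurePreserving]
  have hiter : ∀ k : ℕ, U^[k] (toL2 μ g) = toL2 μ ((star l) ^ k • shift T k g) := by
    intro k
    induction k with
    | zero =>
      rw [Function.iterate_zero_apply, pow_zero, one_smul]
      rfl
    | succ k ih =>
      rw [Function.iterate_succ_apply', ih, hU]
      have e : shift T ((k + 1 : ℕ) : ℤ) g = shift T 1 (shift T k g) := by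
        rw [← shift_add, Nat.cast_succ, add_comm]
      rw [e, pow_succ', mul_smul, map_smul (toL2 μ) (star l)]
      rfl
  have hj : ∀ j : ℕ, birkhoffAverage ℂ U _root_.id j.factorial (toL2 μ g) =
      toL2 μ (∑ k ∈ Finset.range j.factorial,
        ((j.factorial : ℂ)⁻¹ * (star l) ^ k) • shift T k g) := by
    intro j
    rw [birkhoffAverage, birkhoffSum, Finset.smul_sum, map_sum]
    refine Finset.sum_congr rfl fun k _ => ?_
    rw [_root_.id, hiter, mul_smul, map_smul _ ((j.factorial : ℂ)⁻¹)]
  set K := (U : Lp ℂ 2 μ →ₗ[ℂ] Lp ℂ 2 μ).eqLocus (1 : Lp ℂ 2 μ →L[ℂ] Lp ℂ 2 μ) with hK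
  have hlim := U.tendsto_birkhoffAverage_orthogonalProjection hU1 (toL2 μ g)
  obtain ⟨v, hvK, hv⟩ : ∃ v ∈ K, v = (K.orthogonalProjectionOnto (toL2 μ g) : Lp ℂ 2 μ) :=
    ⟨_, Subtype.coe_prop _, rfl⟩
  have hfac : Tendsto Nat.factorial atTop atTop :=
    tendsto_atTop_mono Nat.self_le_factorial tendsto_id
  have hvδ : δ ≤ ‖v‖ := by
    rw [hv]
    refine ge_of_tendsto' (hlim.comp hfac).norm fun j => ?_
    have := h j
    rw [← norm_sq_toL2, ← hj] at this
    exact le_of_sq_le_sq this (norm_nonneg _)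
  have hinn : inner ℂ v (toL2 μ g) = ((‖v‖ ^ 2 : ℝ) : ℂ) := by
    have h0 : inner ℂ v (toL2 μ g - v) = 0 := by
      rw [hv]
      exact Submodule.inner_right_of_mem_orthogonal (hv ▸ hvK)
        (K.sub_starProjection_mem_orthogonal (toL2 μ g))
    rw [inner_sub_right, sub_eq_zero] at h0
    rw [h0, inner_self_eq_norm_sq_to_K]
    push_cast
    rfl
  have hll : l * star l = 1 := by
    have := Complex.mul_conj' l
    rw [hl] at this
    simpa using this
  have hvT : ∀ᵐ x ∂μ, v (T x) = l * v x := by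
    have e : star l • Lp.compMeasurePreserving T hTp v = v := hvK
    have e2 : Lp.compMeasurePreserving T hTp v = l • v := by
      nth_rewrite 2 [← e]
      rw [smul_smul, hll, one_smul]
    filter_upwards [Lp.coeFn_compMeasurePreserving v hTp, Lp.coeFn_smul l v] with x hx hy
    rw [e2, hy] at hx
    exact hx.symm
  have hmeas : Measurable v := (Lp.stronglyMeasurable v).measurable
  obtain ⟨c, hc⟩ := hT.ae_eq_const_of_ae_eq_comp_ae (g := fun x => ‖v x‖)
    hmeas.norm.aestronglyMeasurable (by
      filter_upwards [hvT] with x hx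
      change ‖v (T x)‖ = ‖v x‖
      rw [hx, norm_mul, hl, one_mul])
  have hcv : ∀ᵐ x ∂μ, ‖v x‖ = c := hc
  have hc0 : 0 ≤ c := by
    obtain ⟨x, hx⟩ := hcv.exists
    rw [← hx]
    exact norm_nonneg _
  have hvc : ‖v‖ = c := by
    have h1 : ((‖v‖ ^ 2 : ℝ) : ℂ) = ((c ^ 2 : ℝ) : ℂ) := by
      have : inner ℂ v v = ((‖v‖ ^ 2 : ℝ) : ℂ) := by
        rw [inner_self_eq_norm_sq_to_K]
        push_cast
        rfl
      rw [← this, L2.inner_def]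
      have e : ∀ᵐ x ∂μ, inner ℂ (v x) (v x) = ((c ^ 2 : ℝ) : ℂ) := by
        filter_upwards [hcv] with x hx
        rw [inner_self_eq_norm_sq_to_K, hx]
        push_cast
        rfl
      rw [integral_congr_ae e]
      simp
    have h2 : ‖v‖ ^ 2 = c ^ 2 := by exact_mod_cast h1
    exact (sq_eq_sq₀ (norm_nonneg _) hc0).1 h2
  have hcpos : 0 < c := by linarith
  have hcne : (c : ℂ) ≠ 0 := by exact_mod_cast hcpos.ne'
  classical
  have hbd : ∀ x, ‖if ‖v x‖ = c then v x / c else 1‖ ≤ 1 := by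
    intro x
    split_ifs with h
    · rw [norm_div, h, Complex.norm_real, Real.norm_of_nonneg hc0, div_self hcpos.ne']
    · simp
  obtain ⟨χ, hχB, hχ⟩ : ∃ χ : BM X, (∀ x, ‖χ x‖ ≤ 1) ∧ ∀ᵐ x ∂μ, χ x = v x / c := by
    refine ⟨⟨fun x => if ‖v x‖ = c then v x / c else 1,
      Measurable.ite (measurableSet_eq_fun hmeas.norm measurable_const)
        (hmeas.div_const _) measurable_const, 1, hbd⟩, hbd, ?_⟩
    filter_upwards [hcv] with x hx
    exact if_pos hx
  refine ⟨χ, hχB, fun f => ?_, fun f => ?_, ?_⟩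
  · have e : shift T 1 χ =ᵐ[μ] (l • χ : BM X) := by
      filter_upwards [hχ, hTp.quasiMeasurePreserving.ae hχ, hvT] with x h1 h2 h3
      rw [shift_apply, zpow_one, smul_apply, h1]
      change χ (T x) = _
      rw [h2, h3, mul_div_assoc]
    rw [int_congr μ e, mul_smul_comm, map_smul, smul_eq_mul]
  · have e : (χ * star χ : BM X) =ᵐ[μ] (1 : BM X) := by
      filter_upwards [hχ, hcv] with x h1 h2
      have := Complex.mul_conj' (χ x)
      change χ x * (starRingEnd ℂ) (χ x) = 1
      rw [this, h1, norm_div, h2, Complex.norm_real, Real.norm_of_nonneg hc0,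
        div_self hcpos.ne']
      simp
    rw [int_congr μ e, mul_one]
  · have e : int μ (g * star χ) = inner ℂ v (toL2 μ g) / c := by
      rw [L2.inner_def, int_apply, ← integral_div]
      refine integral_congr_ae ?_
      filter_upwards [hχ, coeFn_toL2 μ g] with x h1 h2
      rw [h2, RCLike.inner_apply, mul_apply, star_apply, h1, star_div₀]
      have : star (c : ℂ) = c := Complex.conj_ofReal c
      rw [this, mul_div_assoc]
      rfl
    rw [e, hinn, hvc, norm_div, Complex.norm_real, Complex.norm_real, Real.norm_of_nonneg hc0,
      Real.norm_of_nonneg (by positivity), sq, mul_self_div_self]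
    linarith

end BM

/-- The abstract system of an ergodic transformation. -/
noncomputable def Ergodic.sys {μ : Measure X} [IsProbabilityMeasure μ] {T : X ≃ᵐ X}
    (hT : Ergodic T μ) : ErgSys (BM X) where
  B f := ∀ x, ‖f x‖ ≤ 1
  B_one x := by simp
  B_mul hf hg x := by
    rw [BM.mul_apply, norm_mul]
    exact mul_le_one₀ (hf x) (norm_nonneg _) (hg x)
  B_star hf x := by
    rw [BM.star_apply, norm_star]
    exact hf x
  B_sum s c f hf hc x := by
    rw [BM.sum_apply]
    refine (norm_sum_le _ _).trans (le_trans (Finset.sum_le_sum fun i hi => ?_) hc)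
    rw [BM.smul_apply, norm_mul]
    exact mul_le_of_le_one_right (norm_nonneg _) (hf i hi x)
  int := BM.int μ
  sh := BM.shift T
  sh_zero _ := rfl
  sh_add := BM.shift_add T
  B_sh a hf x := hf _
  int_sh := BM.int_shift μ T hT.toMeasurePreserving
  int_star := BM.int_star μ
  int_one := by simp [BM.int_apply]
  int_le := BM.int_le μ
  int_cs hb _ := BM.int_cs μ hb
  m := mean
  m_one := mean_one
  m_le := mean_le
  m_mono := mean_mono
  m_shift := mean_shift
  m_cs := mean_cs
  dual _ hu := BM.exists_dual μ hu
  eig_unique _ _ _ hl _ _ h1 h2 h3 h4 := BM.eig_unique hT hl h1 h2 h3 h4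
  eig_extract _ _ _ hl _ hδ h := BM.eig_extract hT hl hδ h

end Ergodic

section Decomposition

open Topology

variable {X : Type*} [m0 : MeasurableSpace X] {μ : Measure X}

theorem integral_mul_condExp_eq [IsProbabilityMeasure μ] {m : MeasurableSpace X} (hm : m ≤ m0) {f G : X → ℝ}
    (hG : Measurable[m] G) (hf : Integrable f μ) (hGf : Integrable (G * f) μ) :
    ∫ x, G x * (μ[f|m]) x ∂μ = ∫ x, G x * f x ∂μ := by
  have h := condExp_mul_of_stronglyMeasurable_left (m := m) hG.stronglyMeasurable hGf hf
  calc ∫ x, G x * (μ[f|m]) x ∂μ = ∫ x, (μ[G * f|m]) x ∂μ := (integral_congr_ae h).symm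
    _ = _ := integral_condExp hm

theorem exists_measurable_invariants_ae_eq {S : X → X} (hS : MeasurePreserving S μ μ) {G : X → ℝ}
    (hG : Measurable G) (h : G ∘ S =ᵐ[μ] G) :
    ∃ G', Measurable[MeasurableSpace.invariants S] G' ∧ G' =ᵐ[μ] G := by
  let G' : X → ℝ := fun x => limsup (fun n : ℕ => G (S^[n] x)) atTop
  refine ⟨G', ?_, ?_⟩
  · rw [MeasurableSpace.measurable_invariants_dom]
    refine ⟨Measurable.limsup fun n => hG.comp (hS.measurable.iterate n), fun s _ => ?_⟩
    have e : G' ∘ S = G' := by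
      ext x
      exact limsup_nat_add (fun n : ℕ => G (S^[n] x)) 1
    rw [e]
  · have h1 : ∀ n : ℕ, ∀ᵐ x ∂μ, G (S^[n] x) = G x := by
      intro n
      induction n with
      | zero => exact Eventually.of_forall fun _ => rfl
      | succ n ih =>
        filter_upwards [hS.quasiMeasurePreserving.ae ih, h] with x hx hy
        rw [Function.iterate_succ_apply, hx]
        exact hy
    filter_upwards [ae_all_iff.2 h1] with x hx
    change limsup (fun n : ℕ => G (S^[n] x)) atTop = G x
    simp only [hx]
    exact limsup_const _

variable [IsProbabilityMeasure μ]

theorem exists_condExp_mem_Icc {m : MeasurableSpace X} (hm : m ≤ m0) {f : X → ℝ}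
    (hf : Integrable f μ) (hf0 : ∀ x, f x ∈ Set.Icc (0 : ℝ) 1) :
    ∃ P : X → ℝ, Measurable[m] P ∧ (∀ x, P x ∈ Set.Icc (0 : ℝ) 1) ∧ P =ᵐ[μ] μ[f|m] := by
  refine ⟨fun x => max 0 (min 1 ((μ[f|m]) x)), ?_, fun x => ?_, ?_⟩
  · exact measurable_const.max (measurable_const.min stronglyMeasurable_condExp.measurable)
  · exact ⟨le_max_left _ _, max_le zero_le_one (min_le_left _ _)⟩
  · have h0 : 0 ≤ᵐ[μ] μ[f|m] := condExp_nonneg (Eventually.of_forall fun x => (hf0 x).1)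
    have h1 : μ[f|m] ≤ᵐ[μ] μ[fun _ => (1 : ℝ)|m] :=
      condExp_mono hf (integrable_const _) (Eventually.of_forall fun x => (hf0 x).2)
    rw [condExp_const hm] at h1
    filter_upwards [h0, h1] with x hx hy
    rw [min_eq_right hy]
    exact max_eq_right hx

theorem abs_le_one_of_mem_Icc {t : ℝ} (h : t ∈ Set.Icc (0 : ℝ) 1) : |t| ≤ 1 := by
  rw [abs_of_nonneg h.1]
  exact h.2

theorem abs_sub_le_one_of_mem_Icc {s t : ℝ} (hs : s ∈ Set.Icc (0 : ℝ) 1)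
    (ht : t ∈ Set.Icc (0 : ℝ) 1) : |s - t| ≤ 1 := by
  rw [abs_le]
  constructor <;> linarith [hs.1, hs.2, ht.1, ht.2]

/-- A bounded real function as an observable. -/
def BM.ofReal (f : X → ℝ) (hf : Measurable f) (hb : ∀ x, |f x| ≤ 1) : BM X :=
  ⟨fun x => (f x : ℂ), Complex.measurable_ofReal.comp hf, 1, fun x => by
    rw [Complex.norm_real]
    exact hb x⟩

theorem BM.norm_ofReal_le {f : X → ℝ} (hf : Measurable f) (hb : ∀ x, |f x| ≤ 1) (x : X) :
    ‖BM.ofReal f hf hb x‖ ≤ 1 := by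
  change ‖(f x : ℂ)‖ ≤ 1
  rw [Complex.norm_real]
  exact hb x

theorem integrable_of_abs_le {f : X → ℝ} (hf : Measurable f) {c : ℝ} (hb : ∀ᵐ x ∂μ, |f x| ≤ c) :
    Integrable f μ :=
  memLp_one_iff_integrable.1 (MemLp.of_bound hf.aestronglyMeasurable c hb)

theorem Ergodic.ratOrth {T : X ≃ᵐ X} (hT : Ergodic T μ) {f P : X → ℝ}
    (hf : Measurable f) (hf0 : ∀ x, f x ∈ Set.Icc (0 : ℝ) 1)
    (hPm : Measurable P) (hP0 : ∀ x, P x ∈ Set.Icc (0 : ℝ) 1)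
    (hm : ∃ m : MeasurableSpace X, m ≤ m0 ∧
      (∀ n : ℕ, 0 < n → @MeasurableSpace.invariants X m0 (T^[n]) ≤ m) ∧ P =ᵐ[μ] μ[f|m]) :
    hT.sys.RatOrth (BM.ofReal (fun x => f x - P x) (hf.sub hPm)
      fun x => abs_sub_le_one_of_mem_Icc (hf0 x) (hP0 x)) := by
  intro b hb G hG hinv
  have hTp := hT.toMeasurePreserving
  have hfi : Integrable f μ :=
    integrable_of_abs_le hf (Eventually.of_forall fun x => abs_le_one_of_mem_Icc (hf0 x))
  have hGb : ∀ᵐ x ∂μ, G ((T.toEquiv ^ b) x) = G x := by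
    refine BM.ae_eq_of_forall_int μ (f := BM.shift T b G) (g := G) fun φ => ?_
    obtain ⟨c, hc⟩ := φ.2.2
    have hc' : ∀ x, ‖φ x‖ ≤ max c 1 := fun x => (hc x).trans (le_max_left _ _)
    have hpos : 0 < max c 1 := lt_max_of_lt_right one_pos
    have hne : ((max c 1 : ℝ) : ℂ) ≠ 0 := by exact_mod_cast hpos.ne'
    have h := hinv ((((max c 1 : ℝ) : ℂ)⁻¹) • φ) (fun x => by
      rw [BM.smul_apply, norm_mul, norm_inv, Complex.norm_real, Real.norm_of_nonneg hpos.le]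
      exact (inv_mul_le_one₀ hpos).2 (hc' x))
    rw [smul_mul_assoc, smul_mul_assoc, map_smul, map_smul, smul_eq_mul, smul_eq_mul] at h
    exact mul_left_cancel₀ (inv_ne_zero hne) h
  obtain ⟨n, hn, hGn⟩ : ∃ n : ℕ, 0 < n ∧ ∀ᵐ x ∂μ, G (T^[n] x) = G x := by
    obtain ⟨n, rfl | rfl⟩ := b.eq_nat_or_neg
    · refine ⟨n, Nat.pos_of_ne_zero (by simpa using hb), ?_⟩
      rw [zpow_natCast, Equiv.Perm.coe_pow] at hGb
      exact hGb
    · refine ⟨n, Nat.pos_of_ne_zero (by simpa using hb), ?_⟩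
      filter_upwards [(hTp.iterate n).quasiMeasurePreserving.ae hGb] with x hx
      rw [← hx]
      have : T^[n] x = (T.toEquiv ^ n) x := by
        rw [Equiv.Perm.coe_pow]
        rfl
      rw [this, ← zpow_natCast, ← Equiv.Perm.mul_apply, ← zpow_add, neg_add_cancel, zpow_zero,
        Equiv.Perm.one_apply]
  have key : ∀ H : X → ℝ, Measurable H → (∀ x, |H x| ≤ 1) → (∀ᵐ x ∂μ, H (T^[n] x) = H x) →
      ∫ x, (f x - P x) * H x ∂μ = 0 := by
    intro H hH hH1 hHn
    obtain ⟨H', hH'm, hH'⟩ := exists_measurable_invariants_ae_eq (hTp.iterate n) hH hHn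
    have hHmeas : Measurable H' := hH'm.mono (MeasurableSpace.invariants_le _) le_rfl
    have hH'1 : ∀ᵐ x ∂μ, |H' x| ≤ 1 := by
      filter_upwards [hH'] with x hx
      rw [hx]
      exact hH1 x
    have hintg : Integrable (H' * f) μ := by
      refine integrable_of_abs_le (hHmeas.mul hf) (c := 1) ?_
      filter_upwards [hH'1] with x hx
      rw [Pi.mul_apply, abs_mul]
      exact mul_le_one₀ hx (abs_nonneg _) (abs_le_one_of_mem_Icc (hf0 x))
    have hintg₂ : Integrable (fun x => H' x * P x) μ := by
      refine integrable_of_abs_le (hHmeas.mul hPm) (c := 1) ?_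
      filter_upwards [hH'1] with x hx
      rw [abs_mul]
      exact mul_le_one₀ hx (abs_nonneg _) (abs_le_one_of_mem_Icc (hP0 x))
    have h1 : ∫ x, H' x * f x ∂μ = ∫ x, H' x * P x ∂μ := by
      obtain ⟨m, hm, hTm, hP⟩ := hm
      rw [← @integral_mul_condExp_eq X m0 μ _ m hm f H' (hH'm.mono (hTm n hn) le_rfl) hfi hintg]
      refine integral_congr_ae ?_
      filter_upwards [hP] with x hx
      rw [hx]
    calc ∫ x, (f x - P x) * H x ∂μ = ∫ x, (H' x * f x - H' x * P x) ∂μ := by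
          refine integral_congr_ae ?_
          filter_upwards [hH'] with x hx
          rw [hx]
          ring
      _ = ∫ x, H' x * f x ∂μ - ∫ x, H' x * P x ∂μ := integral_sub hintg hintg₂
      _ = 0 := by rw [h1, sub_self]
  have hi := BM.integrable μ (BM.ofReal (fun x => f x - P x) (hf.sub hPm)
      (fun x => abs_sub_le_one_of_mem_Icc (hf0 x) (hP0 x)) * G)
  change ∫ x, ((f x - P x : ℝ) : ℂ) * G x ∂μ = 0
  have hre := Complex.reCLM.integral_comp_comm hi
  have him := Complex.imCLM.integral_comp_comm hi
  refine Complex.ext (hre.symm.trans ?_) (him.symm.trans ?_)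
  · refine Eq.trans (integral_congr_ae (Eventually.of_forall fun x => ?_))
      (key (fun x => (G x).re) (Complex.measurable_re.comp (BM.measurable G))
        (fun x => (Complex.abs_re_le_norm _).trans (hG x)) ?_)
    · change (((f x - P x : ℝ) : ℂ) * G x).re = _
      rw [Complex.re_ofReal_mul]
    · filter_upwards [hGn] with x hx
      rw [hx]
  · refine Eq.trans (integral_congr_ae (Eventually.of_forall fun x => ?_))
      (key (fun x => (G x).im) (Complex.measurable_im.comp (BM.measurable G))
        (fun x => (Complex.abs_im_le_norm _).trans (hG x)) ?_)
    · change (((f x - P x : ℝ) : ℂ) * G x).im = _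
      rw [Complex.im_ofReal_mul]
    · filter_upwards [hGn] with x hx
      rw [hx]

/-- Decomposition of an observable into a periodic part, a rationally orthogonal part and a small
remainder. -/
theorem Ergodic.exists_decomp {T : X ≃ᵐ X} (hT : Ergodic T μ) {f : X → ℝ} (hf : Measurable f)
    (hf0 : ∀ x, f x ∈ Set.Icc (0 : ℝ) 1) {η : ℝ} (hη : 0 < η) :
    ∃ q : ℕ, 0 < q ∧ ∃ g e r : BM X, hT.sys.B g ∧ hT.sys.B e ∧ hT.sys.RatOrth e ∧
      (∀ h, hT.sys.B h → hT.sys.int (h * hT.sys.sh q g) = hT.sys.int (h * g)) ∧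
      (∀ b, hT.sys.B b → ‖hT.sys.int (b * r)‖ ≤ η) ∧
      BM.ofReal f hf (fun x => abs_le_one_of_mem_Icc (hf0 x)) = g + (e + r) ∧
      ∀ k : ℕ, (∫ x, f x ∂μ) ^ (k + 1) ≤ (hT.sys.int
        (BM.ofReal f hf (fun x => abs_le_one_of_mem_Icc (hf0 x)) * g ^ k)).re := by
  have hfi : Integrable f μ :=
    integrable_of_abs_le hf (Eventually.of_forall fun x => abs_le_one_of_mem_Icc (hf0 x))
  have hmono : ∀ i j : ℕ, i ∣ j →
      MeasurableSpace.invariants (T^[i]) ≤ MeasurableSpace.invariants (T^[j]) := by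
    rintro i _ ⟨k, rfl⟩
    rw [Function.iterate_mul]
    exact MeasurableSpace.le_invariants_iterate _ _
  let ℱ : Filtration ℕ m0 :=
    { seq := fun j => MeasurableSpace.invariants (T^[j.factorial])
      mono' := fun i j hij => hmono _ _ (Nat.factorial_dvd_factorial hij)
      le' := fun j => MeasurableSpace.invariants_le _ }
  have hm : ⨆ n, ℱ n ≤ m0 := iSup_le fun n => ℱ.le n
  obtain ⟨P, hPm, hP0, hP⟩ := exists_condExp_mem_Icc (μ := μ) hm hfi hf0
  have hPm' : Measurable P := hPm.mono hm le_rfl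
  have hlim := tendsto_eLpNorm_condExp (μ := μ) (ℱ := ℱ) f
  obtain ⟨j, hj⟩ := ((ENNReal.tendsto_nhds_zero.1 hlim) (ENNReal.ofReal η)
    (ENNReal.ofReal_pos.2 hη)).exists
  obtain ⟨g, hgm, hg0, hg⟩ := exists_condExp_mem_Icc (μ := μ) (ℱ.le j) hfi hf0
  have hgm' : Measurable g := hgm.mono (ℱ.le j) le_rfl
  have hginv : g ∘ T^[j.factorial] = g := MeasurableSpace.comp_eq_of_measurable_invariants hgm
  refine ⟨j.factorial, j.factorial_pos,
    BM.ofReal g hgm' fun x => abs_le_one_of_mem_Icc (hg0 x),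
    BM.ofReal (fun x => f x - P x) (hf.sub hPm')
      (fun x => abs_sub_le_one_of_mem_Icc (hf0 x) (hP0 x)),
    BM.ofReal (fun x => P x - g x) (hPm'.sub hgm')
      (fun x => abs_sub_le_one_of_mem_Icc (hP0 x) (hg0 x)),
    BM.norm_ofReal_le _ _, BM.norm_ofReal_le _ _, ?_, ?_, ?_, ?_, ?_⟩
  · refine hT.ratOrth hf hf0 hPm' hP0 ⟨_, hm, fun n hn => ?_, hP⟩
    exact (hmono _ _ (Nat.dvd_factorial hn le_rfl)).trans (le_iSup (fun n => (ℱ n)) n)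
  · intro h _
    congr 2
    ext x
    change ((g ((T.toEquiv ^ (j.factorial : ℤ)) x) : ℝ) : ℂ) = (g x : ℂ)
    rw [zpow_natCast, Equiv.Perm.coe_pow]
    have := congrFun hginv x
    exact_mod_cast this
  · intro b hb
    have h1 : ∫ x, |P x - g x| ∂μ ≤ η := by
      have h2 : eLpNorm (fun x => P x - g x) 1 μ ≤ ENNReal.ofReal η := by
        refine le_trans (le_of_eq (eLpNorm_congr_norm_ae ?_)) hj
        filter_upwards [hP, hg] with x hx hy
        rw [hx, hy, Pi.sub_apply, norm_sub_rev]
      rw [eLpNorm_one_eq_lintegral_enorm] at h2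
      have h3 := integral_norm_eq_lintegral_enorm (μ := μ) (hPm'.sub hgm').aestronglyMeasurable
      calc ∫ x, |P x - g x| ∂μ = (∫⁻ x, ‖P x - g x‖ₑ ∂μ).toReal := h3
        _ ≤ (ENNReal.ofReal η).toReal := ENNReal.toReal_mono ENNReal.ofReal_ne_top h2
        _ = η := ENNReal.toReal_ofReal hη.le
    refine le_trans (norm_integral_le_of_norm_le ?_ (Eventually.of_forall fun x => ?_)) h1
    · exact (integrable_of_abs_le (hPm'.sub hgm') (Eventually.of_forall fun x =>
        abs_sub_le_one_of_mem_Icc (hP0 x) (hg0 x))).abs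
    · change ‖b x * ((P x - g x : ℝ) : ℂ)‖ ≤ _
      rw [norm_mul, Complex.norm_real, Real.norm_eq_abs]
      exact mul_le_of_le_one_left (abs_nonneg _) (hb x)
  · ext x
    change (f x : ℂ) = (g x : ℂ) + (((f x - P x : ℝ) : ℂ) + ((P x - g x : ℝ) : ℂ))
    push_cast
    ring
  · intro k
    have hgk : Measurable[ℱ j] fun x => g x ^ k := hgm.pow_const k
    have hgkb : ∀ x, |g x ^ k| ≤ 1 := fun x => by
      rw [abs_pow]
      exact pow_le_one₀ (abs_nonneg _) (abs_le_one_of_mem_Icc (hg0 x))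
    have h1 := integral_mul_condExp_eq (ℱ.le j) hgk hfi (integrable_of_abs_le
      ((hgm'.pow_const k).mul hf) (c := 1) (Eventually.of_forall fun x => by
        rw [Pi.mul_apply, abs_mul]
        exact mul_le_one₀ (hgkb x) (abs_nonneg _) (abs_le_one_of_mem_Icc (hf0 x))))
    have h2 : ∫ x, g x ^ k * f x ∂μ = ∫ x, g x ^ (k + 1) ∂μ := by
      rw [← h1]
      refine integral_congr_ae ?_
      filter_upwards [hg] with x hx
      rw [← hx, pow_succ]
    have h3 : ∫ x, g x ∂μ = ∫ x, f x ∂μ := by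
      rw [integral_congr_ae hg, integral_condExp (ℱ.le j)]
    have h4 : (∫ x, g x ∂μ) ^ (k + 1) ≤ ∫ x, g x ^ (k + 1) ∂μ := by
      refine (convexOn_pow (𝕜 := ℝ) (k + 1)).map_integral_le (continuous_pow _).continuousOn
        isClosed_Ici (Eventually.of_forall fun x => (hg0 x).1)
        (integrable_of_abs_le hgm' (Eventually.of_forall fun x => abs_le_one_of_mem_Icc (hg0 x)))
        (integrable_of_abs_le (hgm'.pow_const (k + 1)) (c := 1) (Eventually.of_forall fun x => ?_))
      rw [Function.comp_apply, abs_pow]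
      exact pow_le_one₀ (abs_nonneg _) (abs_le_one_of_mem_Icc (hg0 x))
    rw [h3, ← h2] at h4
    refine h4.trans (le_of_eq ?_)
    have h5 : ((∫ x, g x ^ k * f x ∂μ : ℝ) : ℂ) = ∫ x, ((f x : ℝ) : ℂ) * ((g x : ℝ) : ℂ) ^ k ∂μ := by
      rw [← integral_complex_ofReal]
      refine integral_congr_ae (Eventually.of_forall fun x => ?_)
      push_cast
      ring
    exact congrArg Complex.re h5

end Decomposition

/-- The normalized Fejér kernel. -/
noncomputable def fejer (M : ℕ) (z : Circle) : ℝ :=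
  ‖(M : ℂ)⁻¹ * ∑ j ∈ Finset.range M, (z : ℂ) ^ j‖ ^ 2

theorem fejer_nonneg (M : ℕ) (z : Circle) : 0 ≤ fejer M z := sq_nonneg _

theorem fejer_le_one (M : ℕ) (z : Circle) : fejer M z ≤ 1 := by
  refine pow_le_one₀ (norm_nonneg _) ?_
  exact norm_cesaro_le (u := fun j => (z : ℂ) ^ j) (fun n => by rw [norm_pow, Circle.norm_coe, one_pow]) M

theorem fejer_one {M : ℕ} (hM : 0 < M) : fejer M 1 = 1 := by
  have : (M : ℂ) ≠ 0 := by exact_mod_cast hM.ne'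
  simp [fejer, this]

theorem continuous_fejer (M : ℕ) : Continuous (fejer M) := by
  unfold fejer
  have : Continuous fun z : Circle => (z : ℂ) := continuous_subtype_val
  fun_prop

theorem fejer_expand (M : ℕ) (z : Circle) : ((fejer M z : ℝ) : ℂ) =
    ∑ j ∈ Finset.range M, ∑ k ∈ Finset.range M, ((M : ℂ)⁻¹) ^ 2 * ((z ^ j * (z ^ k)⁻¹ : Circle) : ℂ) := by
  rw [fejer, Complex.ofReal_pow]
  rw [← Complex.mul_conj', map_mul, map_sum]
  simp only [map_pow, map_inv₀, Complex.conj_natCast]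
  rw [mul_mul_mul_comm, Finset.sum_mul_sum, Finset.mul_sum]
  refine Finset.sum_congr rfl fun j _ => ?_
  rw [Finset.mul_sum]
  refine Finset.sum_congr rfl fun k _ => ?_
  rw [← sq, Circle.coe_mul, ← inv_pow, Circle.coe_pow, Circle.coe_pow, Circle.coe_inv_eq_conj]

namespace ErgSys

variable {𝓐 : Type*} [CommRing 𝓐] [StarRing 𝓐] [Algebra ℂ 𝓐] [StarModule ℂ 𝓐] {X : ErgSys 𝓐}

theorem val_update_one {q : ℕ} {D : Finset ℕ} {c : ℕ} (hc : c ∈ D) (ζ : Circle) (f₀ : 𝓐)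
    (l : List (ℕ × 𝓐)) : X.val q D (Function.update 1 c ζ) f₀ l =
      X.m fun n => ((ζ ^ (q * n) ^ c : Circle) : ℂ) * X.int (f₀ * X.monProd q l n) := by
  rw [val, Φ_apply]
  congr 1
  ext n
  have h := phase_update (q := q) hc 1 ζ n
  rw [Pi.one_apply, one_mul] at h
  have h1 : phase q D 1 n = 1 := by simp [phase]
  rw [h, h1, one_mul, map_smul, smul_eq_mul]

/-- A Fejér weight at an irrational frequency along an exponent outside `ds` factors out. -/
theorem mean_fejer_mul {q : ℕ} (hq : 0 < q) {D : Finset ℕ} (hD : ∀ d ∈ D, 0 < d) {ds : List ℕ}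
    (hds : ds.Pairwise (· > ·)) (hdsD : ∀ d ∈ ds, d ∈ D) {c : ℕ} (hc : c ∈ D) (hcd : c ∉ ds)
    {ω : Circle} (hω : ¬ IsOfFinOrder ω) {f₀ : 𝓐} (hf₀ : X.B f₀) {l : List (ℕ × 𝓐)}
    (hl : l.map Prod.fst = ds) (hlB : ∀ t ∈ l, X.B t.2) {M : ℕ} (hM : 0 < M) :
    X.m (fun n => ((fejer M (ω ^ (q * n) ^ c) : ℝ) : ℂ) * X.int (f₀ * X.monProd q l n)) =
      (M : ℂ)⁻¹ * X.m (fun n => X.int (f₀ * X.monProd q l n)) := by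
  have key : ∀ j k : ℕ, X.m (fun n => ((((ω ^ j * (ω ^ k)⁻¹ : Circle)) ^ (q * n) ^ c : Circle) : ℂ) *
      X.int (f₀ * X.monProd q l n)) =
      if j = k then X.m (fun n => X.int (f₀ * X.monProd q l n)) else 0 := by
    intro j k
    split_ifs with hjk
    · subst hjk
      simp
    · rw [← val_update_one hc]
      by_contra hne
      obtain ⟨Q, hQ, h⟩ := rootOrder (X := X) hq hD hds hdsD _ (norm_pos_iff.2 hne)
      have h1 := h _ f₀ l hl hf₀ hlB le_rfl c hc hcd
      rw [Function.update_self, mul_pow, inv_pow, mul_inv_eq_one, ← pow_mul, ← pow_mul] at h1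
      have h2 := injective_pow_iff_not_isOfFinOrder.2 hω h1
      exact hjk (Nat.eq_of_mul_eq_mul_right hQ h2)
  have e : (fun n => ((fejer M (ω ^ (q * n) ^ c) : ℝ) : ℂ) * X.int (f₀ * X.monProd q l n)) =
      ∑ j ∈ Finset.range M, ∑ k ∈ Finset.range M, ((M : ℂ)⁻¹) ^ 2 •
        fun n => ((((ω ^ j * (ω ^ k)⁻¹ : Circle)) ^ (q * n) ^ c : Circle) : ℂ) *
          X.int (f₀ * X.monProd q l n) := by
    ext n
    rw [fejer_expand, Finset.sum_mul, Finset.sum_apply]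
    refine Finset.sum_congr rfl fun j _ => ?_
    rw [Finset.sum_mul, Finset.sum_apply]
    refine Finset.sum_congr rfl fun k _ => ?_
    have h : ∀ N : ℕ, (ω ^ N) ^ j * ((ω ^ N) ^ k)⁻¹ = (ω ^ j * (ω ^ k)⁻¹) ^ N := fun N => by
      rw [mul_pow, inv_pow, ← pow_mul, ← pow_mul, ← pow_mul, ← pow_mul, mul_comm j, mul_comm k]
    rw [Pi.smul_apply, smul_eq_mul, mul_assoc, h]
  rw [e]
  simp only [map_sum, map_smul, key, smul_eq_mul]
  simp only [mul_ite, mul_zero, Finset.sum_ite_eq, Finset.mem_range]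
  rw [Finset.sum_congr rfl (g := fun _ => ((M : ℂ)⁻¹) ^ 2 *
    X.m (fun n => X.int (f₀ * X.monProd q l n))) (fun j hj => if_pos (Finset.mem_range.1 hj)),
    Finset.sum_const, Finset.card_range, nsmul_eq_mul]
  have : (M : ℂ) ≠ 0 := by exact_mod_cast hM.ne'
  field_simp

end ErgSys

section Recurrence

theorem indicator_one_mem_Icc {X : Type*} (A : Set X) (x : X) :
    A.indicator (1 : X → ℝ) x ∈ Set.Icc (0 : ℝ) 1 := by
  by_cases h : x ∈ A <;> simp [h]

variable {X : Type*} [MeasurableSpace X] {μ : Measure X} [IsProbabilityMeasure μ]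

/-- The set of points of `A` returning to `A` at all times `n ^ d`, `d ∈ a`. -/
def returnSet (T : X ≃ᵐ X) (A : Set X) (a : Finset ℕ) (n : ℕ) : Set X :=
  A ∩ ⋂ d ∈ a, (⇑(T.toEquiv ^ ((n : ℤ) ^ d))) ⁻¹' A

theorem measurableSet_returnSet (T : X ≃ᵐ X) {A : Set X} (hA : MeasurableSet A) (a : Finset ℕ)
    (n : ℕ) : MeasurableSet (returnSet T A a n) :=
  hA.inter (Finset.measurableSet_biInter _ fun _ _ => measurable_zpow T _ hA)

theorem Ergodic.monProd_indicator {T : X ≃ᵐ X} (hT : Ergodic T μ) {A : Set X}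
    (hA : MeasurableSet A) (q n : ℕ) (ds : List ℕ) (x : X) :
    (hT.sys.monProd q (ds.map fun d => (d, BM.ofReal (A.indicator 1) (measurable_one.indicator hA)
      fun x => abs_le_one_of_mem_Icc (indicator_one_mem_Icc A x))) n) x =
      (((⋂ d ∈ ds, (⇑(T.toEquiv ^ (((q * n : ℕ) : ℤ) ^ d))) ⁻¹' A).indicator (1 : X → ℝ) x : ℝ) :
        ℂ) := by
  induction ds with
  | nil => simp [ErgSys.monProd_nil]
  | cons d ds ih =>
    rw [List.map_cons, ErgSys.monProd_cons, BM.mul_apply, ih]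
    change ((A.indicator (1 : X → ℝ) ((T.toEquiv ^ (((q * n : ℕ) : ℤ) ^ d)) x) : ℝ) : ℂ) * _ = _
    rw [← Complex.ofReal_mul]
    congr 1
    simp only [List.mem_cons, Set.iInter_iInter_eq_or_left]
    rw [Set.inter_indicator_one]
    rfl

theorem Ergodic.int_indicator_mul_monProd {T : X ≃ᵐ X} (hT : Ergodic T μ) {A : Set X}
    (hA : MeasurableSet A) (q n : ℕ) (a : Finset ℕ) :
    hT.sys.int (BM.ofReal (A.indicator 1) (measurable_one.indicator hA)
      (fun x => abs_le_one_of_mem_Icc (indicator_one_mem_Icc A x)) *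
    hT.sys.monProd q ((a.sort (· ≥ ·)).map fun d =>
      (d, BM.ofReal (A.indicator 1) (measurable_one.indicator hA)
      fun x => abs_le_one_of_mem_Icc (indicator_one_mem_Icc A x))) n) =
      ((μ.real (returnSet T A a (q * n)) : ℝ) : ℂ) := by
  rw [← integral_indicator_one (measurableSet_returnSet T hA a _), ← integral_complex_ofReal]
  refine integral_congr_ae (Eventually.of_forall fun x => ?_)
  dsimp only
  rw [BM.mul_apply, hT.monProd_indicator hA]
  simp only [Finset.mem_sort]
  change ((A.indicator (1 : X → ℝ) x : ℝ) : ℂ) * _ = _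
  rw [returnSet, ← Complex.ofReal_mul]
  congr 1
  rw [Set.inter_indicator_one]
  rfl

/-- Multiple recurrence in an ergodic system along times avoiding a Bohr-type neighbourhood. -/
theorem Ergodic.exists_returnSet_pos {T : X ≃ᵐ X} (hT : Ergodic T μ) {A : Set X}
    (hA : MeasurableSet A) (hμ : 0 < μ A) {a C : Finset ℕ} (ha : ∀ d ∈ a, 0 < d)
    (hC : ∀ c ∈ C, 0 < c) (haC : Disjoint C a) {ω : Circle} (hω : ¬ IsOfFinOrder ω) {M : ℕ → ℕ}
    (hM : ∀ c, 0 < M c) (hMC : ∑ c ∈ C, 2 * (M c : ℝ)⁻¹ < 1) (n₀ : ℕ) :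
    ∃ n, n₀ < n ∧ (∀ c ∈ C, fejer (M c) (ω ^ n ^ c) ≤ 1 / 2) ∧ 0 < μ (returnSet T A a n) := by
  by_contra! hcon
  set F : BM X := BM.ofReal (A.indicator 1) (measurable_one.indicator hA)
    fun x => abs_le_one_of_mem_Icc (indicator_one_mem_Icc A x) with hF
  have hFB : hT.sys.B F := BM.norm_ofReal_le _ _
  set α : ℝ := ∫ x, A.indicator (1 : X → ℝ) x ∂μ with hα
  have hα0 : 0 < α := by
    rw [hα, integral_indicator_one hA]
    exact ENNReal.toReal_pos hμ.ne' (measure_ne_top _ _)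
  set ds := a.sort (· ≥ ·) with hds
  set L := ds.length
  obtain ⟨η, hη0, hη⟩ : ∃ η : ℝ, 0 < η ∧ L * η < α ^ (L + 1) := by
    refine ⟨α ^ (L + 1) / (L + 1), by positivity, ?_⟩
    rw [mul_div_assoc', div_lt_iff₀ (by positivity), mul_comm]
    exact mul_lt_mul_of_pos_left (lt_add_one _) (by positivity)
  obtain ⟨q, hq, g, e, r, hgB, heB, he, hgq, hr, hfg, hk⟩ :=
    hT.exists_decomp (measurable_one.indicator hA) (indicator_one_mem_Icc A) hη0
  rw [← hF] at hfg hk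
  set D := C ∪ a
  have hD : ∀ d ∈ D, 0 < d := fun d hd => (Finset.mem_union.1 hd).elim (hC d) (ha d)
  have hds1 : ds.Pairwise (· > ·) := a.sortedGT_sort.pairwise
  have hds2 : ∀ d ∈ ds, d ∈ D := fun d hd =>
    Finset.mem_union_right _ ((Finset.mem_sort _).1 hd)
  set l : List (ℕ × BM X) := ds.map fun d => (d, F) with hl
  set v : ℕ → ℂ := fun n => hT.sys.int (F * hT.sys.monProd q l n) with hv
  have hvr : ∀ n, v n = ((μ.real (returnSet T A a (q * n)) : ℝ) : ℂ) :=
    fun n => hT.int_indicator_mul_monProd hA q n a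
  have hv1 : ∀ n, ‖v n‖ ≤ 1 := fun n => by
    rw [hvr, Complex.norm_real, Real.norm_of_nonneg measureReal_nonneg]
    exact measureReal_le_one
  have hV : hT.sys.val q D 1 F l = mean v := by
    rw [ErgSys.val, ErgSys.Φ_apply]
    change mean _ = mean _
    congr 1
    ext n
    have h1 : phase q D 1 n = 1 := by simp [phase]
    rw [h1, Circle.coe_one, one_smul]
  have hpos : 0 < (mean v).re := by
    have h1 := ErgSys.val_sub_le hq hD hFB hFB hgB heB he hgq hr hfg ds [] hds1 hds2
    rw [List.nil_append, List.map_nil, List.nil_append, ErgSys.val_one_of_invariant hFB hgB hgq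
      (fun d hd => hD d (hds2 d hd)), hV] at h1
    have h2 := (Complex.abs_re_le_norm _).trans h1
    rw [Complex.sub_re] at h2
    have h3 := (abs_le.1 h2).1
    linarith [hk L]
  set Ψ : ℕ → ℝ := fun n => 1 - ∑ c ∈ C, 2 * fejer (M c) (ω ^ n ^ c) with hΨ
  have hmean : mean (fun n => (Ψ (q * n) : ℂ) * v n) =
      ((1 - ∑ c ∈ C, 2 * (M c : ℝ)⁻¹ : ℝ) : ℂ) * mean v := by
    have e1 : (fun n => (Ψ (q * n) : ℂ) * v n) = v - ∑ c ∈ C, (2 : ℂ) •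
        fun n => ((fejer (M c) (ω ^ (q * n) ^ c) : ℝ) : ℂ) * v n := by
      ext n
      rw [Pi.sub_apply, Finset.sum_apply, hΨ]
      push_cast
      rw [sub_mul, one_mul, Finset.sum_mul]
      congr 1
      refine Finset.sum_congr rfl fun c _ => ?_
      rw [Pi.smul_apply, smul_eq_mul, mul_assoc]
    rw [e1, map_sub, map_sum]
    push_cast
    rw [sub_mul, one_mul, Finset.sum_mul]
    congr 1
    refine Finset.sum_congr rfl fun c hc => ?_
    rw [map_smul, smul_eq_mul, mul_assoc]
    congr 1
    refine hT.sys.mean_fejer_mul hq hD hds1 hds2 (Finset.mem_union_left _ hc) ?_ hω hFB ?_ ?_ (hM c)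
    · rw [Finset.mem_sort]
      exact Finset.disjoint_left.1 haC hc
    · rw [hl, List.map_map]
      simp [Function.comp_def]
    · intro t ht
      obtain ⟨d, _, rfl⟩ := List.mem_map.1 ht
      exact hFB
  have hΨb : ∀ n, |Ψ n| ≤ 1 + ∑ c ∈ C, 2 := by
    intro n
    have h1 : 0 ≤ ∑ c ∈ C, 2 * fejer (M c) (ω ^ n ^ c) :=
      Finset.sum_nonneg fun c _ => mul_nonneg zero_le_two (fejer_nonneg _ _)
    have h2 : ∑ c ∈ C, 2 * fejer (M c) (ω ^ n ^ c) ≤ ∑ c ∈ C, (2 : ℝ) :=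
      Finset.sum_le_sum fun c _ => by linarith [fejer_le_one (M c) (ω ^ n ^ c)]
    rw [abs_le]
    constructor <;> linarith
  have hb : ∀ n, ‖(Ψ (q * n) : ℂ) * v n‖ ≤ 1 + ∑ c ∈ C, 2 := by
    intro n
    rw [norm_mul, Complex.norm_real]
    exact (mul_le_of_le_one_right (norm_nonneg _) (hv1 n)).trans (hΨb _)
  have hshift : ∀ k, mean (fun n => (Ψ (q * (n + k)) : ℂ) * v (n + k)) =
      mean (fun n => (Ψ (q * n) : ℂ) * v n) := by
    intro k
    induction k with
    | zero => rfl
    | succ k ih =>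
      rw [← ih, ← mean_shift fun n => hb (n + k)]
      congr 1
      ext n
      rw [add_right_comm, add_assoc]
  have hle : (mean (fun n => (Ψ (q * n) : ℂ) * v n)).re ≤ 0 := by
    rw [← hshift (n₀ + 1)]
    have h0 : (mean (0 : ℕ → ℂ)).re = 0 := by rw [map_zero, Complex.zero_re]
    rw [← h0]
    refine mean_mono (fun n => hb _) (d := 0) (by simp) fun n => ?_
    rw [Pi.zero_apply, Complex.zero_re, Complex.re_ofReal_mul, hvr, Complex.ofReal_re]
    set N := q * (n + (n₀ + 1))
    have hN : n₀ < N := by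
      calc n₀ < 1 * (n + (n₀ + 1)) := by omega
        _ ≤ N := Nat.mul_le_mul_right _ hq
    by_cases hS : ∀ c ∈ C, fejer (M c) (ω ^ N ^ c) ≤ 1 / 2
    · have h1 := hcon N hN hS
      rw [Measure.real, nonpos_iff_eq_zero.1 h1]
      simp
    · push Not at hS
      obtain ⟨c, hc, hcl⟩ := hS
      refine mul_nonpos_of_nonpos_of_nonneg ?_ measureReal_nonneg
      have h1 : 2 * fejer (M c) (ω ^ N ^ c) ≤ ∑ c ∈ C, 2 * fejer (M c) (ω ^ N ^ c) :=
        Finset.single_le_sum (f := fun c => 2 * fejer (M c) (ω ^ N ^ c))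
          (fun c _ => mul_nonneg zero_le_two (fejer_nonneg _ _)) hc
      rw [hΨ]
      dsimp only
      linarith
  rw [hmean, Complex.re_ofReal_mul] at hle
  have : 0 < (1 - ∑ c ∈ C, 2 * (M c : ℝ)⁻¹) * (mean v).re := mul_pos (by linarith) hpos
  linarith

end Recurrence

section ErgodicSelection

variable {Ω : Type*} [TopologicalSpace Ω] [MeasurableSpace Ω] [BorelSpace Ω]

theorem continuous_real_of_isClopen [HasOuterApproxClosed Ω] {B : Set Ω} (hB : IsClopen B) :
    Continuous fun ν : ProbabilityMeasure Ω => (ν : Measure Ω).real B := by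
  have h : Continuous fun ν : ProbabilityMeasure Ω => ν B :=
    continuous_iff_continuousAt.2 fun ν =>
      ProbabilityMeasure.tendsto_measure_of_isClopen_of_tendsto tendsto_id hB
  exact NNReal.continuous_coe.comp h

theorem isClosed_measurePreserving [HasOuterApproxClosed Ω] {T : Ω → Ω} (hT : Continuous T) :
    IsClosed {ν : ProbabilityMeasure Ω | MeasurePreserving T (ν : Measure Ω) ν} := by
  have h : {ν : ProbabilityMeasure Ω | MeasurePreserving T (ν : Measure Ω) ν} =
      {ν | ν.map hT.measurable.aemeasurable = ν} := by
    ext ν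
    exact ⟨fun h => Subtype.ext h.map_eq, fun h => ⟨hT.measurable, congrArg Subtype.val h⟩⟩
  rw [h]
  exact isClosed_eq (ProbabilityMeasure.continuous_map hT) continuous_id

/-- An invariant measure vanishing on given clopen sets and charging the clopen set `U` can be
replaced by an ergodic one. -/
theorem exists_ergodic_of_isClopen [CompactSpace Ω] [T2Space Ω] [HasOuterApproxClosed Ω]
    [CompactSpace (ProbabilityMeasure Ω)] {T : Ω → Ω}
    (hT : Continuous T) {𝓑 : Set (Set Ω)} (h𝓑 : ∀ B ∈ 𝓑, IsClopen B) {U : Set Ω} (hU : IsClopen U)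
    {ν : ProbabilityMeasure Ω} (hν : MeasurePreserving T (ν : Measure Ω) ν)
    (hνB : ∀ B ∈ 𝓑, (ν : Measure Ω).real B = 0) (hνU : 0 < (ν : Measure Ω).real U) :
    ∃ ν' : ProbabilityMeasure Ω, Ergodic T (ν' : Measure Ω) ∧
      (∀ B ∈ 𝓑, (ν' : Measure Ω).real B = 0) ∧ 0 < (ν' : Measure Ω).real U := by
  set K : Set (ProbabilityMeasure Ω) := {ν | MeasurePreserving T (ν : Measure Ω) ν} ∩
    ⋂ B ∈ 𝓑, {ν | (ν : Measure Ω).real B = 0} with hK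
  have memK : ∀ ν : ProbabilityMeasure Ω, ν ∈ K ↔ MeasurePreserving T (ν : Measure Ω) ν ∧
      ∀ B ∈ 𝓑, (ν : Measure Ω).real B = 0 := fun ν => by
    simp only [hK, Set.mem_inter_iff, Set.mem_iInter, Set.mem_ofPred_eq]
  have hKc : IsCompact K := ((isClosed_measurePreserving hT).inter
    (isClosed_biInter fun B hB =>
      isClosed_eq (continuous_real_of_isClopen (h𝓑 B hB)) continuous_const)).isCompact
  obtain ⟨ρ, hρ, hmax⟩ := hKc.exists_isMaxOn ⟨ν, (memK ν).2 ⟨hν, hνB⟩⟩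
    (continuous_real_of_isClopen hU).continuousOn
  set m := (ρ : Measure Ω).real U with hm
  have hm0 : 0 < m := hνU.trans_le (hmax ((memK ν).2 ⟨hν, hνB⟩))
  set J := K ∩ {ν | (ν : Measure Ω).real U = m} with hJ
  have hJc : IsCompact J :=
    hKc.inter_right (isClosed_eq (continuous_real_of_isClopen hU) continuous_const)
  let e : ProbabilityMeasure Ω → (BoundedContinuousFunction Ω ℝ → ℝ) :=
    fun ν f => ∫ x, f x ∂(ν : Measure Ω)
  have he : Continuous e := continuous_pi fun f =>
    ProbabilityMeasure.continuous_integral_boundedContinuousFunction f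
  obtain ⟨y, hy⟩ := (hJc.image he).extremePoints_nonempty ⟨e ρ, ρ, ⟨hρ, rfl⟩, rfl⟩
  obtain ⟨⟨ν, ⟨hνK, hνm⟩, rfl⟩, hext⟩ := mem_extremePoints_iff_left.1 hy
  refine ⟨ν, Ergodic.of_mem_extremePoints (mem_extremePoints_iff_left.2
    ⟨⟨((memK ν).1 hνK).1, inferInstance⟩, ?_⟩), ((memK ν).1 hνK).2, hνm ▸ hm0⟩
  rintro ν₁ ⟨h₁, hp₁⟩ ν₂ ⟨h₂, hp₂⟩ ⟨a, b, ha, hb, hab, hν12⟩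
  have hatop : a ≠ ⊤ := fun h => by simp [h] at hab
  have hbtop : b ≠ ⊤ := fun h => by simp [h] at hab
  have ha0 := ENNReal.toReal_pos ha.ne' hatop
  have hb0 := ENNReal.toReal_pos hb.ne' hbtop
  have hab' : a.toReal + b.toReal = 1 := by
    rw [← ENNReal.toReal_add hatop hbtop, hab, ENNReal.toReal_one]
  have hreal : ∀ B, (ν : Measure Ω).real B = a.toReal * ν₁.real B + b.toReal * ν₂.real B := by
    intro B
    rw [← hν12, Measure.real, Measure.add_apply, Measure.smul_apply, Measure.smul_apply,
      smul_eq_mul, smul_eq_mul, ENNReal.toReal_add (ENNReal.mul_ne_top hatop (measure_ne_top _ _))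
      (ENNReal.mul_ne_top hbtop (measure_ne_top _ _)), ENNReal.toReal_mul, ENNReal.toReal_mul]
    rfl
  have hK₁ : (⟨ν₁, hp₁⟩ : ProbabilityMeasure Ω) ∈ K := (memK _).2 ⟨h₁, fun B hB => by
    have h := ((memK ν).1 hνK).2 B hB
    rw [hreal B] at h
    have := mul_nonneg hb0.le (measureReal_nonneg (μ := ν₂) (s := B))
    have h' := mul_nonneg ha0.le (measureReal_nonneg (μ := ν₁) (s := B))
    exact (mul_eq_zero.1 (le_antisymm (by linarith) h')).resolve_left ha0.ne'⟩
  have hK₂ : (⟨ν₂, hp₂⟩ : ProbabilityMeasure Ω) ∈ K := (memK _).2 ⟨h₂, fun B hB => by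
    have h := ((memK ν).1 hνK).2 B hB
    rw [hreal B] at h
    have := mul_nonneg hb0.le (measureReal_nonneg (μ := ν₂) (s := B))
    have h' := mul_nonneg ha0.le (measureReal_nonneg (μ := ν₁) (s := B))
    exact (mul_eq_zero.1 (le_antisymm (by linarith) this)).resolve_left hb0.ne'⟩
  have hU₁ : ν₁.real U ≤ m := hmax hK₁
  have hU₂ : ν₂.real U ≤ m := hmax hK₂
  have hUm : a.toReal * ν₁.real U + b.toReal * ν₂.real U = m := (hreal U).symm.trans hνm
  have hJ₁ : (⟨ν₁, hp₁⟩ : ProbabilityMeasure Ω) ∈ J := ⟨hK₁, hU₁.antisymm (by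
    change m ≤ ν₁.real U
    by_contra! hlt
    nlinarith)⟩
  have hJ₂ : (⟨ν₂, hp₂⟩ : ProbabilityMeasure Ω) ∈ J := ⟨hK₂, hU₂.antisymm (by
    change m ≤ ν₂.real U
    by_contra! hlt
    nlinarith)⟩
  have heq := hext _ ⟨_, hJ₁, rfl⟩ _ ⟨_, hJ₂, rfl⟩
    ⟨a.toReal, b.toReal, ha0, hb0, hab', by
      ext f
      have hi : ∀ (κ : Measure Ω) [IsProbabilityMeasure κ], Integrable f κ := fun κ _ =>
        f.integrable κ
      change a.toReal * ∫ x, f x ∂ν₁ + b.toReal * ∫ x, f x ∂ν₂ = ∫ x, f x ∂(ν : Measure Ω)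
      rw [← hν12, integral_add_measure ((hi ν₁).smul_measure hatop) ((hi ν₂).smul_measure hbtop),
        integral_smul_measure, integral_smul_measure, smul_eq_mul, smul_eq_mul]⟩
  exact ext_of_forall_integral_eq_of_IsFiniteMeasure fun f => congrFun heq f

end ErgodicSelection

section Shift

/-- The shift on two-sided binary sequences. -/
def binaryShift : (ℤ → Bool) ≃ᵐ (ℤ → Bool) where
  toFun x n := x (n + 1)
  invFun x n := x (n - 1)
  left_inv x := by simp
  right_inv x := by simp
  measurable_toFun := measurable_pi_lambda _ fun _ => measurable_pi_apply _
  measurable_invFun := measurable_pi_lambda _ fun _ => measurable_pi_apply _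

theorem binaryShift_apply (x : ℤ → Bool) (n : ℤ) : binaryShift x n = x (n + 1) := rfl

theorem binaryShift_zpow_apply (k : ℤ) (x : ℤ → Bool) (n : ℤ) :
    (binaryShift.toEquiv ^ k) x n = x (n + k) := by
  induction k using Int.induction_on generalizing x with
  | zero => simp
  | succ i ih =>
    rw [zpow_add_one, Equiv.Perm.mul_apply, ih]
    change x (n + i + 1) = _
    rw [add_assoc]
  | pred i ih =>
    rw [zpow_sub_one, Equiv.Perm.mul_apply, ih]
    change x (n + -i - 1) = _
    rw [add_sub_assoc]

theorem continuous_binaryShift : Continuous binaryShift :=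
  continuous_pi fun _ => continuous_apply _

/-- The binary sequences with value `true` at the origin. -/
def trueAtZero : Set (ℤ → Bool) := {x | x 0 = true}

theorem isClopen_trueAtZero : IsClopen trueAtZero :=
  (isClopen_discrete {true}).preimage (continuous_apply (0 : ℤ))

theorem isClopen_returnSet (a : Finset ℕ) (n : ℕ) :
    IsClopen (returnSet binaryShift trueAtZero a n) := by
  refine isClopen_trueAtZero.inter (Set.Finite.isClopen_biInter a.finite_toSet fun d _ => ?_)
  refine isClopen_trueAtZero.preimage (continuous_pi fun m => ?_)
  simp_rw [binaryShift_zpow_apply]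
  exact continuous_apply _

variable {X : Type*} [MeasurableSpace X]

open scoped Classical in
/-- The itinerary of a point relative to the set `A`. -/
noncomputable def itinerary (T : X ≃ᵐ X) (A : Set X) (x : X) (n : ℤ) : Bool :=
  decide ((T.toEquiv ^ n) x ∈ A)

theorem itinerary_eq_true {T : X ≃ᵐ X} {A : Set X} {x : X} {n : ℤ} :
    itinerary T A x n = true ↔ (T.toEquiv ^ n) x ∈ A := by
  simp [itinerary]

theorem measurable_itinerary (T : X ≃ᵐ X) {A : Set X} (hA : MeasurableSet A) :
    Measurable (itinerary T A) := by
  refine measurable_pi_lambda _ fun n => measurable_to_bool ?_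
  have : (fun x => itinerary T A x n) ⁻¹' {true} = (T.toEquiv ^ n) ⁻¹' A := by
    ext x
    exact itinerary_eq_true
  rw [this]
  exact measurable_zpow T n hA

theorem itinerary_apply (T : X ≃ᵐ X) (A : Set X) (x : X) :
    itinerary T A (T x) = binaryShift (itinerary T A x) := by
  ext n
  rw [binaryShift_apply, itinerary, itinerary, zpow_add_one]
  rfl

theorem itinerary_preimage_trueAtZero (T : X ≃ᵐ X) (A : Set X) :
    itinerary T A ⁻¹' trueAtZero = A := by
  ext x
  exact itinerary_eq_true.trans (by simp)

theorem itinerary_preimage_returnSet (T : X ≃ᵐ X) (A : Set X) (a : Finset ℕ) (n : ℕ) :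
    itinerary T A ⁻¹' returnSet binaryShift trueAtZero a n = returnSet T A a n := by
  rw [returnSet, Set.preimage_inter, itinerary_preimage_trueAtZero, Set.preimage_iInter₂, returnSet]
  congr 1
  refine Set.iInter₂_congr fun d _ => ?_
  ext x
  change (binaryShift.toEquiv ^ ((n : ℤ) ^ d)) (itinerary T A x) 0 = true ↔ _
  rw [binaryShift_zpow_apply, zero_add]
  exact itinerary_eq_true

theorem measurePreserving_binaryShift_map_itinerary {μ : Measure X} {T : X ≃ᵐ X}
    (hT : MeasurePreserving T μ μ) {A : Set X} (hA : MeasurableSet A) :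
    MeasurePreserving binaryShift (μ.map (itinerary T A)) (μ.map (itinerary T A)) := by
  refine ⟨binaryShift.measurable, ?_⟩
  rw [Measure.map_map binaryShift.measurable (measurable_itinerary T hA)]
  have : binaryShift ∘ itinerary T A = itinerary T A ∘ T := by
    ext1 x
    exact (itinerary_apply T A x).symm
  rw [this, ← Measure.map_map (measurable_itinerary T hA) T.measurable, hT.map_eq]

end Shift

/-- Uniform multiple recurrence: finitely many times outside a Bohr-type neighbourhood suffice for
all sets of measure at least `δ`. -/
theorem exists_finset_returnSet_pos {a C : Finset ℕ} (ha : ∀ d ∈ a, 0 < d)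
    (hC : ∀ c ∈ C, 0 < c) (haC : Disjoint C a) {ω : Circle} (hω : ¬ IsOfFinOrder ω) {M : ℕ → ℕ}
    (hM : ∀ c, 0 < M c) (hMC : ∑ c ∈ C, 2 * (M c : ℝ)⁻¹ < 1) (n₀ : ℕ) {δ : ℝ} (hδ : 0 < δ) :
    ∃ F : Finset ℕ, (∀ n ∈ F, n₀ < n ∧ ∀ c ∈ C, fejer (M c) (ω ^ n ^ c) ≤ 1 / 2) ∧
      ∀ (X : Type) (_ : MeasurableSpace X) (μ : Measure X), IsProbabilityMeasure μ →
        ∀ T : X ≃ᵐ X, MeasurePreserving T μ μ → ∀ A : Set X, MeasurableSet A → δ ≤ μ.real A →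
          ∃ n ∈ F, 0 < μ (returnSet T A a n) := by
  classical
  by_contra hcon
  push Not at hcon
  set S : Set ℕ := {n | n₀ < n ∧ ∀ c ∈ C, fejer (M c) (ω ^ n ^ c) ≤ 1 / 2} with hS
  let K : ℕ → Set (ProbabilityMeasure (ℤ → Bool)) := fun N =>
    ({ν | MeasurePreserving binaryShift (ν : Measure (ℤ → Bool)) ν} ∩
      {ν | δ ≤ (ν : Measure (ℤ → Bool)).real trueAtZero}) ∩
      ⋂ n ∈ S ∩ Set.Iio N, {ν | (ν : Measure (ℤ → Bool)).real (returnSet binaryShift trueAtZero a n) = 0}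
  have hKc : ∀ N, IsClosed (K N) := fun N =>
    ((isClosed_measurePreserving continuous_binaryShift).inter
      (isClosed_le continuous_const (continuous_real_of_isClopen isClopen_trueAtZero))).inter
      (isClosed_biInter fun n _ =>
        isClosed_eq (continuous_real_of_isClopen (isClopen_returnSet a n)) continuous_const)
  have hKne : ∀ N, (K N).Nonempty := by
    intro N
    obtain ⟨X, _, μ, hμ, T, hT, A, hA, hδA, h⟩ := hcon ((Finset.range N).filter (· ∈ S))
      fun n hn => (Finset.mem_filter.1 hn).2
    have hφ := measurable_itinerary T hA
    refine ⟨⟨μ.map (itinerary T A), Measure.isProbabilityMeasure_map hφ.aemeasurable⟩,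
      ⟨measurePreserving_binaryShift_map_itinerary hT hA, ?_⟩, ?_⟩
    · change δ ≤ (μ.map (itinerary T A)).real trueAtZero
      rwa [map_measureReal_apply hφ isClopen_trueAtZero.isOpen.measurableSet, itinerary_preimage_trueAtZero]
    · refine Set.mem_iInter₂.2 fun n hn => ?_
      change (μ.map (itinerary T A)).real (returnSet binaryShift trueAtZero a n) = 0
      rw [map_measureReal_apply hφ (isClopen_returnSet a n).isOpen.measurableSet,
        itinerary_preimage_returnSet, Measure.real, nonpos_iff_eq_zero.1
          (h n (Finset.mem_filter.2 ⟨Finset.mem_range.2 hn.2, hn.1⟩)), ENNReal.toReal_zero]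
  have hanti : ∀ N, K (N + 1) ⊆ K N := fun N => Set.inter_subset_inter_right _
    (Set.biInter_subset_biInter_left fun n hn => ⟨hn.1, Nat.lt_succ_of_lt hn.2⟩)
  obtain ⟨ν, hν⟩ := IsCompact.nonempty_iInter_of_sequence_nonempty_isCompact_isClosed K hanti hKne
    (hKc 0).isCompact hKc
  rw [Set.mem_iInter] at hν
  obtain ⟨ν', hν', hB, hU⟩ := exists_ergodic_of_isClopen continuous_binaryShift
    (𝓑 := (fun n => returnSet binaryShift trueAtZero a n) '' S)
    (by rintro _ ⟨n, _, rfl⟩; exact isClopen_returnSet a n) isClopen_trueAtZero (hν 0).1.1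
    (by
      rintro _ ⟨n, hn, rfl⟩
      exact Set.mem_iInter₂.1 (hν (n + 1)).2 n ⟨hn, Nat.lt_succ_self n⟩)
    (hδ.trans_le (hν 0).1.2)
  obtain ⟨n, hn, hnC, hpos⟩ := hν'.exists_returnSet_pos isClopen_trueAtZero.isOpen.measurableSet
    (ENNReal.toReal_pos_iff.1 hU).1 ha hC haC hω hM hMC n₀
  exact (ENNReal.toReal_pos hpos.ne' (measure_ne_top _ _)).ne' (hB _ ⟨n, ⟨hn, hnC⟩, rfl⟩)

theorem Circle.not_isOfFinOrder_exp_one : ¬ IsOfFinOrder (Circle.exp 1) := by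
  rw [isOfFinOrder_iff_pow_eq_one]
  rintro ⟨n, hn, h⟩
  rw [← Circle.exp_nsmul, ← Circle.exp_zero, Circle.exp_eq_exp] at h
  obtain ⟨m, hm⟩ := h
  rw [zero_add, nsmul_eq_mul, mul_one] at hm
  have hn' : (n : ℝ) ≠ 0 := by exact_mod_cast hn.ne'
  have hm0 : (m : ℝ) ≠ 0 := by
    rintro h0
    rw [h0, zero_mul] at hm
    exact hn' hm
  refine irrational_pi ⟨(n : ℚ) / (m * 2), ?_⟩
  push_cast
  rw [hm]
  field_simp

theorem mulLeft_zpow_apply {K : Type*} [Group K] [MeasurableSpace K] [MeasurableMul K] (ω : K)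
    (k : ℤ) (x : K) : ((MeasurableEquiv.mulLeft ω).toEquiv ^ k) x = ω ^ k * x := by
  have h : (MeasurableEquiv.mulLeft ω).toEquiv = MulAction.toPermHom K K ω := rfl
  rw [h, ← map_zpow]
  rfl

/-- An irrational rotation obstructs recurrence along times whose powers move the rotation away
from the identity. -/
theorem not_goodForRecurrenceAlong {ℓ : ℕ} {a : Fin ℓ → ℕ} {R : Set ℕ} {ω : Circle} {M : ℕ → ℕ}
    (hM : ∀ c, 0 < M c)
    (hfin : {r ∈ R | ∀ i, 1 / 2 < fejer (M (a i)) (ω ^ r ^ a i)}.Finite) :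
    ¬ GoodForRecurrenceAlong ℓ (fun i n => (n : ℤ) ^ (a i)) R := by
  intro hgood
  let : MeasurableSpace Circle := borel Circle
  have : BorelSpace Circle := ⟨rfl⟩
  let μ : Measure Circle := Measure.haarMeasure ⊤
  have hμ : IsProbabilityMeasure μ := ⟨Measure.haarMeasure_self⟩
  have hV : (⋂ i, {z : Circle | 1 / 2 < fejer (M (a i)) z}) ∈ nhds (1 : Circle) := by
    refine Filter.iInter_mem.2 fun i => ?_
    refine (isOpen_lt continuous_const (continuous_fejer _)).mem_nhds ?_
    rw [Set.mem_ofPred_eq, fejer_one (hM _)]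
    norm_num
  obtain ⟨V, hV1, hVV⟩ := exists_nhds_split_inv hV
  refine hgood Circle _ μ hμ (MeasurableEquiv.mulLeft ω) (measurePreserving_mul_left μ ω)
    (interior V) isOpen_interior.measurableSet
    (isOpen_interior.measure_pos μ ⟨1, mem_interior_iff_mem_nhds.2 hV1⟩) (hfin.subset ?_)
  rintro r ⟨hr, hpos⟩
  refine ⟨hr, fun i => ?_⟩
  obtain ⟨x, hx, hxi⟩ := nonempty_of_measure_ne_zero hpos.ne'
  have h1 := Set.mem_iInter.1 hxi i
  rw [Set.mem_preimage, mulLeft_zpow_apply] at h1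
  have h2 := Set.mem_iInter.1 (hVV _ (interior_subset h1) _ (interior_subset hx)) i
  rw [mul_div_cancel_right] at h2
  exact_mod_cast h2

theorem sum_two_mul_inv_two_pow_lt_one {C : Finset ℕ} {k : ℕ} (hC : C ⊆ Finset.Icc 1 k) :
    ∑ c ∈ C, 2 * (((2 ^ (c + 2) : ℕ) : ℝ))⁻¹ < 1 := by
  have h : ∀ n : ℕ, ∑ c ∈ Finset.range n, 2 * (((2 ^ (c + 2) : ℕ) : ℝ))⁻¹ = 1 - (2 ^ n : ℝ)⁻¹ := by
    intro n
    induction n with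
    | zero => simp
    | succ n ih =>
      rw [Finset.sum_range_succ, ih]
      push_cast
      field_simp
      ring
  have hle : ∑ c ∈ C, 2 * (((2 ^ (c + 2) : ℕ) : ℝ))⁻¹ ≤
      ∑ c ∈ Finset.range (k + 1), 2 * (((2 ^ (c + 2) : ℕ) : ℝ))⁻¹ :=
    Finset.sum_le_sum_of_subset_of_nonneg
      (fun c hc => Finset.mem_range.2 (Nat.lt_succ_of_le (Finset.mem_Icc.1 (hC hc)).2))
      fun c _ _ => by positivity
  rw [h] at hle
  have : (0 : ℝ) < (2 ^ (k + 1) : ℝ)⁻¹ := by positivity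
  linarith

theorem returnSet_image {X : Type*} [MeasurableSpace X] {ℓ : ℕ} (T : X ≃ᵐ X) (A : Set X)
    (a : Fin ℓ → ℕ) (n : ℕ) : returnSet T A (Finset.univ.image a) n =
      A ∩ ⋂ i, (⇑(T.toEquiv ^ ((n : ℤ) ^ a i))) ⁻¹' A := by
  simp [returnSet]

theorem StrictMono.exists_apply_notMem_image {ℓ : ℕ} {a b : Fin ℓ → ℕ} (ha : StrictMono a)
    (hb : StrictMono b) (hab : a ≠ b) : ∃ i, a i ∉ Finset.univ.image b := by
  by_contra! h
  have hsub : Finset.univ.image a ⊆ Finset.univ.image b := Finset.image_subset_iff.2 fun i _ => h i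
  have heq := Finset.eq_of_subset_of_card_le hsub (by
    rw [Finset.card_image_of_injective _ ha.injective, Finset.card_image_of_injective _ hb.injective])
  refine hab ((ha.range_inj hb).1 ?_)
  simpa using congrArg (fun s : Finset ℕ => (s : Set ℕ)) heq

theorem statement4 (ℓ : ℕ) (hℓ : 0 < ℓ) (G : Set (Fin ℓ → ℕ))
    (hG : ∀ a ∈ G, StrictMono a ∧ ∀ i, 0 < a i) :
    ∃ R : Set ℕ, R.Infinite ∧ (∀ r ∈ R, 0 < r) ∧
      ∀ a : Fin ℓ → ℕ, StrictMono a → (∀ i, 0 < a i) →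
        (GoodForRecurrenceAlong ℓ (fun i n => (n : ℤ) ^ (a i)) R ↔ a ∈ G) := by
  obtain ⟨f, hf⟩ := (Set.to_countable
    (insert ∅ ((fun a : Fin ℓ → ℕ => Finset.univ.image a) '' G))).exists_eq_range
    (Set.insert_nonempty _ _)
  have hfpos : ∀ i, ∀ d ∈ f i, 0 < d := by
    intro i d hd
    rcases hf.symm.subset ⟨i, rfl⟩ with h | ⟨a, ha, h⟩
    · rw [h] at hd
      exact absurd hd (Finset.notMem_empty d)
    · rw [← h] at hd
      obtain ⟨j, _, rfl⟩ := Finset.mem_image.1 hd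
      exact (hG a ha).2 j
  set ω := Circle.exp 1
  set M : ℕ → ℕ := fun c => 2 ^ (c + 2)
  have hM : ∀ c, 0 < M c := fun c => by positivity
  choose F hFS hFrec using fun k : ℕ => exists_finset_returnSet_pos (hfpos k.unpair.1)
    (C := Finset.Icc 1 k \ f k.unpair.1)
    (fun c hc => (Finset.mem_Icc.1 (Finset.mem_sdiff.1 hc).1).1) Finset.sdiff_disjoint
    Circle.not_isOfFinOrder_exp_one hM (sum_two_mul_inv_two_pow_lt_one Finset.sdiff_subset) k
    (δ := ((k : ℝ) + 1)⁻¹) (by positivity)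
  refine ⟨⋃ k, (F k : Set ℕ), ?_, ?_, ?_⟩
  · refine Set.infinite_of_forall_exists_gt fun N => ?_
    obtain ⟨n, hn, _⟩ := hFrec N Unit _ (Measure.dirac ()) inferInstance (MeasurableEquiv.refl _)
      (MeasurePreserving.id _) Set.univ MeasurableSet.univ (by
        rw [probReal_univ]
        exact inv_le_one_of_one_le₀ (by linarith [N.cast_nonneg (α := ℝ)]))
    exact ⟨n, Set.mem_iUnion.2 ⟨N, hn⟩, (hFS N n hn).1⟩
  · intro r hr
    obtain ⟨k, hk⟩ := Set.mem_iUnion.1 hr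
    exact (Nat.zero_le k).trans_lt (hFS k r hk).1
  · intro a ha hapos
    constructor
    · intro hgood
      by_contra haG
      refine not_goodForRecurrenceAlong (ω := ω) hM (Set.Finite.subset
        ((Set.finite_Iio (Finset.univ.sup a)).biUnion fun k _ => (F k).finite_toSet) ?_) hgood
      rintro r ⟨hr, hri⟩
      obtain ⟨k, hk⟩ := Set.mem_iUnion.1 hr
      refine Set.mem_iUnion₂.2 ⟨k, ?_, hk⟩
      by_contra hka
      have hka' : Finset.univ.sup a ≤ k := not_lt.1 hka
      obtain ⟨i, hi⟩ : ∃ i, a i ∉ f k.unpair.1 := by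
        rcases hf.symm.subset ⟨k.unpair.1, rfl⟩ with h | ⟨b, hb, h⟩
        · rw [h]
          exact ⟨⟨0, hℓ⟩, Finset.notMem_empty _⟩
        · rw [← h]
          exact ha.exists_apply_notMem_image (hG b hb).1 fun hab => haG (hab ▸ hb)
      have h := (hFS k r hk).2 (a i) (Finset.mem_sdiff.2 ⟨Finset.mem_Icc.2
        ⟨hapos i, (Finset.le_sup (f := a) (Finset.mem_univ i)).trans hka'⟩, hi⟩)
      exact (hri i).not_ge h
    · intro haG X _ μ hμ T hT A hA hA0
      obtain ⟨i, hi⟩ := hf.subset (Set.mem_insert_of_mem _ ⟨a, haG, rfl⟩)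
      have hδ : 0 < μ.real A := ENNReal.toReal_pos hA0.ne' (measure_ne_top _ _)
      obtain ⟨j₀, hj₀⟩ := exists_nat_one_div_lt hδ
      refine Set.infinite_of_forall_exists_gt fun N => ?_
      set k := Nat.pair i (max N j₀)
      have hk : max N j₀ ≤ k := Nat.right_le_pair _ _
      have hjk : (j₀ : ℝ) ≤ k := by exact_mod_cast (le_max_right _ _).trans hk
      obtain ⟨n, hn, hpos⟩ := hFrec k X _ μ hμ T hT A hA (by
        refine le_trans ?_ hj₀.le
        rw [one_div]
        gcongr)
      refine ⟨n, ⟨Set.mem_iUnion.2 ⟨k, hn⟩, ?_⟩, ((le_max_left _ _).trans hk).trans_lt (hFS k n hn).1⟩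
      rw [Nat.unpair_pair, hi, returnSet_image] at hpos
      exact hpos
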